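/- Let p > 0 be a real number and let Ω ⊂ ℝ² be a bounded open set with C² boundary such that 0 ∉ ∂Ω. If equality holds in the inequality (|Ω|/π)^((p+1)/2) ≤ (1/(2π)) ∫_{∂Ω} |x|^p dσ(x), then Ω is an open disc centered at the origin. If in addition p ≥ 1, the same conclusion holds without the assumption 0 ∉ ∂Ω. -/

import Mathlib

open MeasureTheory Metric Real

/-- `Ω ⊂ ℝ²` has `C²` boundary: its topological boundary is a finite union of
images of periodic regular `C²` closed curves. -/
def HasC2Boundary (Ω : Set (EuclideanSpace ℝ (Fin 2))) : Prop :=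
  ∃ (n : ℕ) (γ : Fin n → ℝ → EuclideanSpace ℝ (Fin 2)),
    (∀ i, ContDiff ℝ 2 (γ i)) ∧ (∀ i, Function.Periodic (γ i) 1) ∧
    (∀ i t, deriv (γ i) t ≠ 0) ∧ frontier Ω = ⋃ i, Set.range (γ i)

section Helpers

open Set Filter Topology
open scoped ENNReal NNReal

lemma lip_piece {γ : ℝ → ℂ} {t0 : ℝ} {v : ℂ} (hγ : HasStrictDerivAt γ v t0) (hv : v ≠ 0)
    {f : ℂ → ℝ} {f' : ℂ →L[ℝ] ℝ} (hf : HasStrictFDerivAt f f' (γ t0)) {ε : ℝ} (hε : 0 < ε) :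
    ∃ U ∈ 𝓝 t0, ∀ t ∈ U, ∀ t' ∈ U,
      |f (γ t) - f (γ t')| ≤ (|f' v| / ‖v‖ + ε) * ‖γ t - γ t'‖ := by
  have hv' : 0 < ‖v‖ := norm_pos_iff.mpr hv
  set d := f' v with hd
  have hK : 0 < 1 + |d| / ‖v‖ + ε := by positivity
  set c := ε * ‖v‖ / (1 + |d| / ‖v‖ + ε) with hc
  have hcpos : 0 < c := by positivity
  have h1 : HasStrictDerivAt (f ∘ γ) d t0 := hf.comp_hasStrictDerivAt t0 hγ
  have e1 := (hasStrictDerivAt_iff_hasStrictFDerivAt.mp h1).isLittleO.def hcpos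
  have e2 := (hasStrictDerivAt_iff_hasStrictFDerivAt.mp hγ).isLittleO.def hcpos
  have e := e1.and e2
  rw [nhds_prod_eq] at e
  obtain ⟨U, hU, hUU⟩ := Filter.mem_prod_self_iff.mp e
  refine ⟨U, hU, fun t ht t' ht' => ?_⟩
  obtain ⟨a1, a2⟩ := hUU (mk_mem_prod ht ht')
  simp only [ContinuousLinearMap.toSpanSingleton_apply, Function.comp, smul_eq_mul, Real.norm_eq_abs] at a1 a2
  have b1 : |f (γ t) - f (γ t')| ≤ (|d| + c) * |t - t'| := by
    have := abs_sub_abs_le_abs_sub (f (γ t) - f (γ t')) ((t - t') * d)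
    rw [abs_mul] at this
    nlinarith
  have b2 : (‖v‖ - c) * |t - t'| ≤ ‖γ t - γ t'‖ := by
    have := norm_sub_norm_le ((t - t') • v) (γ t - γ t')
    rw [norm_smul, norm_sub_rev ((t - t') • v), Real.norm_eq_abs] at this
    nlinarith
  have hkey : |d| + c ≤ (|d| / ‖v‖ + ε) * (‖v‖ - c) := by
    have : c * (1 + |d| / ‖v‖ + ε) = ε * ‖v‖ := by rw [hc]; field_simp
    have h3 : |d| / ‖v‖ * ‖v‖ = |d| := by field_simp
    nlinarith
  calc |f (γ t) - f (γ t')| ≤ (|d| + c) * |t - t'| := b1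
    _ ≤ (|d| / ‖v‖ + ε) * (‖v‖ - c) * |t - t'| := by gcongr
    _ = (|d| / ‖v‖ + ε) * ((‖v‖ - c) * |t - t'|) := by ring
    _ ≤ _ := by gcongr

lemma vol_image_le {f : ℂ → ℝ} {E : Set ℂ} {L : ℝ} (hL : 0 ≤ L)
    (h : ∀ z ∈ E, ∀ w ∈ E, |f z - f w| ≤ L * ‖z - w‖) :
    volume (f '' E) ≤ ENNReal.ofReal L * μH[1] E := by
  have : LipschitzOnWith (Real.toNNReal L) f E := by
    apply LipschitzOnWith.of_dist_le_mul
    intro z hz w hw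
    rw [Real.dist_eq, dist_eq_norm, Real.coe_toNNReal _ hL]
    exact h z hz w hw
  have h2 := this.hausdorffMeasure_image_le (d := 1) zero_le_one
  rw [hausdorffMeasure_real] at h2
  simpa [ENNReal.ofReal] using h2

lemma arg_split {z z0 : ℂ} (hz : z ≠ 0) (hz0 : z0 ≠ 0) :
    z.arg - (z / z0).arg - z0.arg = 0 ∨ z.arg - (z / z0).arg - z0.arg = 2 * Real.pi ∨
    z.arg - (z / z0).arg - z0.arg = - (2 * Real.pi) := by
  have h := Complex.arg_div_coe_angle hz hz0
  rw [← Real.Angle.coe_sub, Real.Angle.angle_eq_iff_two_pi_dvd_sub] at h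
  obtain ⟨k, hk⟩ := h
  have p := Real.pi_pos
  have a1 := Complex.neg_pi_lt_arg z
  have a2 := Complex.arg_le_pi z
  have a3 := Complex.neg_pi_lt_arg z0
  have a4 := Complex.arg_le_pi z0
  have a5 := Complex.neg_pi_lt_arg (z / z0)
  have a6 := Complex.arg_le_pi (z / z0)
  have k1 : -2 < (k : ℝ) := by
    by_contra hh
    nlinarith
  have k2 : (k : ℝ) < 2 := by
    by_contra hh
    nlinarith
  have k1' : -2 < k := by exact_mod_cast k1
  have k2' : k < 2 := by exact_mod_cast k2
  have : k = -1 ∨ k = 0 ∨ k = 1 := by omega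
  rcases this with rfl | rfl | rfl
  · right; left; push_cast at hk; linarith
  · left; push_cast at hk; linarith
  · right; right; push_cast at hk; linarith

lemma vol_arg_le {E : Set ℂ} (hE : MeasurableSet E) (h0 : (0 : ℂ) ∉ E) {z0 : ℂ} (hz0 : z0 ≠ 0)
    {L : ℝ} (hL : 0 ≤ L)
    (h : ∀ z ∈ E, ∀ w ∈ E, |(z / z0).arg - (w / z0).arg| ≤ L * ‖z - w‖) :
    volume (Complex.arg '' E) ≤ ENNReal.ofReal L * μH[1] E := by
  set D : ℂ → ℝ := fun z => z.arg - (z / z0).arg - z0.arg with hD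
  have hDm : Measurable D := by
    have : Measurable fun z : ℂ => (z / z0).arg :=
      Complex.measurable_arg.comp (measurable_id.div_const z0)
    exact (Complex.measurable_arg.sub this).sub_const _
  have key : ∀ c : ℝ, volume (Complex.arg '' (E ∩ D ⁻¹' {c})) ≤
      ENNReal.ofReal L * μH[1] (E ∩ D ⁻¹' {c}) := by
    intro c
    apply vol_image_le hL
    rintro z ⟨hz, hzc⟩ w ⟨hw, hwc⟩
    have e1 : D z = c := hzc
    have e2 : D w = c := hwc
    have : z.arg - w.arg = (z / z0).arg - (w / z0).arg := by
      simp only [hD] at e1 e2; linarith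
    rw [this]; exact h z hz w hw
  have p := Real.pi_pos
  have hcov : E ⊆ (E ∩ D ⁻¹' {0}) ∪ ((E ∩ D ⁻¹' {2 * Real.pi}) ∪ (E ∩ D ⁻¹' {-(2 * Real.pi)})) := by
    intro z hz
    rcases arg_split (z := z) (fun h => h0 (h ▸ hz)) hz0 with h | h | h
    · left; exact ⟨hz, h⟩
    · right; left; exact ⟨hz, h⟩
    · right; right; exact ⟨hz, h⟩
  have m : ∀ c : ℝ, MeasurableSet (E ∩ D ⁻¹' {c}) := fun c => hE.inter (hDm (measurableSet_singleton c))
  have d1 : ∀ c c' : ℝ, c ≠ c' → Disjoint (E ∩ D ⁻¹' {c}) (E ∩ D ⁻¹' {c'}) := by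
    intro c c' hcc
    rw [Set.disjoint_left]
    rintro z ⟨_, h1⟩ ⟨_, h2⟩
    exact hcc (h1.symm.trans h2)
  calc volume (Complex.arg '' E) ≤ volume (Complex.arg '' ((E ∩ D ⁻¹' {0}) ∪
        ((E ∩ D ⁻¹' {2 * Real.pi}) ∪ (E ∩ D ⁻¹' {-(2 * Real.pi)})))) := measure_mono (image_mono hcov)
    _ ≤ volume (Complex.arg '' (E ∩ D ⁻¹' {0})) + (volume (Complex.arg '' (E ∩ D ⁻¹' {2 * Real.pi}))
        + volume (Complex.arg '' (E ∩ D ⁻¹' {-(2 * Real.pi)}))) := by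
      rw [image_union, image_union]
      refine (measure_union_le _ _).trans ?_
      gcongr
      exact measure_union_le _ _
    _ ≤ ENNReal.ofReal L * (μH[1] (E ∩ D ⁻¹' {0}) + (μH[1] (E ∩ D ⁻¹' {2 * Real.pi})
        + μH[1] (E ∩ D ⁻¹' {-(2 * Real.pi)}))) := by
      rw [mul_add, mul_add]
      gcongr <;> apply key
    _ = ENNReal.ofReal L * μH[1] ((E ∩ D ⁻¹' {0}) ∪
        ((E ∩ D ⁻¹' {2 * Real.pi}) ∪ (E ∩ D ⁻¹' {-(2 * Real.pi)}))) := by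
      rw [measure_union _ ((m _).union (m _)), measure_union _ (m _)]
      · apply d1; intro h; linarith
      · rw [Set.disjoint_union_right]
        constructor <;> apply d1 <;> intro h <;> linarith
    _ ≤ _ := by
      gcongr
      intro z hz
      rcases hz with h | h | h <;> exact h.1

/-- Local inequality on a small arc. -/
lemma piece_ineq {γ : ℝ → ℂ} {t0 : ℝ} {v : ℂ} (hγ : HasStrictDerivAt γ v t0) (hv : v ≠ 0)
    (h0 : γ t0 ≠ 0) {p : ℝ} {A G : ℝ → ℝ} (hA : Continuous A) (hG : Continuous G)
    (hA0 : ∀ r, 0 ≤ A r) (hG0 : ∀ r, 0 ≤ G r)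
    (hAG : A ‖γ t0‖ ^ 2 + G ‖γ t0‖ ^ 2 ≤ (‖γ t0‖ ^ p * ‖γ t0‖) ^ 2)
    {η δ : ℝ} (hη : 0 < η) (hδ : 0 < δ) :
    ∃ U ∈ 𝓝 t0, ∃ a g : ℝ, 0 ≤ a ∧ 0 ≤ g ∧ (∀ t ∈ U, A ‖γ t‖ ≤ a ∧ G ‖γ t‖ ≤ g ∧ γ t ≠ 0 ∧
        ∀ t' ∈ U, dist (γ t) (γ t') ≤ δ) ∧
      ∀ E ⊆ γ '' U, MeasurableSet E →
        ENNReal.ofReal a * volume ((fun z : ℂ => Real.log ‖z‖) '' E) +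
          ENNReal.ofReal g * volume (Complex.arg '' E) ≤
        ENNReal.ofReal (1 + η) * ∫⁻ z in E, ENNReal.ofReal (‖z‖ ^ p) ∂μH[1] := by
  set z0 := γ t0 with hz0
  set r0 := ‖z0‖ with hr0
  have hr0pos : 0 < r0 := norm_pos_iff.mpr h0
  have hv' : 0 < ‖v‖ := norm_pos_iff.mpr hv
  set L := |(v / z0).re| / ‖v‖ with hL
  set L' := |(v / z0).im| / ‖v‖ with hL'
  have hLL : L ^ 2 + L' ^ 2 = 1 / r0 ^ 2 := by
    rw [hL, hL', div_pow, div_pow, sq_abs, sq_abs, ← add_div]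
    have : (v / z0).re ^ 2 + (v / z0).im ^ 2 = ‖v / z0‖ ^ 2 := by
      rw [Complex.sq_norm, Complex.normSq_apply]; ring
    rw [this, norm_div]
    field_simp
    rw [hr0]
  have hL0 : 0 ≤ L := by positivity
  have hL0' : 0 ≤ L' := by positivity
  have hrp : 0 < r0 ^ p := Real.rpow_pos_of_pos hr0pos p
  have hCS : A r0 * L + G r0 * L' ≤ r0 ^ p := by
    have h1 : (A r0 * L + G r0 * L') ^ 2 ≤ (r0 ^ p) ^ 2 := by
      calc (A r0 * L + G r0 * L') ^ 2 ≤ (A r0 ^ 2 + G r0 ^ 2) * (L ^ 2 + L' ^ 2) := by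
            nlinarith [sq_nonneg (A r0 * L' - G r0 * L)]
        _ ≤ (r0 ^ p * r0) ^ 2 * (L ^ 2 + L' ^ 2) := by gcongr
        _ = (r0 ^ p) ^ 2 := by rw [hLL]; field_simp
    exact (abs_le_of_sq_le_sq' h1 hrp.le).2
  -- choice of ε
  obtain ⟨ε, hε, hεineq⟩ : ∃ ε > 0, (A r0 + ε) * (L + ε) + (G r0 + ε) * (L' + ε) <
      (1 + η) * (r0 ^ p - ε) := by
    have hc : Continuous fun ε : ℝ => (1 + η) * (r0 ^ p - ε) -
      ((A r0 + ε) * (L + ε) + (G r0 + ε) * (L' + ε)) := by fun_prop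
    have hpos : 0 < (fun ε : ℝ => (1 + η) * (r0 ^ p - ε) -
      ((A r0 + ε) * (L + ε) + (G r0 + ε) * (L' + ε))) 0 := by
      simp only [sub_zero, add_zero]; nlinarith [mul_pos hη hrp]
    have := (hc.tendsto 0).eventually (lt_mem_nhds hpos)
    have h2 : ∀ᶠ ε in 𝓝[>] (0 : ℝ), 0 < (fun ε : ℝ => (1 + η) * (r0 ^ p - ε) -
      ((A r0 + ε) * (L + ε) + (G r0 + ε) * (L' + ε))) ε := nhdsWithin_le_nhds this
    obtain ⟨ε, h3, h4⟩ := (h2.and self_mem_nhdsWithin).exists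
    exact ⟨ε, h4, by simpa using h3⟩
  have hrε : 0 < r0 ^ p - ε := by
    have : 0 ≤ (A r0 + ε) * (L + ε) + (G r0 + ε) * (L' + ε) := by
      have := hA0 r0; have := hG0 r0; positivity
    have h2 : 0 < (1 + η) * (r0 ^ p - ε) := by linarith
    exact pos_of_mul_pos_right h2 (by positivity)
  -- strict derivative of log (z / z0)
  have hd : HasStrictDerivAt (fun z : ℂ => Complex.log (z / z0)) (1 / z0 / (z0 / z0)) z0 := by
    apply HasStrictDerivAt.clog
    · exact (hasStrictDerivAt_id z0).div_const z0
    · rw [div_self h0]; exact Complex.one_mem_slitPlane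
  rw [div_self h0, div_one] at hd
  have hfd := hd.complexToReal_fderiv
  have hre : HasStrictFDerivAt (fun z : ℂ => (Complex.log (z / z0)).re) _ (γ t0) :=
    Complex.reCLM.hasStrictFDerivAt.comp z0 hfd
  have him : HasStrictFDerivAt (fun z : ℂ => (Complex.log (z / z0)).im) _ (γ t0) :=
    Complex.imCLM.hasStrictFDerivAt.comp z0 hfd
  obtain ⟨U1, hU1, l1⟩ := lip_piece hγ hv hre hε
  obtain ⟨U2, hU2, l2⟩ := lip_piece hγ hv him hε
  have hγc : ContinuousAt γ t0 := hγ.hasDerivAt.continuousAt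
  have hnc : ContinuousAt (fun t => ‖γ t‖) t0 := hγc.norm
  have e1 : ∀ᶠ t in 𝓝 t0, A ‖γ t‖ < A r0 + ε :=
    (hA.continuousAt.comp_of_eq hnc rfl).eventually_lt continuousAt_const (by
      simp only [Function.comp]; change A r0 < A r0 + ε; linarith)
  have e2 : ∀ᶠ t in 𝓝 t0, G ‖γ t‖ < G r0 + ε :=
    (hG.continuousAt.comp_of_eq hnc rfl).eventually_lt continuousAt_const (by
      simp only [Function.comp]; change G r0 < G r0 + ε; linarith)
  have e3 : ∀ᶠ t in 𝓝 t0, r0 ^ p - ε < ‖γ t‖ ^ p := by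
    have : ContinuousAt (fun t => ‖γ t‖ ^ p) t0 := hnc.rpow_const (Or.inl hr0pos.ne')
    apply continuousAt_const.eventually_lt this
    change r0 ^ p - ε < r0 ^ p; linarith
  have e4 : ∀ᶠ t in 𝓝 t0, γ t ≠ 0 := hγc.eventually_ne h0
  have e5 : ∀ᶠ t in 𝓝 t0, dist (γ t) z0 < δ / 2 :=
    (Metric.tendsto_nhds.mp hγc.tendsto) (δ / 2) (by positivity)
  refine ⟨U1 ∩ U2 ∩ {t | A ‖γ t‖ < A r0 + ε ∧ G ‖γ t‖ < G r0 + ε ∧ r0 ^ p - ε < ‖γ t‖ ^ p ∧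
    γ t ≠ 0 ∧ dist (γ t) z0 < δ / 2}, ?_, A r0 + ε, G r0 + ε, ?_, ?_, ?_, ?_⟩
  · exact Filter.inter_mem (Filter.inter_mem hU1 hU2) (e1.and (e2.and (e3.and (e4.and e5))))
  · have := hA0 r0; positivity
  · have := hG0 r0; positivity
  · rintro t ⟨_, h1, h2, h3, h4, h5⟩
    refine ⟨h1.le, h2.le, h4, ?_⟩
    rintro t' ⟨_, h1', h2', h3', h4', h5'⟩
    have := dist_triangle_right (γ t) (γ t') z0
    linarith
  · intro E hE hEm
    have hEn0 : (0 : ℂ) ∉ E := by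
      intro h
      obtain ⟨t, ht, h2⟩ := hE h
      exact ht.2.2.2.2.1 h2
    have q1 : volume ((fun z : ℂ => Real.log ‖z‖) '' E) ≤ ENNReal.ofReal (L + ε) * μH[1] E := by
      apply vol_image_le (by positivity)
      intro z hz w hw
      obtain ⟨t, ht, rfl⟩ := hE hz
      obtain ⟨t', ht', rfl⟩ := hE hw
      have := l1 t ht.1.1 t' ht'.1.1
      have e : ∀ s, γ s ≠ 0 → (Complex.log (γ s / z0)).re = Real.log ‖γ s‖ - Real.log r0 := by
        intro s hs
        rw [Complex.log_re, norm_div, Real.log_div (norm_ne_zero_iff.mpr hs) hr0pos.ne']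
      rw [e _ ht.2.2.2.2.1, e _ ht'.2.2.2.2.1] at this
      have e' : (Complex.reCLM.comp ((1 / z0) • (1 : ℂ →L[ℝ] ℂ))) v = (v / z0).re := by
        simp [div_eq_inv_mul]
      rw [e'] at this
      rwa [sub_sub_sub_cancel_right] at this
    have q2 : volume (Complex.arg '' E) ≤ ENNReal.ofReal (L' + ε) * μH[1] E := by
      apply vol_arg_le hEm hEn0 h0 (by positivity)
      intro z hz w hw
      obtain ⟨t, ht, rfl⟩ := hE hz
      obtain ⟨t', ht', rfl⟩ := hE hw
      have := l2 t ht.1.2 t' ht'.1.2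
      simp only [Complex.log_im] at this
      have e' : (Complex.imCLM.comp ((1 / z0) • (1 : ℂ →L[ℝ] ℂ))) v = (v / z0).im := by
        simp [div_eq_inv_mul]
      rw [e'] at this
      exact this
    have q3 : ENNReal.ofReal (r0 ^ p - ε) * μH[1] E ≤
        ∫⁻ z in E, ENNReal.ofReal (‖z‖ ^ p) ∂μH[1] := by
      rw [← setLIntegral_const]
      apply setLIntegral_mono' hEm
      intro z hz
      obtain ⟨t, ht, rfl⟩ := hE hz
      exact ENNReal.ofReal_le_ofReal ht.2.2.2.1.le
    have hAr := hA0 r0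
    have hGr := hG0 r0
    calc _ ≤ ENNReal.ofReal (A r0 + ε) * (ENNReal.ofReal (L + ε) * μH[1] E) +
          ENNReal.ofReal (G r0 + ε) * (ENNReal.ofReal (L' + ε) * μH[1] E) := by gcongr
      _ = ENNReal.ofReal ((A r0 + ε) * (L + ε) + (G r0 + ε) * (L' + ε)) * μH[1] E := by
        rw [ENNReal.ofReal_add (p := (A r0 + ε) * (L + ε)) (by positivity) (by positivity),
          ENNReal.ofReal_mul (p := A r0 + ε) (by positivity),
          ENNReal.ofReal_mul (p := G r0 + ε) (by positivity)]
        ring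
      _ ≤ ENNReal.ofReal ((1 + η) * (r0 ^ p - ε)) * μH[1] E := by
        gcongr
      _ = ENNReal.ofReal (1 + η) * (ENNReal.ofReal (r0 ^ p - ε) * μH[1] E) := by
        rw [ENNReal.ofReal_mul (by positivity), mul_assoc]
      _ ≤ _ := by gcongr

/-- The covering property used in the slicing lemma. -/
def Sliceable (p : ℝ) (A G : ℝ → ℝ) (η δ : ℝ) (T : Set ℂ) : Prop :=
  ∃ T' : Set ℂ, MeasurableSet T' ∧ T ⊆ T' ∧ ∀ E ⊆ T', MeasurableSet E →
    ∃ f F : ℝ → ℝ≥0∞, Measurable f ∧ Measurable F ∧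
      (∫⁻ x, f x) + (∫⁻ x, F x) ≤
        ENNReal.ofReal (1 + η) * ∫⁻ z in E, ENNReal.ofReal (‖z‖ ^ p) ∂μH[1] ∧
      (∀ (P : Finset ℂ), (↑P : Set ℂ) ⊆ E → (∀ x ∈ P, ∀ y ∈ P, x ≠ y → δ < dist x y) →
        (∀ ξ, (∀ x ∈ P, Real.log ‖x‖ = ξ) → ∑ x ∈ P, ENNReal.ofReal (A ‖x‖) ≤ f ξ) ∧
        (∀ θ, (∀ x ∈ P, Complex.arg x = θ) → ∑ x ∈ P, ENNReal.ofReal (G ‖x‖) ≤ F θ))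

lemma Sliceable.empty {p A G η δ} : Sliceable p A G η δ ∅ := by
  refine ⟨∅, MeasurableSet.empty, subset_rfl, ?_⟩
  intro E hE _
  obtain rfl := subset_empty_iff.mp hE
  refine ⟨0, 0, measurable_const, measurable_const, by simp, ?_⟩
  intro P hP _
  have : P = ∅ := by
    rw [← Finset.coe_eq_empty]; exact subset_empty_iff.mp hP
  subst this
  simp

lemma Sliceable.mono {p A G η δ} {S T : Set ℂ} (h : S ⊆ T) (hT : Sliceable p A G η δ T) :
    Sliceable p A G η δ S := by
  obtain ⟨T', h1, h2, h3⟩ := hT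
  exact ⟨T', h1, h.trans h2, h3⟩

lemma Sliceable.union {p A G η δ} {S T : Set ℂ} (hS : Sliceable p A G η δ S)
    (hT : Sliceable p A G η δ T) : Sliceable p A G η δ (S ∪ T) := by
  classical
  obtain ⟨S', s1, s2, s3⟩ := hS
  obtain ⟨T', t1, t2, t3⟩ := hT
  refine ⟨S' ∪ T', s1.union t1, union_subset_union s2 t2, ?_⟩
  intro E hE hEm
  obtain ⟨f1, F1, m1, n1, i1, c1⟩ := s3 (E ∩ S') inter_subset_right (hEm.inter s1)
  obtain ⟨f2, F2, m2, n2, i2, c2⟩ := t3 (E \ S')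
    (by intro x hx; exact (hE hx.1).resolve_left hx.2) (hEm.diff s1)
  refine ⟨f1 + f2, F1 + F2, m1.add m2, n1.add n2, ?_, ?_⟩
  · simp only [Pi.add_apply]
    rw [lintegral_add_left m1, lintegral_add_left n1, ← lintegral_inter_add_sdiff _ E s1, mul_add]
    calc _ = (∫⁻ x, f1 x) + (∫⁻ x, F1 x) + ((∫⁻ x, f2 x) + (∫⁻ x, F2 x)) := by ring
      _ ≤ _ := add_le_add i1 i2
  · intro P hP hsep
    have hP1 : (↑(P.filter (· ∈ S')) : Set ℂ) ⊆ E ∩ S' := by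
      intro x hx
      simp only [Finset.coe_filter, mem_ofPred_eq] at hx
      exact ⟨hP hx.1, hx.2⟩
    have hP2 : (↑(P.filter (¬ · ∈ S')) : Set ℂ) ⊆ E \ S' := by
      intro x hx
      simp only [Finset.coe_filter, mem_ofPred_eq] at hx
      exact ⟨hP hx.1, hx.2⟩
    have u1 := c1 _ hP1 (fun x hx y hy => hsep x (Finset.mem_of_mem_filter _ hx) y
      (Finset.mem_of_mem_filter _ hy))
    have u2 := c2 _ hP2 (fun x hx y hy => hsep x (Finset.mem_of_mem_filter _ hx) y
      (Finset.mem_of_mem_filter _ hy))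
    constructor
    · intro ξ hξ
      rw [← Finset.sum_filter_add_sum_filter_not P (· ∈ S')]
      exact add_le_add (u1.1 ξ fun x hx => hξ x (Finset.mem_of_mem_filter _ hx))
        (u2.1 ξ fun x hx => hξ x (Finset.mem_of_mem_filter _ hx))
    · intro ξ hξ
      rw [← Finset.sum_filter_add_sum_filter_not P (· ∈ S')]
      exact add_le_add (u1.2 ξ fun x hx => hξ x (Finset.mem_of_mem_filter _ hx))
        (u2.2 ξ fun x hx => hξ x (Finset.mem_of_mem_filter _ hx))

lemma Sliceable.piece {γ : ℝ → ℂ} (hγ1 : ContDiff ℝ 1 γ) {t0 : ℝ} (hv : deriv γ t0 ≠ 0)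
    (h0 : γ t0 ≠ 0) {p : ℝ} {A G : ℝ → ℝ} (hA : Continuous A) (hG : Continuous G)
    (hA0 : ∀ r, 0 ≤ A r) (hG0 : ∀ r, 0 ≤ G r)
    (hAG : A ‖γ t0‖ ^ 2 + G ‖γ t0‖ ^ 2 ≤ (‖γ t0‖ ^ p * ‖γ t0‖) ^ 2)
    {η δ : ℝ} (hη : 0 < η) (hδ : 0 < δ) :
    ∃ U ∈ 𝓝 t0, Sliceable p A G η δ (γ '' U) := by
  have hγ : HasStrictDerivAt γ (deriv γ t0) t0 :=
    (hγ1.contDiffAt).hasStrictDerivAt one_ne_zero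
  obtain ⟨U, hU, a, g, ha, hg, hpt, hintg⟩ := piece_ineq hγ hv h0 hA hG hA0 hG0 hAG hη hδ
  obtain ⟨ε, hε, hball⟩ := Metric.nhds_basis_closedBall.mem_iff.mp hU
  refine ⟨Metric.closedBall t0 ε, Metric.closedBall_mem_nhds t0 hε, γ '' Metric.closedBall t0 ε, ?_,
    subset_rfl, ?_⟩
  · exact ((isCompact_closedBall t0 ε).image hγ1.continuous).measurableSet
  intro E hE hEm
  have hEU : E ⊆ γ '' U := hE.trans (image_mono hball)
  set X := toMeasurable volume ((fun z : ℂ => Real.log ‖z‖) '' E) with hX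
  set Y := toMeasurable volume (Complex.arg '' E) with hY
  have hXm : MeasurableSet X := measurableSet_toMeasurable _ _
  have hYm : MeasurableSet Y := measurableSet_toMeasurable _ _
  refine ⟨X.indicator fun _ => ENNReal.ofReal a, Y.indicator fun _ => ENNReal.ofReal g,
    measurable_const.indicator hXm, measurable_const.indicator hYm, ?_, ?_⟩
  · rw [lintegral_indicator_const hXm, lintegral_indicator_const hYm, hX, hY,
      measure_toMeasurable, measure_toMeasurable]
    exact hintg E hEU hEm
  · intro P hP hsep
    have hsub : ∀ x ∈ P, ∀ y ∈ P, x = y := by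
      intro x hx y hy
      by_contra hne
      have h1 := hsep x hx y hy hne
      obtain ⟨t, ht, rfl⟩ := hEU (hP hx)
      obtain ⟨t', ht', rfl⟩ := hEU (hP hy)
      exact absurd ((hpt t ht).2.2.2 t' ht') (not_le.mpr h1)
    rcases P.eq_empty_or_nonempty with rfl | ⟨x, hx⟩
    · simp
    have hPx : P = {x} := by
      ext y; simp only [Finset.mem_singleton]
      exact ⟨fun hy => hsub y hy x hx, fun h => h ▸ hx⟩
    subst hPx
    simp only [Finset.sum_singleton, Finset.mem_singleton, forall_eq]
    obtain ⟨t, ht, hxt⟩ := hEU (hP hx)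
    obtain ⟨b1, b2, _⟩ := hpt t ht
    rw [hxt] at b1 b2
    constructor
    · rintro ξ rfl
      have : Real.log ‖x‖ ∈ X := subset_toMeasurable _ _ ⟨x, hP hx, rfl⟩
      rw [indicator_of_mem this]
      exact ENNReal.ofReal_le_ofReal b1
    · rintro ξ rfl
      have : Complex.arg x ∈ Y := subset_toMeasurable _ _ ⟨x, hP hx, rfl⟩
      rw [indicator_of_mem this]
      exact ENNReal.ofReal_le_ofReal b2

/-- A finite family of regular closed C¹ curves. -/
structure RegCurves {n : ℕ} (γ : Fin n → ℝ → ℂ) (Γ : Set ℂ) : Prop where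
  smooth : ∀ i, ContDiff ℝ 1 (γ i)
  per : ∀ i, Function.Periodic (γ i) 1
  reg : ∀ i t, deriv (γ i) t ≠ 0
  eq : Γ = ⋃ i, range (γ i)

lemma RegCurves.range_eq {n : ℕ} {γ : Fin n → ℝ → ℂ} {Γ : Set ℂ} (h : RegCurves γ Γ) (i : Fin n) :
    range (γ i) = γ i '' Icc 0 1 := by
  have := (h.per i).image_Icc zero_lt_one 0
  rw [zero_add] at this
  exact this.symm

lemma RegCurves.isCompact {n : ℕ} {γ : Fin n → ℝ → ℂ} {Γ : Set ℂ} (h : RegCurves γ Γ) :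
    IsCompact Γ := by
  rw [h.eq]
  apply isCompact_iUnion
  intro i
  rw [h.range_eq]
  exact isCompact_Icc.image (h.smooth i).continuous

lemma liminf_add_le_ennreal (u v : ℕ → ℝ≥0∞) :
    liminf u atTop + liminf v atTop ≤ liminf (fun n => u n + v n) atTop := by
  simp only [liminf_eq_iSup_iInf_of_nat]
  rw [ENNReal.iSup_add_iSup_of_monotone]
  · gcongr with n
    refine le_iInf₂ fun i hi => add_le_add (iInf₂_le i hi) (iInf₂_le i hi)
  · intro a b hab
    exact le_iInf₂ fun i hi => iInf₂_le i (hab.trans hi)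
  · intro a b hab
    exact le_iInf₂ fun i hi => iInf₂_le i (hab.trans hi)

/-- Slicing lemma. -/
lemma slicing {n : ℕ} {γ : Fin n → ℝ → ℂ} {Γ : Set ℂ} (h : RegCurves γ Γ) {p : ℝ}
    {S : Set ℂ} (hSc : IsClosed S) (hSΓ : S ⊆ Γ) (hS0 : (0 : ℂ) ∉ S)
    {A G : ℝ → ℝ} (hA : Continuous A) (hG : Continuous G)
    (hA0 : ∀ r, 0 ≤ A r) (hG0 : ∀ r, 0 ≤ G r)
    (hAG : ∀ z ∈ S, A ‖z‖ ^ 2 + G ‖z‖ ^ 2 ≤ (‖z‖ ^ p * ‖z‖) ^ 2)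
    (ψ φ : ℝ → ℝ≥0∞)
    (hψ : ∀ᵐ ξ, ∃ P : Finset ℂ, (↑P : Set ℂ) ⊆ S ∧ (∀ x ∈ P, Real.log ‖x‖ = ξ) ∧
      ψ ξ ≤ ∑ x ∈ P, ENNReal.ofReal (A ‖x‖))
    (hφ : ∀ᵐ θ, θ ∈ Ioo (-π) π → ∃ P : Finset ℂ, (↑P : Set ℂ) ⊆ S ∧
      (∀ x ∈ P, Complex.arg x = θ) ∧ φ θ ≤ ∑ x ∈ P, ENNReal.ofReal (G ‖x‖)) :
    (∫⁻ ξ, ψ ξ) + (∫⁻ θ in Ioo (-π) π, φ θ) ≤ ∫⁻ z in S, ENNReal.ofReal (‖z‖ ^ p) ∂μH[1] := by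
  have hslice : ∀ η > 0, ∀ δ > 0, Sliceable p A G η δ S := by
    intro η hη δ hδ
    have hi : ∀ i, Sliceable p A G η δ (γ i '' (Icc 0 1 ∩ γ i ⁻¹' S)) := by
      intro i
      have hK : IsCompact (Icc 0 1 ∩ γ i ⁻¹' S) :=
        isCompact_Icc.inter_right (hSc.preimage (h.smooth i).continuous)
      refine hK.induction_on (p := fun T => Sliceable p A G η δ (γ i '' T)) ?_ ?_ ?_ ?_
      · rw [image_empty]; exact Sliceable.empty
      · intro s t hst ht; exact ht.mono (image_mono hst)
      · intro s t hs ht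
        rw [image_union]; exact hs.union ht
      · rintro t0 ⟨_, ht0⟩
        have ht0' : γ i t0 ∈ S := ht0
        obtain ⟨U, hU, hs⟩ := Sliceable.piece (h.smooth i) (h.reg i t0)
          (fun hh => hS0 (hh ▸ ht0')) hA hG hA0 hG0 (hAG _ ht0') hη hδ
        exact ⟨U, mem_nhdsWithin_of_mem_nhds hU, hs⟩
    have hall : ∀ s : Finset (Fin n), Sliceable p A G η δ (⋃ i ∈ s, γ i '' (Icc 0 1 ∩ γ i ⁻¹' S)) := by
      intro s
      induction s using Finset.induction_on with
      | empty => simpa using Sliceable.empty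
      | insert a s _ ih =>
        rw [Finset.set_biUnion_insert]
        exact (hi a).union ih
    refine (hall Finset.univ).mono ?_
    intro z hz
    have := hSΓ hz
    rw [h.eq] at this
    obtain ⟨i, hzi⟩ := mem_iUnion.mp this
    rw [h.range_eq] at hzi
    obtain ⟨t, ht, rfl⟩ := hzi
    simp only [mem_iUnion]
    exact ⟨i, Finset.mem_univ _, t, ⟨ht, hz⟩, rfl⟩
  have hseq : ∀ k : ℕ, ∃ f F : ℝ → ℝ≥0∞, Measurable f ∧ Measurable F ∧
      (∫⁻ x, f x) + (∫⁻ x, F x) ≤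
        ENNReal.ofReal (1 + 1 / ((k : ℝ) + 1)) * ∫⁻ z in S, ENNReal.ofReal (‖z‖ ^ p) ∂μH[1] ∧
      (∀ (P : Finset ℂ), (↑P : Set ℂ) ⊆ S → (∀ x ∈ P, ∀ y ∈ P, x ≠ y → 1 / ((k : ℝ) + 1) < dist x y) →
        (∀ ξ, (∀ x ∈ P, Real.log ‖x‖ = ξ) → ∑ x ∈ P, ENNReal.ofReal (A ‖x‖) ≤ f ξ) ∧
        (∀ θ, (∀ x ∈ P, Complex.arg x = θ) → ∑ x ∈ P, ENNReal.ofReal (G ‖x‖) ≤ F θ)) := by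
    intro k
    obtain ⟨T', _, h2, h3⟩ := hslice (1 / ((k : ℝ) + 1)) (by positivity) (1 / ((k : ℝ) + 1)) (by positivity)
    exact h3 S h2 hSc.measurableSet
  choose f F hf hF hintg hP using hseq
  have hsep : ∀ P : Finset ℂ, ∀ᶠ k : ℕ in atTop, ∀ x ∈ P, ∀ y ∈ P, x ≠ y →
      1 / ((k : ℝ) + 1) < dist x y := by
    intro P
    rw [Finset.eventually_all]
    intro x _
    rw [Finset.eventually_all]
    intro y _
    by_cases hxy : x = y
    · exact Eventually.of_forall fun k h => absurd hxy h
    · have := (tendsto_one_div_add_atTop_nhds_zero_nat (𝕜 := ℝ)).eventually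
        (gt_mem_nhds (dist_pos.mpr hxy))
      filter_upwards [this] with k hk _ using hk
  have h1 : (∫⁻ ξ, ψ ξ) ≤ liminf (fun k => ∫⁻ x, f k x) atTop := by
    refine le_trans (lintegral_mono_ae ?_) (lintegral_liminf_le hf)
    filter_upwards [hψ] with ξ hξ
    obtain ⟨P, hPS, hPl, hle⟩ := hξ
    refine hle.trans (le_liminf_of_le (by isBoundedDefault) ?_)
    filter_upwards [hsep P] with k hk
    exact (hP k P hPS hk).1 ξ hPl
  have h2 : (∫⁻ θ in Ioo (-π) π, φ θ) ≤ liminf (fun k => ∫⁻ x, F k x) atTop := by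
    have : (∫⁻ θ in Ioo (-π) π, φ θ) ≤ ∫⁻ θ in Ioo (-π) π, liminf (fun k => F k θ) atTop := by
      apply lintegral_mono_ae
      rw [ae_restrict_iff' measurableSet_Ioo]
      filter_upwards [hφ] with θ hθ hmem
      obtain ⟨P, hPS, hPl, hle⟩ := hθ hmem
      refine hle.trans (le_liminf_of_le (by isBoundedDefault) ?_)
      filter_upwards [hsep P] with k hk
      exact (hP k P hPS hk).2 θ hPl
    exact this.trans ((setLIntegral_le_lintegral _ _).trans (lintegral_liminf_le hF))
  refine (add_le_add h1 h2).trans ((liminf_add_le_ennreal _ _).trans ?_)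
  set I := ∫⁻ z in S, ENNReal.ofReal (‖z‖ ^ p) ∂μH[1] with hI
  have h3 : Tendsto (fun k : ℕ => ENNReal.ofReal (1 + 1 / ((k : ℝ) + 1)) * I) atTop (𝓝 I) := by
    have : Tendsto (fun k : ℕ => ENNReal.ofReal (1 + 1 / ((k : ℝ) + 1))) atTop (𝓝 (ENNReal.ofReal (1 + 0))) :=
      ENNReal.tendsto_ofReal (tendsto_const_nhds.add (tendsto_one_div_add_atTop_nhds_zero_nat (𝕜 := ℝ)))
    have := ENNReal.Tendsto.mul_const (b := I) this (by simp)
    simpa using this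
  rw [← h3.liminf_eq]
  exact liminf_le_liminf (Eventually.of_forall hintg)

lemma lintegral_deriv_nonneg {F f : ℝ → ℝ} {a b : ℝ} (hab : a ≤ b) (hc : ContinuousOn F (Icc a b))
    (hd : ∀ x ∈ Ioo a b, HasDerivAt F (f x) x) (hf : ∀ x ∈ Ioo a b, 0 ≤ f x) :
    ∫⁻ x in Ioo a b, ENNReal.ofReal (f x) = ENNReal.ofReal (F b - F a) := by
  have hi : IntegrableOn f (Ioc a b) := intervalIntegral.integrableOn_deriv_of_nonneg hc hd hf
  have h1 := intervalIntegral.integral_eq_sub_of_hasDerivAt_of_le hab hc hd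
    ((intervalIntegrable_iff_integrableOn_Ioc_of_le hab).mpr hi)
  rw [intervalIntegral.integral_of_le hab, integral_Ioc_eq_integral_Ioo] at h1
  rw [← h1, ofReal_integral_eq_lintegral_ofReal (hi.mono_set Ioo_subset_Ioc_self)]
  rw [EventuallyLE, ae_restrict_iff' measurableSet_Ioo]
  exact Eventually.of_forall fun x hx => hf x hx

lemma arcsine_int {m q : ℝ} (hm : 0 < m) (hmq : m < q) :
    ∫⁻ w in Ioo m q, ENNReal.ofReal (w / (√(q^2 - w^2) * √(w^2 - m^2))) = ENNReal.ofReal (π / 2) := by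
  have hD : 0 < q^2 - m^2 := by nlinarith
  have := lintegral_deriv_nonneg (F := fun w => (1/2) * arcsin ((2*w^2 - q^2 - m^2)/(q^2-m^2)))
    (f := fun w => w / (√(q^2 - w^2) * √(w^2 - m^2))) (a := m) (b := q) hmq.le ?_ ?_ ?_
  · rw [this]
    congr 1
    have e1 : (2*q^2 - q^2 - m^2)/(q^2-m^2) = 1 := by
      rw [div_eq_one_iff_eq hD.ne']; ring
    have e2 : (2*m^2 - q^2 - m^2)/(q^2-m^2) = -1 := by
      rw [div_eq_iff hD.ne']; ring
    rw [e1, e2, arcsin_one, arcsin_neg_one]; ring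
  · apply Continuous.continuousOn
    exact continuous_const.mul (continuous_arcsin.comp (by fun_prop))
  · intro w hw
    have h1 : 0 < q^2 - w^2 := by nlinarith [hw.1, hw.2]
    have h2 : 0 < w^2 - m^2 := by nlinarith [hw.1, hw.2]
    set Y := (2*w^2 - q^2 - m^2)/(q^2-m^2) with hY
    have hY1 : 1 - Y^2 = 4 * (q^2 - w^2) * (w^2 - m^2) / (q^2-m^2)^2 := by
      rw [hY]; field_simp; ring
    have hpos : 0 < 1 - Y^2 := by rw [hY1]; positivity
    have hYa : Y ≠ -1 := by rintro h; rw [h] at hpos; norm_num at hpos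
    have hYb : Y ≠ 1 := by rintro h; rw [h] at hpos; norm_num at hpos
    have hd := (hasDerivAt_arcsin hYa hYb)
    have hd2 : HasDerivAt (fun w : ℝ => (2*w^2 - q^2 - m^2)/(q^2-m^2)) ((4 * w)/(q^2-m^2)) w := by
      have : HasDerivAt (fun w : ℝ => 2*w^2 - q^2 - m^2) (4 * w) w := by
        have := ((((hasDerivAt_id w).pow 2).const_mul 2).sub_const (q^2)).sub_const (m^2)
        refine this.congr_deriv ?_
        simp; ring
      exact this.div_const _
    have hd3 := (hd.comp w hd2).const_mul (1/2)
    refine hd3.congr_deriv ?_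
    have hs : √(1 - Y^2) = 2 * (√(q^2 - w^2) * √(w^2 - m^2)) / (q^2-m^2) := by
      rw [hY1, Real.sqrt_div (by positivity), Real.sqrt_sq hD.le, Real.sqrt_mul (by positivity),
        Real.sqrt_mul (by positivity)]
      have : √(4:ℝ) = 2 := by rw [show (4:ℝ) = 2^2 by norm_num]; exact Real.sqrt_sq (by norm_num)
      rw [this]; ring
    have hs1 : 0 < √(q^2 - w^2) := Real.sqrt_pos.mpr h1
    have hs2 : 0 < √(w^2 - m^2) := Real.sqrt_pos.mpr h2
    rw [hs]
    field_simp
    ring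
  · intro w hw
    have : 0 ≤ w := hm.le.trans hw.1.le
    positivity

/-- the one-dimensional profile -/
noncomputable def omg (s b v : ℝ) : ℝ := v ^ s + b / v

lemma omg_deriv {s b v : ℝ} (hv : 0 < v) :
    HasDerivAt (omg s b) ((s * v ^ s - b / v) / v) v := by
  have h1 := Real.hasDerivAt_rpow_const (x := v) (p := s) (Or.inl hv.ne')
  have h2 := ((hasDerivAt_inv hv.ne').const_mul b)
  have := h1.add h2
  refine (this.congr_of_eventuallyEq ?_).congr_deriv ?_
  · exact Eventually.of_forall fun x => by simp [omg, div_eq_mul_inv]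
  · rw [Real.rpow_sub_one hv.ne']; field_simp; ring

lemma vzero_spec {s b : ℝ} (hs : 0 < s) (hb : 0 < b) : 0 < (b / s) ^ (1 / (1 + s)) ∧
    s * ((b / s) ^ (1 / (1 + s))) ^ s = b / ((b / s) ^ (1 / (1 + s))) := by
  have h0 : 0 < b / s := by positivity
  have hv : 0 < (b / s) ^ (1 / (1 + s)) := Real.rpow_pos_of_pos h0 _
  refine ⟨hv, ?_⟩
  rw [eq_div_iff hv.ne', mul_assoc, ← Real.rpow_add_one hv.ne', ← Real.rpow_mul h0.le]
  rw [show 1 / (1 + s) * (s + 1) = 1 by field_simp; ring, Real.rpow_one]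
  field_simp

lemma nu_strict {s b : ℝ} (hs : 0 < s) (hb : 0 < b) : StrictMonoOn (fun v => s * v ^ s - b / v) (Ioi 0) := by
  intro x hx y hy hxy
  have hx : 0 < x := hx
  have hy : 0 < y := hy
  have h1 : x ^ s < y ^ s := Real.rpow_lt_rpow hx.le hxy hs
  have h2 : b / y < b / x := by gcongr
  simp only
  nlinarith

lemma prod_ineq {s b v1 v2 w : ℝ} (hs : 0 < s) (hb : 0 < b) (h1 : 0 < v1) (h2 : 0 < v2)
    (e1 : omg s b v1 = w) (e2 : omg s b v2 = w) :
    (s * v1 ^ s - b / v1) * (b / v2 - s * v2 ^ s) ≤ s * (w^2 - omg s b (√(v1 * v2)) ^ 2) := by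
  unfold omg at *
  set a1 := v1 ^ s
  set a2 := v2 ^ s
  set c1 := b / v1
  set c2 := b / v2
  have ha1 : 0 < a1 := Real.rpow_pos_of_pos h1 s
  have ha2 : 0 < a2 := Real.rpow_pos_of_pos h2 s
  have hc1 : 0 < c1 := by positivity
  have hc2 : 0 < c2 := by positivity
  have hg1 : (√(v1 * v2)) ^ s = √(a1 * a2) := by
    rw [Real.sqrt_eq_rpow, Real.sqrt_eq_rpow, ← Real.rpow_mul (by positivity), mul_comm (1/2) s,
      Real.rpow_mul (by positivity), Real.mul_rpow h1.le h2.le]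
  have hg2 : b / √(v1 * v2) = √(c1 * c2) := by
    have : c1 * c2 = b^2 / (v1 * v2) := by simp only [c1, c2]; field_simp
    rw [this, Real.sqrt_div (by positivity), Real.sqrt_sq hb.le]
  rw [hg1, hg2]
  have k1 : √(a1 * a2) ^ 2 = a1 * a2 := Real.sq_sqrt (by positivity)
  have k2 : √(c1 * c2) ^ 2 = c1 * c2 := Real.sq_sqrt (by positivity)
  have hid : s * w^2 - (s * a1 - c1) * (c2 - s * a2) = (1 + s) * (s * (a1 * a2) + c1 * c2) := by
    have : c1 = w - a1 := by linarith
    have h' : c2 = w - a2 := by linarith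
    rw [this, h']; ring
  rw [← k1, ← k2] at hid
  generalize √(a1 * a2) = x at *
  generalize √(c1 * c2) = y at *
  have := sq_nonneg (s * x - y)
  have h3 : (1 + s) * (s * x ^ 2 + y ^ 2) = s * (x + y) ^ 2 + (s * x - y) ^ 2 := by ring
  linarith

lemma omg_strictAnti {s b v0 : ℝ} (hs : 0 < s) (hb : 0 < b) (hv0 : 0 < v0)
    (hv : s * v0 ^ s = b / v0) : StrictAntiOn (omg s b) (Ioc 0 v0) := by
  apply strictAntiOn_of_deriv_neg (convex_Ioc 0 v0)
  · intro x hx; exact (omg_deriv hx.1).continuousAt.continuousWithinAt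
  · intro x hx
    rw [interior_Ioc] at hx
    rw [(omg_deriv hx.1).deriv]
    apply div_neg_of_neg_of_pos _ hx.1
    have := nu_strict hs hb hx.1 hv0 hx.2
    simp only at this; linarith

lemma omg_strictMono {s b v0 : ℝ} (hs : 0 < s) (hb : 0 < b) (hv0 : 0 < v0)
    (hv : s * v0 ^ s = b / v0) : StrictMonoOn (omg s b) (Ici v0) := by
  apply strictMonoOn_of_deriv_pos (convex_Ici v0)
  · intro x hx; exact (omg_deriv (hv0.trans_le hx)).continuousAt.continuousWithinAt
  · intro x hx
    rw [interior_Ici] at hx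
    have hx0 : 0 < x := hv0.trans hx
    rw [(omg_deriv hx0).deriv]
    apply div_pos _ hx0
    have := nu_strict hs hb hv0 hx0 hx
    simp only at this; linarith

lemma omg_min {s b v0 v : ℝ} (hs : 0 < s) (hb : 0 < b) (hv0 : 0 < v0)
    (hv : s * v0 ^ s = b / v0) (h : 0 < v) : omg s b v0 ≤ omg s b v := by
  rcases le_total v v0 with h1 | h1
  · exact (omg_strictAnti hs hb hv0 hv).antitoneOn ⟨h, h1⟩ ⟨hv0, le_rfl⟩ h1
  · exact (omg_strictMono hs hb hv0 hv).monotoneOn self_mem_Ici h1 h1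

/-- A branch integral via substitution. -/
lemma branch_int {s b m q : ℝ} {B : Set ℝ} (hB : MeasurableSet B) (hB0 : B ⊆ Ioi 0)
    (hinj : InjOn (omg s b) B) (him : omg s b '' B = Ioo m q)
    (hν : ∀ v ∈ B, s * v ^ s - b / v ≠ 0) :
    ∫⁻ v in B, ENNReal.ofReal (omg s b v / √(q^2 - omg s b v ^ 2) / v) =
    ∫⁻ w in Ioo m q, ENNReal.ofReal (w / √(q^2 - w^2) /
      |s * (Function.invFunOn (omg s b) B w) ^ s - b / (Function.invFunOn (omg s b) B w)|) := by
  rw [← him, lintegral_image_eq_lintegral_abs_deriv_mul hB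
    (fun x hx => (omg_deriv (hB0 hx)).hasDerivWithinAt) hinj]
  apply setLIntegral_congr_fun hB
  intro v hv
  have hv0 : 0 < v := hB0 hv
  simp only
  rw [hinj.leftInvOn_invFunOn hv, ← ENNReal.ofReal_mul (abs_nonneg _)]
  congr 1
  have := abs_pos.mpr (hν v hv)
  rw [abs_div, abs_of_pos hv0]
  generalize |s * v ^ s - b / v| = y at *
  field_simp

lemma P_bound {s b : ℝ} (hs : 0 < s) (hb : 0 < b) (hbs : b < s) :
    ENNReal.ofReal (π / √s) ≤ ∫⁻ v in {v | 0 < v ∧ omg s b v < 1 + s},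
      ENNReal.ofReal (omg s b v / √((1 + s)^2 - omg s b v ^ 2) / v) := by
  obtain ⟨hv0, hv⟩ := vzero_spec hs hb
  set v0 := (b / s) ^ (1 / (1 + s)) with hv0def
  set q := 1 + s with hq
  set m := omg s b v0 with hm
  have hmpos : 0 < m := by
    have := Real.rpow_pos_of_pos hv0 s
    rw [hm, omg]; positivity
  have hmq : m < q := by
    have := omg_min hs hb hv0 hv one_pos
    have e : omg s b 1 = 1 + b := by simp [omg]
    linarith
  have hanti := omg_strictAnti hs hb hv0 hv
  have hmono := omg_strictMono hs hb hv0 hv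
  have hmeas : Measurable (omg s b) := by unfold omg; fun_prop
  set B1 := {v | v0 < v ∧ omg s b v < q} with hB1
  set B2 := {v | (0 < v ∧ v < v0) ∧ omg s b v < q} with hB2
  have mB1 : MeasurableSet B1 := measurableSet_Ioi.inter (hmeas measurableSet_Iio)
  have mB2 : MeasurableSet B2 := measurableSet_Ioo.inter (hmeas measurableSet_Iio)
  have B1pos : B1 ⊆ Ioi 0 := fun v hv => hv0.trans hv.1
  have B2pos : B2 ⊆ Ioi 0 := fun v hv => hv.1.1
  have B1Ici : B1 ⊆ Ici v0 := fun v hv => hv.1.le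
  have B2Ioc : B2 ⊆ Ioc 0 v0 := fun v hv => ⟨hv.1.1, hv.1.2.le⟩
  have i1 : InjOn (omg s b) B1 := hmono.injOn.mono B1Ici
  have i2 : InjOn (omg s b) B2 := hanti.injOn.mono B2Ioc
  have ν1 : ∀ v ∈ B1, 0 < s * v ^ s - b / v := by
    intro v hvB
    have := nu_strict hs hb hv0 (B1pos hvB) hvB.1
    simp only at this; linarith
  have ν2 : ∀ v ∈ B2, s * v ^ s - b / v < 0 := by
    intro v hvB
    have := nu_strict hs hb (B2pos hvB) hv0 hvB.1.2
    simp only at this; linarith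
  have hcont : ContinuousOn (omg s b) (Ioi 0) := fun x hx =>
    (omg_deriv hx).continuousAt.continuousWithinAt
  have im1 : omg s b '' B1 = Ioo m q := by
    apply Subset.antisymm
    · rintro _ ⟨v, hvB, rfl⟩
      exact ⟨hmono self_mem_Ici hvB.1.le hvB.1, hvB.2⟩
    · intro w hw
      set V := max (v0 + 1) (q ^ (1 / s)) with hV
      have hVv : v0 < V := lt_of_lt_of_le (by linarith) (le_max_left _ _)
      have hVq : q ≤ omg s b V := by
        have hq0 : 0 < q := by positivity
        have h1 : (q ^ (1 / s)) ^ s ≤ V ^ s :=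
          Real.rpow_le_rpow (by positivity) (le_max_right _ _) hs.le
        rw [← Real.rpow_mul hq0.le, one_div_mul_cancel hs.ne', Real.rpow_one] at h1
        have : 0 < b / V := div_pos hb (hv0.trans hVv)
        unfold omg; linarith
      have := intermediate_value_Ioo hVv.le (hcont.mono fun x hx => hv0.trans_le hx.1)
      obtain ⟨v, hv1, rfl⟩ := this ⟨hw.1, hw.2.trans_le hVq⟩
      exact ⟨v, ⟨hv1.1, hw.2⟩, rfl⟩
  have im2 : omg s b '' B2 = Ioo m q := by
    apply Subset.antisymm
    · rintro _ ⟨v, hvB, rfl⟩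
      exact ⟨hanti (B2Ioc hvB) ⟨hv0, le_rfl⟩ hvB.1.2, hvB.2⟩
    · intro w hw
      set V := min (v0 / 2) (b / q) with hV
      have hV0 : 0 < V := lt_min (by positivity) (by positivity)
      have hVv : V < v0 := lt_of_le_of_lt (min_le_left _ _) (by linarith)
      have hVq : q ≤ omg s b V := by
        have hq0 : 0 < q := by positivity
        have h1 : q ≤ b / V := by
          rw [le_div_iff₀ hV0]
          calc q * V ≤ q * (b / q) := by gcongr; exact min_le_right _ _
            _ = b := by field_simp
        have : 0 < V ^ s := Real.rpow_pos_of_pos hV0 s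
        unfold omg; linarith
      have := intermediate_value_Ioo' hVv.le (hcont.mono fun x hx => hV0.trans_le hx.1)
      obtain ⟨v, hv1, rfl⟩ := this ⟨hw.1, hw.2.trans_le hVq⟩
      exact ⟨v, ⟨⟨hV0.trans hv1.1, hv1.2⟩, hw.2⟩, rfl⟩
  set u1 := Function.invFunOn (omg s b) B1 with hu1
  set u2 := Function.invFunOn (omg s b) B2 with hu2
  have mem1 : ∀ w ∈ Ioo m q, u1 w ∈ B1 ∧ omg s b (u1 w) = w := by
    intro w hw; rw [← im1] at hw
    exact ⟨Function.invFunOn_mem hw, Function.invFunOn_eq hw⟩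
  have mem2 : ∀ w ∈ Ioo m q, u2 w ∈ B2 ∧ omg s b (u2 w) = w := by
    intro w hw; rw [← im2] at hw
    exact ⟨Function.invFunOn_mem hw, Function.invFunOn_eq hw⟩
  have mono1 : MonotoneOn u1 (Ioo m q) := by
    intro x hx y hy hxy
    by_contra hlt
    push Not at hlt
    have := hmono (B1Ici (mem1 y hy).1) (B1Ici (mem1 x hx).1) hlt
    rw [(mem1 y hy).2, (mem1 x hx).2] at this
    linarith
  have aem : AEMeasurable (fun w => ENNReal.ofReal (w / √(q^2 - w^2) /
      |s * (u1 w) ^ s - b / (u1 w)|)) (volume.restrict (Ioo m q)) := by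
    have h1 : AEMeasurable u1 (volume.restrict (Ioo m q)) :=
      aemeasurable_restrict_of_monotoneOn measurableSet_Ioo mono1
    have h2 : Measurable fun v : ℝ => |s * v ^ s - b / v| := by fun_prop
    have h3 := h2.comp_aemeasurable h1
    have h4 : Measurable fun w : ℝ => w / √(q^2 - w^2) := by fun_prop
    exact (h4.aemeasurable.div h3).ennreal_ofReal
  have hdisj : Disjoint B1 B2 := by
    rw [Set.disjoint_left]; rintro v h1 h2; exact absurd h1.1 (not_lt.mpr h2.1.2.le)
  have hsub : B1 ∪ B2 ⊆ {v | 0 < v ∧ omg s b v < q} := by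
    rintro v (h | h)
    · exact ⟨B1pos h, h.2⟩
    · exact ⟨B2pos h, h.2⟩
  refine le_trans ?_ (lintegral_mono_set hsub)
  rw [lintegral_union mB2 hdisj, branch_int mB1 B1pos i1 im1 (fun v h => (ν1 v h).ne'),
    branch_int mB2 B2pos i2 im2 (fun v h => (ν2 v h).ne), ← lintegral_add_left' aem]
  have hss : 0 < √s := Real.sqrt_pos.mpr hs
  have : ENNReal.ofReal (π / √s) = ∫⁻ w in Ioo m q, ENNReal.ofReal (2 / √s) *
      ENNReal.ofReal (w / (√(q^2 - w^2) * √(w^2 - m^2))) := by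
    rw [lintegral_const_mul _ (by fun_prop), arcsine_int hmpos hmq, ← ENNReal.ofReal_mul (by positivity)]
    congr 1; field_simp
  rw [this]
  apply setLIntegral_mono' measurableSet_Ioo
  intro w hw
  obtain ⟨m1, o1⟩ := mem1 w hw
  obtain ⟨m2, o2⟩ := mem2 w hw
  have hw0 : 0 < w := hmpos.trans hw.1
  have hprod := prod_ineq hs hb (B1pos m1) (B2pos m2) o1 o2
  have n1 := ν1 _ m1
  have n2 := ν2 _ m2
  have hmin : m ≤ omg s b (√(u1 w * u2 w)) := omg_min hs hb hv0 hv
    (Real.sqrt_pos.mpr (mul_pos (B1pos m1) (B2pos m2)))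
  change _ ≤ ENNReal.ofReal (w / √(q ^ 2 - w ^ 2) / |s * u1 w ^ s - b / u1 w|) +
    ENNReal.ofReal (w / √(q ^ 2 - w ^ 2) / |s * u2 w ^ s - b / u2 w|)
  rw [abs_of_pos n1, abs_of_neg n2, neg_sub]
  set x := s * u1 w ^ s - b / u1 w with hx
  set y := b / u2 w - s * u2 w ^ s with hy
  have ypos : 0 < y := by simp only [hy]; linarith
  have hxy : x * y ≤ s * (w^2 - m^2) := by
    refine hprod.trans ?_
    gcongr
  have hq1 : 0 < q^2 - w^2 := by nlinarith [hw.1, hw.2]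
  have hq2 : 0 < w^2 - m^2 := by nlinarith [hw.1, hw.2]
  have sq1 : 0 < √(q^2 - w^2) := Real.sqrt_pos.mpr hq1
  have sq2 : 0 < √(w^2 - m^2) := Real.sqrt_pos.mpr hq2
  rw [← ENNReal.ofReal_mul (by positivity), ← ENNReal.ofReal_add (by positivity) (by positivity)]
  apply ENNReal.ofReal_le_ofReal
  have hk : 2 / (√s * √(w^2 - m^2)) ≤ 1 / x + 1 / y := by
    have hz : √(x * y) ≤ √s * √(w^2 - m^2) := by
      rw [← Real.sqrt_mul hs.le]; exact Real.sqrt_le_sqrt hxy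
    have hz0 : 0 < √(x * y) := Real.sqrt_pos.mpr (by positivity)
    calc 2 / (√s * √(w^2 - m^2)) ≤ 2 / √(x * y) := by gcongr
      _ ≤ 1 / x + 1 / y := by
        rw [div_add_div _ _ n1.ne' ypos.ne', div_le_div_iff₀ hz0 (by positivity)]
        have e := Real.sq_sqrt (show 0 ≤ x * y by positivity)
        have e2 : 2 * √(x * y) ≤ x + y := by
          have e3 : (2 * √(x * y))^2 ≤ (x + y)^2 := by
            rw [mul_pow, e]; nlinarith [sq_nonneg (x - y)]
          exact (abs_le_of_sq_le_sq' e3 (by positivity)).2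
        calc 2 * (x * y) = 2 * √(x * y) * √(x * y) := by rw [mul_assoc, ← sq, e]
          _ ≤ (x + y) * √(x * y) := by gcongr
          _ = _ := by ring
  calc 2 / √s * (w / (√(q^2 - w^2) * √(w^2 - m^2))) =
      w / √(q^2 - w^2) * (2 / (√s * √(w^2 - m^2))) := by field_simp
    _ ≤ w / √(q^2 - w^2) * (1 / x + 1 / y) := by gcongr
    _ = _ := by ring

lemma PsiI {s b : ℝ} (hs : 0 < s) (hb : 0 < b) (hbs : b < s) :
    ENNReal.ofReal (π * (s - b) / √s) ≤
      ∫⁻ v in Ioi 0, ENNReal.ofReal (√((1 + s)^2 - omg s b v ^ 2)) := by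
  set K : ℝ → ℝ → ℝ≥0∞ := fun c v => if 0 < v ∧ omg s c v < 1 + s then
    ENNReal.ofReal (omg s c v / √((1 + s)^2 - omg s c v ^ 2) / v) else 0 with hK
  have hom : Measurable fun x : ℝ × ℝ => omg s x.1 x.2 := by unfold omg; fun_prop
  have hKm : Measurable (Function.uncurry K) := by
    apply Measurable.ite
    · exact (measurable_snd measurableSet_Ioi).inter (hom measurableSet_Iio)
    · apply Measurable.ennreal_ofReal
      exact (hom.div (measurable_const.sub (hom.pow_const 2)).sqrt).div measurable_snd
    · exact measurable_const
  have h1 : ENNReal.ofReal (π * (s - b) / √s) ≤ ∫⁻ c in Ioo b s, ∫⁻ v, K c v := by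
    calc ENNReal.ofReal (π * (s - b) / √s) = ∫⁻ c in Ioo b s, ENNReal.ofReal (π / √s) := by
          rw [setLIntegral_const, Real.volume_Ioo, ← ENNReal.ofReal_mul (by positivity)]
          congr 1; ring
      _ ≤ _ := by
          apply setLIntegral_mono' measurableSet_Ioo
          intro c hc
          refine (P_bound hs (hb.trans hc.1) hc.2).trans ?_
          have hm : MeasurableSet {v | 0 < v ∧ omg s c v < 1 + s} := by
            have : Measurable (omg s c) := by unfold omg; fun_prop
            exact measurableSet_Ioi.inter (this measurableSet_Iio)
          rw [← lintegral_indicator hm]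
          apply lintegral_mono
          intro v
          simp only [hK, indicator_apply, mem_ofPred_eq]
          exact le_rfl
  refine h1.trans ?_
  rw [lintegral_lintegral_swap hKm.aemeasurable, ← lintegral_indicator measurableSet_Ioi]
  apply lintegral_mono
  intro v
  by_cases hv : 0 < v
  swap
  · simp [hK, hv]
  rw [indicator_of_mem (show v ∈ Ioi 0 from hv)]
  set k := (1 + s - v ^ s) * v with hk
  have hlt : ∀ c, omg s c v < 1 + s ↔ c < k := by
    intro c
    unfold omg
    rw [hk, ← div_lt_iff₀ hv]
    constructor <;> intro h <;> linarith
  have hvs : 0 < v ^ s := Real.rpow_pos_of_pos hv s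
  by_cases hbk : b < k
  · have e1 : ∫⁻ c in Ioo b s, K c v ≤ ∫⁻ c in Ioo b k,
        ENNReal.ofReal (omg s c v / √((1 + s)^2 - omg s c v ^ 2) / v) := by
      rw [← lintegral_indicator measurableSet_Ioo, ← lintegral_indicator measurableSet_Ioo]
      apply lintegral_mono
      intro c
      simp only [hK, indicator_apply, mem_Ioo, hlt, hv, true_and]
      split_ifs with a1 a2 a3 <;> simp_all
    refine e1.trans ?_
    have := lintegral_deriv_nonneg (F := fun c => -√((1 + s)^2 - omg s c v ^ 2))
      (f := fun c => omg s c v / √((1 + s)^2 - omg s c v ^ 2) / v) (a := b) (b := k) hbk.le ?_ ?_ ?_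
    · rw [this]
      apply ENNReal.ofReal_le_ofReal
      have : 0 ≤ √((1 + s)^2 - omg s k v ^ 2) := Real.sqrt_nonneg _
      linarith
    · apply Continuous.continuousOn
      unfold omg; fun_prop
    · intro c hc
      have hc0 : 0 < omg s c v := by
        have := div_pos (hb.trans hc.1) hv
        unfold omg; linarith
      have hpos : 0 < (1 + s)^2 - omg s c v ^ 2 := by
        have := (hlt c).mpr hc.2
        nlinarith
      have d1 : HasDerivAt (fun c => omg s c v) (1 / v) c := by
        unfold omg
        exact ((hasDerivAt_id c).div_const v).const_add _
      have d2 := (((d1.pow 2).const_sub ((1 + s)^2)).sqrt hpos.ne').neg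
      refine d2.congr_deriv ?_
      have : 0 < √((1 + s)^2 - omg s c v ^ 2) := Real.sqrt_pos.mpr hpos
      field_simp
      simp only [Pi.pow_apply]
      push_cast
      field_simp
    · intro c hc
      have hc0 : 0 < omg s c v := by
        have := div_pos (hb.trans hc.1) hv
        unfold omg; linarith
      positivity
  · have : ∫⁻ c in Ioo b s, K c v = 0 := by
      rw [setLIntegral_congr_fun (g := fun _ => 0) measurableSet_Ioo]
      · simp
      · intro c hc
        simp only [hK, hlt]
        rw [if_neg]
        rintro ⟨_, h⟩
        exact hbk (hc.1.trans h)
    exact this.le.trans zero_le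

lemma omg_neg_strict {s B : ℝ} (hs : 0 < s) (hB : 0 < B) : StrictMonoOn (omg s (-B)) (Ioi 0) := by
  intro x hx y hy hxy
  have hx : 0 < x := hx
  have hy : 0 < y := hy
  have h1 : x ^ s < y ^ s := Real.rpow_lt_rpow hx.le hxy hs
  have h2 : B / y < B / x := by gcongr
  unfold omg
  rw [neg_div, neg_div]; linarith

lemma diff_pow_ineq {s c d : ℝ} (hs : 0 < s) (hs1 : s < 1) (hd : 0 < d) (hdc : d < c) :
    c ^ (1 + s) - d ^ (1 + s) ≤ (c - d) ^ s * (c + d) := by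
  have hc : 0 < c := hd.trans hdc
  obtain ⟨τ, rfl⟩ : ∃ τ, d = c * τ := ⟨d / c, by field_simp⟩
  have hτ0 : 0 < τ := by
    by_contra h
    push Not at h
    nlinarith
  have hτ1 : τ < 1 := by
    by_contra h
    push Not at h
    nlinarith
  have e1 : c - c * τ = c * (1 - τ) := by ring
  rw [e1, Real.mul_rpow hc.le hτ0.le, Real.mul_rpow hc.le (by linarith), Real.rpow_add hc,
    Real.rpow_one]
  have k1 : τ ^ (2:ℝ) ≤ τ ^ (1 + s) := Real.rpow_le_rpow_of_exponent_ge hτ0 hτ1.le (by linarith)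
  have k2 : (1 - τ) ^ (1:ℝ) ≤ (1 - τ) ^ s :=
    Real.rpow_le_rpow_of_exponent_ge (by linarith) (by linarith) hs1.le
  rw [Real.rpow_two] at k1
  rw [Real.rpow_one] at k2
  have hcs : 0 < c * c ^ s := mul_pos hc (Real.rpow_pos_of_pos hc s)
  calc c * c ^ s - c * c ^ s * τ ^ (1 + s) = c * c ^ s * (1 - τ ^ (1 + s)) := by ring
    _ ≤ c * c ^ s * ((1 - τ) ^ s * (1 + τ)) := by
      gcongr
      nlinarith
    _ = _ := by ring

lemma width_neg {s B w : ℝ} (hs : 0 < s) (hs1 : s < 1) (hB : 0 < B) (hw : 0 < w) :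
    ENNReal.ofReal (w ^ (1 / s)) ≤ volume {v : ℝ | 0 < v ∧ |omg s (-B) v| < w} := by
  set ε := min 1 (B / (w + 1)) with hε
  have hε0 : 0 < ε := lt_min one_pos (by positivity)
  have lo : omg s (-B) ε ≤ -w := by
    have h1 : ε ^ s ≤ 1 := Real.rpow_le_one hε0.le (min_le_left _ _) hs.le
    have h2 : w + 1 ≤ B / ε := by
      rw [le_div_iff₀ hε0]
      calc (w + 1) * ε ≤ (w + 1) * (B / (w + 1)) := by gcongr; exact min_le_right _ _
        _ = B := by field_simp
    unfold omg; rw [neg_div]; linarith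
  set V := max 2 ((w + B) ^ (1 / s)) with hV
  have hV2 : 2 ≤ V := le_max_left _ _
  have hi : w ≤ omg s (-B) V := by
    have h1 : ((w + B) ^ (1 / s)) ^ s ≤ V ^ s :=
      Real.rpow_le_rpow (by positivity) (le_max_right _ _) hs.le
    rw [← Real.rpow_mul (by positivity), one_div_mul_cancel hs.ne', Real.rpow_one] at h1
    have h2 : B / V ≤ B := div_le_self hB.le (by linarith)
    unfold omg; rw [neg_div]; linarith
  have hεV : ε ≤ V := (min_le_left _ _).trans (by linarith)
  have hcont : ContinuousOn (omg s (-B)) (Icc ε V) := fun x hx =>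
    (omg_deriv (hε0.trans_le hx.1)).continuousAt.continuousWithinAt
  have ivt := intermediate_value_Icc hεV hcont
  obtain ⟨d, hd, hdw⟩ := ivt (show -w ∈ Icc _ _ from ⟨lo, by linarith⟩)
  obtain ⟨c, hc, hcw⟩ := ivt (show w ∈ Icc _ _ from ⟨by linarith, hi⟩)
  have hd0 : 0 < d := hε0.trans_le hd.1
  have hc0 : 0 < c := hε0.trans_le hc.1
  have hstr := omg_neg_strict hs hB
  have hdc : d < c := by
    apply (hstr.lt_iff_lt hd0 hc0).mp
    rw [hdw, hcw]; linarith
  have hsub : Ioo d c ⊆ {v : ℝ | 0 < v ∧ |omg s (-B) v| < w} := by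
    intro v hv
    have hv0 : 0 < v := hd0.trans hv.1
    refine ⟨hv0, ?_⟩
    rw [abs_lt]
    exact ⟨hdw ▸ hstr hd0 hv0 hv.1, (hstr hv0 hc0 hv.2).trans_eq hcw⟩
  refine le_trans ?_ (measure_mono hsub)
  rw [Real.volume_Ioo]
  apply ENNReal.ofReal_le_ofReal
  have key : w * (c + d) = c ^ (1 + s) - d ^ (1 + s) := by
    unfold omg at hdw hcw
    rw [Real.rpow_add hc0, Real.rpow_add hd0, Real.rpow_one, Real.rpow_one]
    have a1 : c ^ s * c = w * c + B := by
      rw [← hcw]; field_simp; ring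
    have a2 : d ^ s * d = -w * d + B := by
      rw [← hdw]; field_simp; ring
    linarith
  have hle := diff_pow_ineq hs hs1 hd0 hdc
  rw [← key] at hle
  have hws : w ≤ (c - d) ^ s := le_of_mul_le_mul_right hle (by linarith)
  calc w ^ (1 / s) ≤ ((c - d) ^ s) ^ (1 / s) := Real.rpow_le_rpow hw.le hws (by positivity)
    _ = c - d := by
      rw [← Real.rpow_mul (by linarith), mul_one_div_cancel hs.ne', Real.rpow_one]

lemma PsiII {s B : ℝ} (hs : 0 < s) (hs1 : s < 1) (hB : 0 < B) :
    ENNReal.ofReal (2 * π * s / (1 + s)) <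
      ∫⁻ v in Ioi 0, ENNReal.ofReal (√((1 + s)^2 - omg s (-B) v ^ 2)) := by
  -- comparison with B = 0
  have h0 : ∫⁻ v in Ioi 0, ENNReal.ofReal (√((1 + s)^2 - (v ^ s) ^ 2)) ≤
      ∫⁻ v in Ioi 0, ENNReal.ofReal (√((1 + s)^2 - omg s (-B) v ^ 2)) := by
    rw [lintegral_eq_lintegral_meas_lt, lintegral_eq_lintegral_meas_lt]
    · apply setLIntegral_mono' measurableSet_Ioi
      intro t ht
      have ht : 0 < t := ht
      rw [Measure.restrict_apply, Measure.restrict_apply]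
      rotate_left
      · exact measurableSet_lt measurable_const (by unfold omg; fun_prop)
      · exact measurableSet_lt measurable_const (by fun_prop)
      by_cases htq : t < 1 + s
      · have hw2 : 0 < (1 + s)^2 - t^2 := by nlinarith
        set w := √((1 + s)^2 - t^2) with hw
        have hw0 : 0 < w := Real.sqrt_pos.mpr hw2
        have hws : w^2 = (1 + s)^2 - t^2 := Real.sq_sqrt hw2.le
        refine le_trans ?_ ((width_neg hs hs1 hB hw0).trans (measure_mono ?_))
        · have : {a : ℝ | t < √((1 + s)^2 - (a ^ s) ^ 2)} ∩ Ioi 0 ⊆ Ioo 0 (w ^ (1 / s)) := by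
            rintro v ⟨h1, h2⟩
            have h2 : 0 < v := h2
            have h1 : t < √((1 + s)^2 - (v ^ s) ^ 2) := h1
            rw [Real.lt_sqrt ht.le] at h1
            refine ⟨h2, ?_⟩
            have hvw : v ^ s < w := by
              apply lt_of_pow_lt_pow_left₀ 2 hw0.le
              linarith
            have := Real.rpow_lt_rpow (by positivity) hvw (show 0 < 1 / s by positivity)
            rwa [← Real.rpow_mul h2.le, mul_one_div_cancel hs.ne', Real.rpow_one] at this
          refine (measure_mono this).trans ?_
          rw [Real.volume_Ioo, sub_zero]
        · rintro v ⟨h1, h2⟩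
          refine ⟨?_, h1⟩
          change t < √((1 + s)^2 - omg s (-B) v ^ 2)
          rw [Real.lt_sqrt ht.le]
          have : omg s (-B) v ^ 2 < w^2 := by
            rw [← sq_abs]; gcongr
          linarith
      · have : {a : ℝ | t < √((1 + s)^2 - (a ^ s) ^ 2)} = ∅ := by
          ext v
          simp only [mem_ofPred_eq, mem_empty_iff_false, iff_false, not_lt]
          rw [Real.sqrt_le_left ht.le]
          push Not at htq
          nlinarith [sq_nonneg (v ^ s)]
        rw [this]; simp
    · exact Eventually.of_forall fun v => Real.sqrt_nonneg _
    · exact (by unfold omg; fun_prop : Measurable _).aemeasurable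
    · exact Eventually.of_forall fun v => Real.sqrt_nonneg _
    · exact (by fun_prop : Measurable _).aemeasurable
  refine lt_of_lt_of_le ?_ h0
  have hss : 0 < √s := Real.sqrt_pos.mpr hs
  have hsq : √s ^ 2 = s := Real.sq_sqrt hs.le
  have hs2 : √s < 1 := by nlinarith
  obtain ⟨b, hb, hbs⟩ : ∃ b, 0 < b ∧ b < s - 2 * √s * s / (1 + s) := by
    have : 0 < s - 2 * √s * s / (1 + s) := by
      rw [sub_pos, div_lt_iff₀ (by positivity)]
      have : 2 * √s < 1 + s := by nlinarith [sq_nonneg (1 - √s)]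
      nlinarith
    exact ⟨_, half_pos this, half_lt_self this⟩
  have hpos : 0 ≤ 2 * √s * s / (1 + s) := by positivity
  have hbs' : b < s := by linarith
  have h1 := PsiI hs hb hbs'
  refine lt_of_lt_of_le ?_ (h1.trans ?_)
  · apply (ENNReal.ofReal_lt_ofReal_iff (div_pos (mul_pos pi_pos (by linarith)) hss)).mpr
    have : 2 * √s * s / (1 + s) < s - b := by linarith
    calc 2 * π * s / (1 + s) = π * (2 * √s * s / (1 + s)) / √s := by field_simp
      _ < _ := by
        have := pi_pos
        gcongr
  · apply setLIntegral_mono' measurableSet_Ioi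
    intro v hv
    have hv : 0 < v := hv
    apply ENNReal.ofReal_le_ofReal
    apply Real.sqrt_le_sqrt
    have h1 : 0 < v ^ s := Real.rpow_pos_of_pos hv s
    have h2 : v ^ s ≤ omg s b v := by
      have := div_pos hb hv
      unfold omg; linarith
    gcongr

lemma PsiI' {s b : ℝ} (hs : 0 < s) (hs1 : s < 1) (hb : 0 < b) (hbs : b < s) :
    ENNReal.ofReal (2 * π * (s - b) / (1 + s)) <
      ∫⁻ v in Ioi 0, ENNReal.ofReal (√((1 + s)^2 - omg s b v ^ 2)) := by
  refine lt_of_lt_of_le ?_ (PsiI hs hb hbs)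
  have hss : 0 < √s := Real.sqrt_pos.mpr hs
  have hsq : √s ^ 2 = s := Real.sq_sqrt hs.le
  have hs2 : √s < 1 := by nlinarith
  have hsb : 0 < s - b := by linarith
  apply (ENNReal.ofReal_lt_ofReal_iff (by positivity)).mpr
  rw [div_lt_div_iff₀ (by positivity) hss]
  have : 2 * √s < 1 + s := by nlinarith [sq_nonneg (1 - √s)]
  have hp : 0 < π * (s - b) := by positivity
  nlinarith

/-- radial part of the calibration -/
noncomputable def Acal (p κ β r : ℝ) : ℝ := √((r ^ p * r) ^ 2 - (κ * r ^ 2 + β) ^ 2)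

lemma young_pow {q κ U : ℝ} (hq : 1 < q) (hU : 0 < U) (hκ : κ = U ^ (1 - q) / q) {X : ℝ} (hX : 0 ≤ X) :
    X ^ (1 / q) ≤ κ * X + (q - 1) / q * U ∧ (X ≠ U ^ q → X ^ (1 / q) < κ * X + (q - 1) / q * U) := by
  have hUq : 0 < U ^ q := Real.rpow_pos_of_pos hU q
  set t := X / U ^ q with ht
  have hXt : X = U ^ q * t := by rw [ht]; field_simp
  have ht0 : 0 ≤ t := by positivity
  have e1 : X ^ (1 / q) = U * t ^ (1 / q) := by
    rw [hXt, Real.mul_rpow hUq.le ht0, ← Real.rpow_mul hU.le, mul_one_div_cancel (by linarith), Real.rpow_one]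
  have e2 : κ * X + (q - 1) / q * U = U * (1 + 1 / q * (t - 1)) := by
    have : U ^ (1 - q) * U ^ q = U := by
      rw [← Real.rpow_add hU]; simp
    rw [hκ, hXt]
    calc _ = (U ^ (1 - q) * U ^ q) * t / q + (q - 1) / q * U := by ring
      _ = _ := by rw [this]; field_simp; ring
  have hq1 : 1 / q < 1 := by rw [div_lt_one (by linarith)]; exact hq
  have hq0 : 0 < 1 / q := by positivity
  rw [e1, e2]
  constructor
  · gcongr
    have := rpow_one_add_le_one_add_mul_self (s := t - 1) (p := 1 / q) (by linarith) hq0.le hq1.le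
    simpa using this
  · intro hne
    gcongr
    have hne' : t - 1 ≠ 0 := by
      intro h
      apply hne
      rw [hXt, show t = 1 by linarith, mul_one]
    have := rpow_one_add_lt_one_add_mul_self (s := t - 1) (p := 1 / q) (by linarith) hne' hq0 hq1
    simpa using this

lemma scale_int {p κ β U q s b : ℝ} (hp0 : 0 < p) (hq : q = 2 / (p + 1)) (hs : s = q - 1) (hU : 0 < U)
    (hκ : κ = U ^ (1 - q) / q) (hb : b = q * β / U) :
    ∫⁻ ξ, ENNReal.ofReal (2 * Acal p κ β (exp ξ)) =
      ENNReal.ofReal U * ∫⁻ v in Ioi 0, ENNReal.ofReal (√((1 + s)^2 - omg s b v ^ 2)) := by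
  have hl : 0 < p + 1 := by linarith
  have hq0 : 0 < q := by rw [hq]; positivity
  have hd : ∀ ξ : ℝ, HasDerivAt (fun ξ => exp ((p + 1) * ξ) / U) ((p + 1) * exp ((p + 1) * ξ) / U) ξ := by
    intro ξ
    have h1 : HasDerivAt (fun ξ : ℝ => (p + 1) * ξ) (p + 1) ξ := by
      simpa using (hasDerivAt_id ξ).const_mul (p + 1)
    have := (h1.exp).div_const U
    exact this.congr_deriv (by ring)
  have him : (fun ξ => exp ((p + 1) * ξ) / U) '' univ = Ioi 0 := by
    ext v
    simp only [image_univ, mem_range, mem_Ioi]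
    constructor
    · rintro ⟨ξ, rfl⟩; positivity
    · intro hv
      refine ⟨log (U * v) / (p + 1), ?_⟩
      rw [mul_div_cancel₀ _ hl.ne', exp_log (by positivity)]
      field_simp
  rw [← him, lintegral_image_eq_lintegral_abs_deriv_mul MeasurableSet.univ
    (fun x _ => (hd x).hasDerivWithinAt), setLIntegral_univ, ← lintegral_const_mul']
  · congr 1
    ext ξ
    have hE : 0 < exp ((p + 1) * ξ) := exp_pos _
    rw [abs_of_pos (by positivity), ← ENNReal.ofReal_mul (by positivity), ← ENNReal.ofReal_mul hU.le]
    congr 1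
    set v := exp ((p + 1) * ξ) / U with hv
    have hv0 : 0 < v := by positivity
    have hvE : exp ((p + 1) * ξ) = U * v := by rw [hv]; field_simp
    have h1 : exp ξ ^ p * exp ξ = U * v := by
      rw [← Real.rpow_add_one (exp_pos ξ).ne', ← Real.exp_mul, mul_comm, hvE]
    have h2 : exp ξ ^ 2 = (U * v) ^ q := by
      rw [← hvE, ← Real.exp_mul, ← Real.exp_nat_mul]
      congr 1
      rw [hq]; push_cast; field_simp
    have h3 : κ * exp ξ ^ 2 + β = (U * v / q) * omg s b v := by
      have e1 : U ^ (1 - q) * U ^ q = U := by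
        rw [← Real.rpow_add hU]; simp
      have e2 : v ^ q = v * v ^ s := by
        rw [show q = 1 + s by linarith, Real.rpow_add hv0, Real.rpow_one]
      rw [h2, Real.mul_rpow hU.le hv0.le, hκ, e2]
      calc _ = (U ^ (1 - q) * U ^ q) * (v * v ^ s) / q + β := by ring
        _ = _ := by
          rw [e1]; unfold omg; rw [hb]; field_simp
    have h4 : Acal p κ β (exp ξ) = (U * v / q) * √((1 + s)^2 - omg s b v ^ 2) := by
      unfold Acal
      rw [h1, h3]
      rw [show (U * v) ^ 2 - (U * v / q * omg s b v) ^ 2 = (U * v / q)^2 * ((1 + s)^2 - omg s b v ^ 2) by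
        rw [show 1 + s = q by linarith]; field_simp]
      rw [Real.sqrt_mul (by positivity), Real.sqrt_sq (by positivity)]
    rw [h4, hvE]
    have : 2 / q = p + 1 := by rw [hq]; field_simp
    calc _ = (2 / q) * (U * v) * √((1 + s)^2 - omg s b v ^ 2) := by ring
      _ = _ := by rw [this]; field_simp
  · exact ENNReal.ofReal_ne_top
  · intro x _ y _ hxy
    simp only at hxy
    rw [div_left_inj' hU.ne'] at hxy
    have := Real.exp_injective hxy
    exact mul_left_cancel₀ hl.ne' this

/-- existence of scaling data -/
lemma scale_data {q κ : ℝ} (hq : 1 < q) (hκ : 0 < κ) : ∃ U, 0 < U ∧ κ = U ^ (1 - q) / q := by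
  refine ⟨(q * κ) ^ (1 / (1 - q)), Real.rpow_pos_of_pos (by positivity) _, ?_⟩
  rw [← Real.rpow_mul (by positivity), one_div_mul_cancel (by linarith), Real.rpow_one]
  field_simp

lemma oneD_I {p κ β : ℝ} (hp0 : 0 < p) (hp1 : p < 1) (hκ : 0 < κ) (hβ : 0 < β) {a y : ℝ}
    (ha : 0 < a) (hay : a < y) (hga : κ * a ^ 2 + β = a ^ p * a) (hgy : κ * y ^ 2 + β = y ^ p * y)
    {R : ℝ} (hR : 0 ≤ R) :
    ENNReal.ofReal (2 * π * (R ^ p * R)) < (∫⁻ ξ, ENNReal.ofReal (2 * Acal p κ β (exp ξ))) +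
      ENNReal.ofReal (2 * κ * (π * R ^ 2) + 2 * π * β) := by
  set q := 2 / (p + 1) with hq
  have hq1 : 1 < q := by rw [hq, lt_div_iff₀ (by linarith)]; linarith
  set s := q - 1 with hs
  have hs0 : 0 < s := by linarith
  have hs1 : s < 1 := by
    have : q < 2 := by rw [hq, div_lt_iff₀ (by linarith)]; linarith
    linarith
  obtain ⟨U, hU, hκU⟩ := scale_data hq1 hκ
  have hpow : ∀ r : ℝ, 0 ≤ r → (r ^ 2) ^ (1 / q) = r ^ p * r := by
    intro r hr
    rw [← Real.rpow_add_one' hr (by linarith), ← Real.rpow_natCast r 2, ← Real.rpow_mul hr]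
    congr 1; rw [hq]; push_cast; field_simp
  have hβU : β < s / q * U := by
    by_cases h : a ^ 2 = U ^ q
    · have hne : y ^ 2 ≠ U ^ q := by rw [← h]; nlinarith
      have := (young_pow hq1 hU hκU (sq_nonneg y)).2 hne
      rw [hpow y (by linarith)] at this
      linarith
    · have := (young_pow hq1 hU hκU (sq_nonneg a)).2 h
      rw [hpow a ha.le] at this
      linarith
  have hJ := scale_int (β := β) hp0 hq hs hU hκU rfl
  have hbs : q * β / U < s := by
    rw [div_lt_iff₀ hU]
    have : q * β < q * (s / q * U) := by gcongr
    calc q * β < q * (s / q * U) := this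
      _ = s * U := by field_simp
  have hP := PsiI' hs0 hs1 (show 0 < q * β / U by positivity) hbs
  have hlt : ENNReal.ofReal (2 * π * (s / q * U - β)) < ∫⁻ ξ, ENNReal.ofReal (2 * Acal p κ β (exp ξ)) := by
    rw [hJ]
    have e : ENNReal.ofReal (2 * π * (s / q * U - β)) = ENNReal.ofReal U *
        ENNReal.ofReal (2 * π * (s - q * β / U) / (1 + s)) := by
      rw [← ENNReal.ofReal_mul hU.le]
      congr 1
      rw [show 1 + s = q by linarith]
      field_simp
    rw [e]
    exact ENNReal.mul_lt_mul_right (by simpa using hU) ENNReal.ofReal_ne_top hP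
  have hy := (young_pow hq1 hU hκU (sq_nonneg R)).1
  rw [hpow R hR] at hy
  calc ENNReal.ofReal (2 * π * (R ^ p * R)) ≤
        ENNReal.ofReal (2 * π * (s / q * U - β) + (2 * κ * (π * R ^ 2) + 2 * π * β)) := by
          apply ENNReal.ofReal_le_ofReal
          have := mul_le_mul_of_nonneg_left hy (show 0 ≤ 2 * π by positivity)
          linarith
    _ = ENNReal.ofReal (2 * π * (s / q * U - β)) + ENNReal.ofReal (2 * κ * (π * R ^ 2) + 2 * π * β) := by
          apply ENNReal.ofReal_add
          · have : 0 < s / q * U - β := by linarith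
            positivity
          · positivity
    _ < _ := ENNReal.add_lt_add_right ENNReal.ofReal_ne_top hlt

lemma oneD_II {p κ β : ℝ} (hp0 : 0 < p) (hp1 : p < 1) (hκ : 0 < κ) (hβ : β < 0)
    {R : ℝ} (hR : 0 ≤ R) :
    ENNReal.ofReal (2 * π * (R ^ p * R)) < (∫⁻ ξ, ENNReal.ofReal (2 * Acal p κ β (exp ξ))) +
      ENNReal.ofReal (2 * κ * (π * R ^ 2)) := by
  set q := 2 / (p + 1) with hq
  have hq1 : 1 < q := by rw [hq, lt_div_iff₀ (by linarith)]; linarith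
  set s := q - 1 with hs
  have hs0 : 0 < s := by linarith
  have hs1 : s < 1 := by
    have : q < 2 := by rw [hq, div_lt_iff₀ (by linarith)]; linarith
    linarith
  obtain ⟨U, hU, hκU⟩ := scale_data hq1 hκ
  have hpow : ∀ r : ℝ, 0 ≤ r → (r ^ 2) ^ (1 / q) = r ^ p * r := by
    intro r hr
    rw [← Real.rpow_add_one' hr (by linarith), ← Real.rpow_natCast r 2, ← Real.rpow_mul hr]
    congr 1; rw [hq]; push_cast; field_simp
  have hJ := scale_int (β := β) (b := -(-(q * β / U))) hp0 hq hs hU hκU (by ring)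
  have hP := PsiII hs0 hs1 (B := -(q * β / U)) (by
    rw [neg_pos]; apply div_neg_of_neg_of_pos _ hU; nlinarith)
  have hlt : ENNReal.ofReal (2 * π * (s / q * U)) < ∫⁻ ξ, ENNReal.ofReal (2 * Acal p κ β (exp ξ)) := by
    rw [hJ]
    have e : ENNReal.ofReal (2 * π * (s / q * U)) = ENNReal.ofReal U *
        ENNReal.ofReal (2 * π * s / (1 + s)) := by
      rw [← ENNReal.ofReal_mul hU.le]
      congr 1
      rw [show 1 + s = q by linarith]
      field_simp
    rw [e]
    exact ENNReal.mul_lt_mul_right (by simpa using hU) ENNReal.ofReal_ne_top hP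
  have hy := (young_pow hq1 hU hκU (sq_nonneg R)).1
  rw [hpow R hR] at hy
  calc ENNReal.ofReal (2 * π * (R ^ p * R)) ≤
        ENNReal.ofReal (2 * π * (s / q * U) + (2 * κ * (π * R ^ 2))) := by
          apply ENNReal.ofReal_le_ofReal
          have := mul_le_mul_of_nonneg_left hy (show 0 ≤ 2 * π by positivity)
          linarith
    _ = ENNReal.ofReal (2 * π * (s / q * U)) + ENNReal.ofReal (2 * κ * (π * R ^ 2)) := by
          apply ENNReal.ofReal_add
          · positivity
          · positivity
    _ < _ := ENNReal.add_lt_add_right ENNReal.ofReal_ne_top hlt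

/-- polar coordinates -/
noncomputable def pol (r θ : ℝ) : ℂ := (r : ℂ) * Complex.exp (θ * Complex.I)

lemma pol_cont : Continuous fun x : ℝ × ℝ => pol x.1 x.2 := by
  unfold pol; fun_prop

lemma pol_cont_r (θ : ℝ) : Continuous fun r => pol r θ := by unfold pol; fun_prop

lemma norm_pol {r : ℝ} (hr : 0 ≤ r) (θ : ℝ) : ‖pol r θ‖ = r := by
  unfold pol
  rw [norm_mul, Complex.norm_exp_ofReal_mul_I, mul_one, Complex.norm_real, Real.norm_of_nonneg hr]

lemma arg_pol {r : ℝ} (hr : 0 < r) {θ : ℝ} (hθ : θ ∈ Ioo (-π) π) : Complex.arg (pol r θ) = θ := by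
  unfold pol
  rw [Complex.exp_mul_I, Complex.arg_mul_cos_add_sin_mul_I hr ⟨hθ.1, hθ.2.le⟩]

lemma pol_norm_arg (z : ℂ) : pol ‖z‖ (Complex.arg z) = z := Complex.norm_mul_exp_arg_mul_I z

/-- weighted length of a ray inside U -/
noncomputable def hray (U : Set ℂ) (θ : ℝ) : ℝ≥0∞ :=
  ∫⁻ r in Ioi 0, U.indicator (fun _ => ENNReal.ofReal (2 * r)) (pol r θ)

lemma polar_hray {U : Set ℂ} (hU : MeasurableSet U) :
    ∫⁻ θ in Ioo (-π) π, hray U θ = 2 * volume U := by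
  have h1 := Complex.lintegral_comp_polarCoord_symm (U.indicator (fun _ => (2 : ℝ≥0∞)))
  rw [lintegral_indicator_const hU] at h1
  rw [← h1, polarCoord_target, Measure.volume_eq_prod, ← Measure.prod_restrict,
    lintegral_prod_symm]
  · unfold hray
    apply lintegral_congr; intro θ
    apply setLIntegral_congr_fun measurableSet_Ioi
    intro r hr
    have hr : 0 < r := hr
    have e : Complex.polarCoord.symm (r, θ) = pol r θ := by
      rw [Complex.polarCoord_symm_apply]; unfold pol; rw [Complex.exp_mul_I]; simp
    simp only [e, smul_eq_mul]
    by_cases h : pol r θ ∈ U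
    · simp only [indicator_of_mem h]
      rw [ENNReal.ofReal_mul (by norm_num), mul_comm]; simp
    · simp [indicator_of_notMem h]
  · apply Measurable.aemeasurable
    simp only [smul_eq_mul]
    refine Measurable.mul (by fun_prop) ?_
    have : Measurable fun x : ℝ × ℝ => Complex.polarCoord.symm x := by
      simp only [Complex.polarCoord_symm_apply]; fun_prop
    exact (measurable_const.indicator hU).comp this

lemma hray_le {U : Set ℂ} {θ α ρ : ℝ} (hα : 0 ≤ α) (hαρ : α ≤ ρ)
    (h : ∀ r, 0 < r → pol r θ ∈ U → r ∈ Icc α ρ) : hray U θ ≤ ENNReal.ofReal (ρ ^ 2 - α ^ 2) := by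
  have e : ∫⁻ r in Ioc α ρ, ENNReal.ofReal (2 * r) = ENNReal.ofReal (ρ ^ 2 - α ^ 2) := by
    rw [← ofReal_integral_eq_lintegral_ofReal]
    · rw [← intervalIntegral.integral_of_le hαρ]
      congr 1
      rw [intervalIntegral.integral_const_mul, integral_id]; ring
    · exact (continuous_const.mul continuous_id).integrableOn_Ioc
    · rw [EventuallyLE, ae_restrict_iff' measurableSet_Ioc]
      filter_upwards with r hr
      have : 0 < r := lt_of_le_of_lt hα hr.1
      simp only [Pi.zero_apply]; positivity
  rw [← e, setLIntegral_congr Ioc_ae_eq_Icc, hray, ← lintegral_indicator measurableSet_Ioi,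
    ← lintegral_indicator measurableSet_Icc]
  apply lintegral_mono
  intro r
  by_cases hr : r ∈ Ioi (0:ℝ)
  · rw [indicator_of_mem hr]
    by_cases hU : pol r θ ∈ U
    · rw [indicator_of_mem hU, indicator_of_mem (h r hr hU)]
    · rw [indicator_of_notMem hU]; exact zero_le
  · rw [indicator_of_notMem hr]; exact zero_le

lemma hray_zero {U : Set ℂ} {θ : ℝ} (h : ∀ r, 0 < r → pol r θ ∉ U) : hray U θ = 0 := by
  have := hray_le (U := U) (θ := θ) (α := 0) (ρ := 0) le_rfl le_rfl (fun r h1 h2 => absurd h2 (h r h1))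
  simpa using this

/-- open annulus piece -/
def ann (Ω : Set ℂ) (x y : ℝ) : Set ℂ := Ω ∩ {z | x < ‖z‖ ∧ ‖z‖ < y}

lemma ann_open {Ω : Set ℂ} (h : IsOpen Ω) (x y : ℝ) : IsOpen (ann Ω x y) :=
  h.inter ((isOpen_lt continuous_const continuous_norm).inter (isOpen_lt continuous_norm continuous_const))

lemma pol_mem_ann {Ω : Set ℂ} {x y r θ : ℝ} (hr : 0 ≤ r) :
    pol r θ ∈ ann Ω x y ↔ pol r θ ∈ Ω ∧ x < r ∧ r < y := by
  simp only [ann, mem_inter_iff, mem_ofPred_eq, norm_pol hr]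

/-- outer point on a ray -/
lemma ray_outer {Ω : Set ℂ} (hopen : IsOpen Ω) {x y θ : ℝ} (hx : 0 ≤ x)
    (hy : ∀ z ∈ Ω, ‖z‖ ≠ y) {r0 : ℝ} (hr0 : x < r0 ∧ r0 < y) (hr0Ω : pol r0 θ ∈ Ω) :
    ∃ ρ, pol ρ θ ∈ frontier Ω ∧ r0 < ρ ∧ ρ ≤ y ∧ ∀ r, 0 < r → pol r θ ∈ ann Ω x y → r ≤ ρ := by
  set O := {r | x < r ∧ r < y ∧ pol r θ ∈ Ω} with hO
  have hOo : IsOpen O := (isOpen_lt continuous_const continuous_id).inter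
    ((isOpen_lt continuous_id continuous_const).inter (hopen.preimage (pol_cont_r θ)))
  have hr0O : r0 ∈ O := ⟨hr0.1, hr0.2, hr0Ω⟩
  have hb : BddAbove O := ⟨y, fun r hr => hr.2.1.le⟩
  have hle : ∀ r ∈ O, r ≤ sSup O := fun r hr => le_csSup hb hr
  have hρy : sSup O ≤ y := csSup_le ⟨r0, hr0O⟩ (fun r hr => hr.2.1.le)
  have hnot : sSup O ∉ O := by
    intro hm
    have hev : ∀ᶠ u in 𝓝[>] (sSup O), u ∈ O := nhdsWithin_le_nhds (hOo.mem_nhds hm)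
    obtain ⟨u, hu, hu2⟩ := (hev.and self_mem_nhdsWithin).exists
    exact absurd (hle u hu) (not_le.mpr hu2)
  have hr0l : r0 < sSup O := lt_of_le_of_ne (hle r0 hr0O) (fun h => hnot (h ▸ hr0O))
  have h0 : 0 ≤ sSup O := by linarith [hr0.1]
  have hnΩ : pol (sSup O) θ ∉ Ω := by
    intro hm
    rcases hρy.lt_or_eq with h | h
    · exact hnot ⟨hr0.1.trans hr0l, h, hm⟩
    · exact hy _ hm (by rw [norm_pol h0, h])
  refine ⟨sSup O, ⟨?_, ?_⟩, hr0l, hρy, ?_⟩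
  · have h1 : sSup O ∈ closure O := csSup_mem_closure ⟨r0, hr0O⟩ hb
    have h2 := mem_closure_image (pol_cont_r θ).continuousAt h1
    refine closure_mono ?_ h2
    rintro _ ⟨r, hr, rfl⟩
    exact hr.2.2
  · rw [hopen.interior_eq]; exact hnΩ
  · intro r hr hm
    rw [pol_mem_ann hr.le] at hm
    exact hle r ⟨hm.2.1, hm.2.2, hm.1⟩

lemma ray_inner {Ω : Set ℂ} (hopen : IsOpen Ω) {x y θ : ℝ} (hx : 0 ≤ x)
    (hxΩ : ∀ z ∈ Ω, ‖z‖ ≠ x) {r0 : ℝ} (hr0 : x < r0 ∧ r0 < y) (hr0Ω : pol r0 θ ∈ Ω) :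
    ∃ α, pol α θ ∈ frontier Ω ∧ α < r0 ∧ x ≤ α ∧ ∀ r, 0 < r → pol r θ ∈ ann Ω x y → α ≤ r := by
  set O := {r | x < r ∧ r < y ∧ pol r θ ∈ Ω} with hO
  have hOo : IsOpen O := (isOpen_lt continuous_const continuous_id).inter
    ((isOpen_lt continuous_id continuous_const).inter (hopen.preimage (pol_cont_r θ)))
  have hr0O : r0 ∈ O := ⟨hr0.1, hr0.2, hr0Ω⟩
  have hb : BddBelow O := ⟨x, fun r hr => hr.1.le⟩
  have hle : ∀ r ∈ O, sInf O ≤ r := fun r hr => csInf_le hb hr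
  have hρx : x ≤ sInf O := le_csInf ⟨r0, hr0O⟩ (fun r hr => hr.1.le)
  have hnot : sInf O ∉ O := by
    intro hm
    have hev : ∀ᶠ u in 𝓝[<] (sInf O), u ∈ O := nhdsWithin_le_nhds (hOo.mem_nhds hm)
    obtain ⟨u, hu, hu2⟩ := (hev.and self_mem_nhdsWithin).exists
    exact absurd (hle u hu) (not_le.mpr hu2)
  have hr0l : sInf O < r0 := lt_of_le_of_ne (hle r0 hr0O) (fun h => hnot (h.symm ▸ hr0O))
  have h0 : 0 ≤ sInf O := by linarith
  have hnΩ : pol (sInf O) θ ∉ Ω := by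
    intro hm
    rcases hρx.lt_or_eq with h | h
    · exact hnot ⟨h, hr0l.trans hr0.2, hm⟩
    · exact hxΩ _ hm (by rw [norm_pol h0, ← h])
  refine ⟨sInf O, ⟨?_, ?_⟩, hr0l, hρx, ?_⟩
  · have h1 : sInf O ∈ closure O := csInf_mem_closure ⟨r0, hr0O⟩ hb
    have h2 := mem_closure_image (pol_cont_r θ).continuousAt h1
    refine closure_mono ?_ h2
    rintro _ ⟨r, hr, rfl⟩
    exact hr.2.2
  · rw [hopen.interior_eq]; exact hnΩ
  · intro r hr hm
    rw [pol_mem_ann hr.le] at hm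
    exact hle r ⟨hm.2.1, hm.2.2, hm.1⟩

/-- circle minus a point is connected -/
lemma circle_minus {r : ℝ} (hr : 0 < r) {f : ℂ} (hf : ‖f‖ = r) :
    IsPreconnected {z : ℂ | ‖z‖ = r ∧ z ≠ f} := by
  have hf0 : f ≠ 0 := by rw [← norm_pos_iff, hf]; exact hr
  have e : {z : ℂ | ‖z‖ = r ∧ z ≠ f} = (fun t : ℝ => f * Complex.exp (t * Complex.I)) '' Ioo 0 (2 * π) := by
    ext z
    simp only [mem_ofPred_eq, mem_image, mem_Ioo]
    constructor
    · rintro ⟨hz, hne⟩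
      have hn : ‖z / f‖ = 1 := by rw [norm_div, hz, hf, div_self hr.ne']
      have h1 := Complex.norm_mul_exp_arg_mul_I (z / f)
      rw [hn, Complex.ofReal_one, one_mul] at h1
      have h2 := Complex.neg_pi_lt_arg (z / f)
      have h3 := Complex.arg_le_pi (z / f)
      have hz' : f * Complex.exp (Complex.arg (z / f) * Complex.I) = z := by
        rw [h1]; field_simp
      rcases lt_trichotomy (Complex.arg (z / f)) 0 with h | h | h
      · refine ⟨Complex.arg (z / f) + 2 * π, ⟨by linarith [pi_pos], by linarith⟩, ?_⟩
        push_cast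
        rw [add_mul, Complex.exp_add, Complex.exp_two_pi_mul_I, mul_one, hz']
      · rw [h] at hz'
        exact absurd (by simpa using hz'.symm) hne
      · exact ⟨_, ⟨h, by linarith [pi_pos]⟩, hz'⟩
    · rintro ⟨t, ⟨h1, h2⟩, rfl⟩
      refine ⟨by rw [norm_mul, Complex.norm_exp_ofReal_mul_I, mul_one, hf], ?_⟩
      intro h
      have : Complex.exp (t * Complex.I) = 1 := by
        have : f * Complex.exp (t * Complex.I) = f * 1 := by rw [h, mul_one]
        exact mul_left_cancel₀ hf0 this
      rw [Complex.exp_eq_one_iff] at this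
      obtain ⟨n, hn⟩ := this
      have hn2 : (t : ℂ) = n * (2 * π) := by
        have : (t : ℂ) * Complex.I = (n * (2 * π)) * Complex.I := by rw [hn]; ring
        exact mul_right_cancel₀ Complex.I_ne_zero this
      have hn3 : t = n * (2 * π) := by exact_mod_cast hn2
      have hp := pi_pos
      have a1 : (0:ℝ) < n := by
        by_contra hc; push Not at hc; nlinarith
      have a2 : (n:ℝ) < 1 := by
        by_contra hc; push Not at hc; nlinarith
      have a1' : 0 < n := by exact_mod_cast a1
      have a2' : n < 1 := by exact_mod_cast a2
      omega
  rw [e]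
  exact isPreconnected_Ioo.image _ (by fun_prop)

lemma conn_frontier {K Ω : Set ℂ} (hK : IsPreconnected K) (hopen : IsOpen Ω)
    (h1 : (K ∩ Ω).Nonempty) (h2 : ∃ v ∈ K, v ∉ Ω) : ∃ f ∈ K, f ∈ frontier Ω := by
  by_contra hc
  push Not at hc
  obtain ⟨v, hvK, hvΩ⟩ := h2
  have hsub : ∀ z ∈ K, z ∉ Ω → z ∈ (closure Ω)ᶜ := by
    intro z hz hzΩ hcl
    exact hc z hz ⟨hcl, by rwa [hopen.interior_eq]⟩
  obtain ⟨z, _, hz1, hz2⟩ := hK Ω (closure Ω)ᶜ hopen isClosed_closure.isOpen_compl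
    (fun z hz => by
      by_cases h : z ∈ Ω
      · exact Or.inl h
      · exact Or.inr (hsub z hz h)) h1 ⟨v, hvK, hsub v hvK hvΩ⟩
  exact hz2 (subset_closure hz1)

lemma two_points {Ω : Set ℂ} (hopen : IsOpen Ω) {r : ℝ} (hr : 0 < r) {w z1 z2 : ℂ} (hw : w ∈ Ω)
    (hwr : ‖w‖ = r) (h1 : z1 ∉ Ω) (h2 : z2 ∉ Ω) (h1r : ‖z1‖ = r) (h2r : ‖z2‖ = r) (h12 : z1 ≠ z2) :
    ∃ f1 ∈ frontier Ω, ∃ f2 ∈ frontier Ω, f1 ≠ f2 ∧ ‖f1‖ = r ∧ ‖f2‖ = r := by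
  have key : ∀ u v : ℂ, u ∉ Ω → v ∉ Ω → ‖u‖ = r → ‖v‖ = r → u ≠ v → ∃ f ∈ frontier Ω, ‖f‖ = r ∧ f ≠ u := by
    intro u v hu hv hur hvr huv
    obtain ⟨f, hf1, hf2⟩ := conn_frontier (circle_minus hr hur) hopen
      ⟨w, ⟨hwr, fun h => hu (h ▸ hw)⟩, hw⟩ ⟨v, ⟨hvr, huv.symm⟩, hv⟩
    exact ⟨f, hf2, hf1.1, hf1.2⟩
  obtain ⟨f, hf, hfr, hfz⟩ := key z1 z2 h1 h2 h1r h2r h12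
  have hfΩ : f ∉ Ω := by
    have := hf.2; rwa [hopen.interior_eq] at this
  obtain ⟨f2, hf2, hf2r, hf2f⟩ := key f z1 hfΩ h1 hfr h1r hfz
  exact ⟨f, hf, f2, hf2, hf2f.symm, hfr, hf2r⟩

/-- weighted length -/
noncomputable def Lp' (p : ℝ) (S : Set ℂ) : ℝ≥0∞ := ∫⁻ z in S, ENNReal.ofReal (‖z‖ ^ p) ∂μH[1]

lemma Lp'_mono {p : ℝ} {S T : Set ℂ} (h : S ⊆ T) : Lp' p S ≤ Lp' p T := lintegral_mono_set h

lemma vol_pi : volume (Ioo (-π) π) = ENNReal.ofReal (2 * π) := by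
  rw [Real.volume_Ioo]; congr 1; ring

lemma vol_ball_C {y : ℝ} (hy : 0 ≤ y) : volume (ball (0:ℂ) y) = ENNReal.ofReal (π * y ^ 2) := by
  rw [Complex.volume_ball, ENNReal.ofReal_mul pi_pos.le, ENNReal.ofReal_pow hy, mul_comm]
  congr 1
  rw [ENNReal.ofReal, ← NNReal.coe_real_pi, Real.toNNReal_coe]

lemma circle_L {n : ℕ} {γ : Fin n → ℝ → ℂ} {Γ : Set ℂ} (h : RegCurves γ Γ) {p y : ℝ} (hy : 0 < y)
    (hθ : ∀ᵐ θ, θ ∈ Ioo (-π) π → pol y θ ∈ Γ) :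
    ENNReal.ofReal (2 * π * (y ^ p * y)) ≤ Lp' p (Γ ∩ sphere 0 y) := by
  have hyp : 0 ≤ y ^ p * y := by positivity
  have := slicing h (p := p) (S := Γ ∩ sphere 0 y) (h.isCompact.isClosed.inter isClosed_sphere)
    inter_subset_left (by rintro ⟨_, h0⟩; simp at h0; linarith) (A := fun _ => 0) (G := fun _ => y ^ p * y)
    continuous_const continuous_const (fun _ => le_rfl) (fun _ => hyp)
    (by
      rintro z ⟨_, hz⟩
      have : ‖z‖ = y := by simpa using hz
      simp [this]) (fun _ => 0) (fun _ => ENNReal.ofReal (y ^ p * y))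
    (by
      filter_upwards with ξ
      exact ⟨∅, by simp⟩)
    (by
      filter_upwards [hθ] with θ h1 hθ
      refine ⟨{pol y θ}, ?_, ?_, by simp⟩
      · simp only [Finset.coe_singleton, singleton_subset_iff]
        exact ⟨h1 hθ, by simp [norm_pol hy.le]⟩
      · simp [arg_pol hy hθ])
  refine le_trans ?_ this
  rw [lintegral_zero, zero_add, setLIntegral_const, vol_pi, ← ENNReal.ofReal_mul hyp, mul_comm]

lemma haus_curve_pos {γ : ℝ → ℂ} (hγ : ContDiff ℝ 1 γ) {t0 : ℝ} (hv : deriv γ t0 ≠ 0) {δ : ℝ} (hδ : 0 < δ) :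
    0 < μH[1] (γ '' Ioo (t0 - δ) (t0 + δ)) := by
  have hd : HasDerivAt γ (deriv γ t0) t0 := (hγ.differentiable (by norm_num) t0).hasDerivAt
  have h1 : ∀ᶠ t in 𝓝[≠] t0, γ t ≠ γ t0 := hd.eventually_ne hv
  have h2 : ∀ᶠ t in 𝓝[≠] t0, t ∈ Ioo (t0 - δ) (t0 + δ) :=
    nhdsWithin_le_nhds (Ioo_mem_nhds (by linarith) (by linarith))
  obtain ⟨t1, ht1, ht1'⟩ := (h1.and h2).exists
  set f : ℂ → ℝ := fun w => dist w (γ t0) with hf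
  have hfl : LipschitzWith 1 f := LipschitzWith.dist_left (γ t0)
  have h3 := hfl.hausdorffMeasure_image_le (d := 1) zero_le_one (γ '' Ioo (t0 - δ) (t0 + δ))
  simp only [ENNReal.coe_one, ENNReal.one_rpow, one_mul] at h3
  refine lt_of_lt_of_le ?_ h3
  have hpre : IsPreconnected (f '' (γ '' Ioo (t0 - δ) (t0 + δ))) := by
    refine (isPreconnected_Ioo.image _ hγ.continuous.continuousOn).image _ hfl.continuous.continuousOn
  have hsub : Icc 0 (f (γ t1)) ⊆ f '' (γ '' Ioo (t0 - δ) (t0 + δ)) := by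
    apply hpre.Icc_subset
    · exact ⟨γ t0, ⟨t0, ⟨by linarith, by linarith⟩, rfl⟩, by simp [hf]⟩
    · exact ⟨γ t1, ⟨t1, ht1', rfl⟩, rfl⟩
  refine lt_of_lt_of_le ?_ (measure_mono hsub)
  rw [hausdorffMeasure_real, Real.volume_Icc]
  simpa [hf] using ht1

lemma fin_lemma {n : ℕ} {γ : Fin n → ℝ → ℂ} {Ω : Set ℂ} (h : RegCurves γ (frontier Ω)) (hopen : IsOpen Ω)
    {p y : ℝ} (hy : 0 < y) (hsub : Ω ⊆ ball 0 y) (hvol : ENNReal.ofReal (π * y ^ 2) ≤ volume Ω)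
    (hL : Lp' p (frontier Ω) ≤ ENNReal.ofReal (2 * π * (y ^ p * y)))
    (hLs : ENNReal.ofReal (2 * π * (y ^ p * y)) ≤ Lp' p (frontier Ω ∩ sphere 0 y)) :
    Ω = ball 0 y := by
  have hz : Lp' p (frontier Ω ∩ ball 0 y) = 0 := by
    have hadd : Lp' p (frontier Ω ∩ sphere 0 y) + Lp' p (frontier Ω ∩ ball 0 y) ≤ Lp' p (frontier Ω) := by
      unfold Lp'
      rw [← lintegral_union (h.isCompact.isClosed.measurableSet.inter isOpen_ball.measurableSet)]
      · exact lintegral_mono_set (union_subset inter_subset_left inter_subset_left)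
      · exact (sphere_disjoint_ball (x := (0:ℂ)) (ε := y)).mono inter_subset_right inter_subset_right
    have h3 := (add_le_add_left hLs (Lp' p (frontier Ω ∩ ball 0 y))).trans (hadd.trans hL)
    have h4 : ENNReal.ofReal (2 * π * (y ^ p * y)) + Lp' p (frontier Ω ∩ ball 0 y) ≤
      ENNReal.ofReal (2 * π * (y ^ p * y)) + 0 := by simpa using h3
    have := (ENNReal.add_le_add_iff_left ENNReal.ofReal_ne_top).mp h4
    exact le_antisymm this zero_le
  have hnull : μH[1] (frontier Ω ∩ ball 0 y) = 0 := by
    unfold Lp' at hz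
    have hm : Measurable fun z : ℂ => ENNReal.ofReal (‖z‖ ^ p) := by fun_prop
    rw [lintegral_eq_zero_iff hm] at hz
    have hms : MeasurableSet (frontier Ω ∩ ball 0 y) :=
      (h.isCompact.isClosed.measurableSet.inter isOpen_ball.measurableSet)
    rw [EventuallyEq, ae_restrict_iff' hms] at hz
    have h0 : μH[1] ({0} : Set ℂ) = 0 := by
      have : NullSingletonClass (μH[1] : Measure ℂ) := Measure.nullSingletonClass_hausdorff ℂ one_pos
      exact measure_singleton 0
    refine measure_mono_null (t := {z | ¬ (z ∈ frontier Ω ∩ ball 0 y → ENNReal.ofReal (‖z‖ ^ p) = 0)} ∪ {0}) ?_ ?_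
    · intro z hz'
      by_cases hz0 : z = 0
      · right; exact hz0
      · left
        intro hc
        have h1 := hc hz'
        rw [ENNReal.ofReal_eq_zero] at h1
        have : 0 < ‖z‖ ^ p := Real.rpow_pos_of_pos (norm_pos_iff.mpr hz0) p
        linarith
    · exact measure_union_null hz h0
  apply subset_antisymm hsub
  intro z hzb
  by_contra hzΩ
  have hcl : z ∈ closure Ω := by
    by_contra hc
    have hopen' : IsOpen (ball 0 y ∩ (closure Ω)ᶜ) := isOpen_ball.inter isClosed_closure.isOpen_compl
    have hpos := hopen'.measure_pos volume ⟨z, hzb, hc⟩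
    have hdis : Disjoint Ω (ball 0 y ∩ (closure Ω)ᶜ) := by
      rw [Set.disjoint_left]
      intro w hw hw2
      exact hw2.2 (subset_closure hw)
    have hle : volume Ω + volume (ball 0 y ∩ (closure Ω)ᶜ) ≤ volume (ball (0:ℂ) y) := by
      rw [← measure_union hdis hopen'.measurableSet]
      exact measure_mono (union_subset hsub inter_subset_left)
    have hb := vol_ball_C hy.le
    have h4 : ENNReal.ofReal (π * y ^ 2) + volume (ball 0 y ∩ (closure Ω)ᶜ) ≤ ENNReal.ofReal (π * y ^ 2) + 0 := by
      rw [add_zero]; rw [hb] at hle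
      exact le_trans (add_le_add_left hvol _) hle
    have := (ENNReal.add_le_add_iff_left ENNReal.ofReal_ne_top).mp h4
    exact absurd hpos (not_lt.mpr this)
  have hfr : z ∈ frontier Ω := ⟨hcl, by rwa [hopen.interior_eq]⟩
  have hfr' := hfr
  rw [h.eq, mem_iUnion] at hfr'
  obtain ⟨i, t0, ht0⟩ := hfr'
  have hnear : ∀ᶠ t in 𝓝 t0, γ i t ∈ ball (0:ℂ) y :=
    (h.smooth i).continuous.continuousAt.eventually_mem (isOpen_ball.mem_nhds (by rw [ht0]; exact hzb))
  obtain ⟨δ, hδ, hball⟩ := Metric.eventually_nhds_iff_ball.mp hnear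
  have hp := haus_curve_pos (h.smooth i) (h.reg i t0) hδ
  refine absurd (measure_mono_null ?_ hnull) hp.ne'
  rintro _ ⟨t, ht, rfl⟩
  refine ⟨?_, hball t ?_⟩
  · rw [h.eq, mem_iUnion]; exact ⟨i, t, rfl⟩
  · rw [Real.ball_eq_Ioo]; exact ht

lemma tangent_line {p R ρ : ℝ} (hp : 1 ≤ p) (hR : 0 < R) (hρ : 0 ≤ ρ) :
    (p + 1) / 2 * (R ^ p / R) * ρ ^ 2 + R ^ p * R * (1 - (p + 1) / 2) ≤ ρ ^ p * ρ := by
  have h := one_add_mul_self_le_rpow_one_add (s := (ρ / R) ^ 2 - 1) (by nlinarith [sq_nonneg (ρ / R)])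
    (p := (p + 1) / 2) (by linarith)
  have e : (1 + ((ρ / R) ^ 2 - 1)) ^ ((p + 1) / 2) = (ρ ^ p * ρ) / (R ^ p * R) := by
    rw [add_sub_cancel, ← Real.rpow_natCast (ρ / R) 2, ← Real.rpow_mul (by positivity),
      ← Real.rpow_add_one' hρ (by linarith), ← Real.rpow_add_one hR.ne', ← Real.div_rpow hρ hR.le]
    congr 1; push_cast; field_simp
  rw [e, le_div_iff₀ (by positivity)] at h
  refine le_trans (le_of_eq ?_) h
  have : 0 < R ^ p := by positivity
  field_simp
  ring

lemma tilt_ineq {n : ℕ} {γ : Fin n → ℝ → ℂ} {Ω : Set ℂ} (h : RegCurves γ (frontier Ω)) (hopen : IsOpen Ω)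
    {p R M : ℝ} (hp : 1 ≤ p) (hR : 0 < R) (hM : Ω ⊆ ball 0 M) (hvol : volume Ω = ENNReal.ofReal (π * R ^ 2))
    (hL : Lp' p (frontier Ω) ≤ ENNReal.ofReal (2 * π * (R ^ p * R)))
    {c0 d0 : ℝ} (hc0 : 0 < c0) (hcd : c0 < d0) (hintg : Icc c0 d0 ⊆ norm '' frontier Ω)
    {s c : ℝ} (hs : 0 ≤ s) (hc : 0 < c) (hsc : s ^ 2 + c ^ 2 = 1) {r1 : ℝ} (hr1 : 0 < r1) (hr1c : r1 ≤ c0) :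
    s * (c0 ^ p * c0 * (log d0 - log c0)) +
      c * (2 * π * (R ^ p * R) - 2 * ((p + 1) / 2 * (R ^ p / R)) * π * r1 ^ 2) ≤ 2 * π * (R ^ p * R) := by
  set κ := (p + 1) / 2 * (R ^ p / R) with hκ
  set β := R ^ p * R * (1 - (p + 1) / 2) with hβ
  have hp0 : 0 < p := by linarith
  have hκ0 : 0 < κ := by positivity
  have hβ0 : β ≤ 0 := by
    apply mul_nonpos_of_nonneg_of_nonpos (by positivity); linarith
  have hT : R ^ p * R = κ * R ^ 2 + β := by rw [hκ, hβ]; field_simp; ring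
  have hcont : Continuous fun r : ℝ => |r| ^ p * |r| :=
    ((Real.continuous_rpow_const hp0.le).comp continuous_abs).mul continuous_abs
  set S := frontier Ω ∩ {z | r1 ≤ ‖z‖} with hS
  set X : ℝ → ℝ≥0∞ := fun θ => ENNReal.ofReal κ * hray (ann Ω r1 M) θ - ENNReal.ofReal (-β) with hX
  set ψ : ℝ → ℝ≥0∞ := (Ioo (log c0) (log d0)).indicator (fun _ => ENNReal.ofReal (s * (c0 ^ p * c0))) with hψ
  have hy : ∀ z ∈ Ω, ‖z‖ ≠ M := by
    intro z hz
    have := hM hz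
    rw [mem_ball_zero_iff] at this
    exact this.ne
  have key := slicing h (p := p) (S := S)
    (h.isCompact.isClosed.inter (isClosed_le continuous_const continuous_norm))
    inter_subset_left (by rintro ⟨_, h0⟩; simp only [mem_ofPred_eq, norm_zero] at h0; linarith)
    (A := fun r => s * (|r| ^ p * |r|)) (G := fun r => c * (|r| ^ p * |r|))
    (continuous_const.mul hcont) (continuous_const.mul hcont) (fun _ => by positivity) (fun _ => by positivity)
    (by
      rintro z ⟨_, hz⟩
      simp only [abs_norm]
      have : (s * (‖z‖ ^ p * ‖z‖)) ^ 2 + (c * (‖z‖ ^ p * ‖z‖)) ^ 2 = (s ^ 2 + c ^ 2) * (‖z‖ ^ p * ‖z‖) ^ 2 := by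
        ring
      rw [this, hsc, one_mul]) ψ (fun θ => ENNReal.ofReal c * X θ)
    (by
      filter_upwards with ξ
      by_cases hξ : ξ ∈ Ioo (log c0) (log d0)
      · have e1 : c0 ≤ exp ξ := by
          rw [← Real.log_le_iff_le_exp hc0]; exact hξ.1.le
        have e2 : exp ξ ≤ d0 := by
          rw [← Real.le_log_iff_exp_le (by linarith)]; exact hξ.2.le
        obtain ⟨z, hz, hzn⟩ := hintg ⟨e1, e2⟩
        refine ⟨{z}, ?_, ?_, ?_⟩
        · simp only [Finset.coe_singleton, singleton_subset_iff]
          exact ⟨hz, by simp only [mem_ofPred_eq]; rw [hzn]; linarith⟩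
        · simp [hzn]
        · rw [hψ, indicator_of_mem hξ, Finset.sum_singleton, hzn, abs_of_pos (exp_pos ξ)]
          apply ENNReal.ofReal_le_ofReal
          gcongr
      · exact ⟨∅, by simp, by simp, by rw [hψ, indicator_of_notMem hξ]; exact zero_le⟩)
    (by
      filter_upwards with θ hθ
      by_cases hne : ∃ r0, 0 < r0 ∧ pol r0 θ ∈ ann Ω r1 M
      · obtain ⟨r0, hr0, hr0m⟩ := hne
        rw [pol_mem_ann hr0.le] at hr0m
        obtain ⟨ρ, hρΓ, hρ1, hρM, hρ⟩ := ray_outer hopen hr1.le hy hr0m.2 hr0m.1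
        have hρ0 : 0 < ρ := by linarith
        refine ⟨{pol ρ θ}, ?_, ?_, ?_⟩
        · simp only [Finset.coe_singleton, singleton_subset_iff]
          exact ⟨hρΓ, by simp only [mem_ofPred_eq]; rw [norm_pol hρ0.le]; linarith [hr0m.2.1]⟩
        · simp [arg_pol hρ0 hθ]
        · rw [Finset.sum_singleton, norm_pol hρ0.le, abs_of_pos hρ0, ENNReal.ofReal_mul hc.le]
          gcongr
          rw [hX]
          simp only
          rw [tsub_le_iff_right, ← ENNReal.ofReal_add (by positivity) (by linarith)]
          have hb := hray_le (U := ann Ω r1 M) (θ := θ) le_rfl hρ0.le (fun r hr hm => ⟨hr.le, hρ r hr hm⟩)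
          calc _ ≤ ENNReal.ofReal κ * ENNReal.ofReal (ρ ^ 2 - 0 ^ 2) := by gcongr
            _ = ENNReal.ofReal (κ * (ρ ^ 2 - 0 ^ 2)) := (ENNReal.ofReal_mul hκ0.le).symm
            _ ≤ _ := by
              apply ENNReal.ofReal_le_ofReal
              have := tangent_line hp hR hρ0.le
              rw [← hκ, ← hβ] at this
              linarith
      · push Not at hne
        refine ⟨∅, by simp, by simp, ?_⟩
        rw [hX]
        simp [hray_zero hne])
  have k1 : ∫⁻ ξ, ψ ξ = ENNReal.ofReal (s * (c0 ^ p * c0 * (log d0 - log c0))) := by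
    rw [hψ, lintegral_indicator_const measurableSet_Ioo, Real.volume_Ioo, ← ENNReal.ofReal_mul (by positivity)]
    congr 1; ring
  rw [k1, lintegral_const_mul' _ _ ENNReal.ofReal_ne_top] at key
  have k2 := (key.trans (Lp'_mono (p := p) inter_subset_left : Lp' p S ≤ _)).trans hL
  set XX := ∫⁻ θ in Ioo (-π) π, X θ with hXX
  have hlogs : 0 ≤ log d0 - log c0 := by
    have := Real.log_le_log hc0 hcd.le; linarith
  have hXfin : XX ≠ ⊤ := by
    intro ht
    rw [ht, ENNReal.mul_top (by simpa using hc)] at k2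
    simp at k2
  have k3 : ENNReal.ofReal κ * (2 * volume (ann Ω r1 M)) ≤ XX + ENNReal.ofReal (-β) * ENNReal.ofReal (2 * π) := by
    rw [← polar_hray (ann_open hopen r1 M).measurableSet, ← lintegral_const_mul' _ _ ENNReal.ofReal_ne_top,
      ← vol_pi, ← setLIntegral_const, hXX, ← lintegral_add_right _ measurable_const]
    apply lintegral_mono
    intro θ
    exact le_tsub_add
  have k4 : ENNReal.ofReal (π * R ^ 2) ≤ volume (ann Ω r1 M) + ENNReal.ofReal (π * r1 ^ 2) := by
    rw [← hvol]
    have hsub : Ω ⊆ ann Ω r1 M ∪ closedBall 0 r1 := by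
      intro z hz
      by_cases hz1 : ‖z‖ ≤ r1
      · right; simpa using hz1
      · left
        push Not at hz1
        exact ⟨hz, hz1, by simpa using hM hz⟩
    refine (measure_mono hsub).trans ((measure_union_le _ _).trans ?_)
    gcongr
    have : volume (closedBall (0:ℂ) r1) = volume (ball (0:ℂ) r1) := by
      rw [Complex.volume_closedBall, Complex.volume_ball]
    rw [this, vol_ball_C hr1.le]
  have hvfin : volume (ann Ω r1 M) ≠ ⊤ := by
    refine ((measure_mono (inter_subset_left : ann Ω r1 M ⊆ Ω)).trans_lt ?_).ne
    rw [hvol]; exact ENNReal.ofReal_lt_top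
  lift XX to ℝ≥0 using hXfin with x
  set V := volume (ann Ω r1 M)
  lift V to ℝ≥0 using hvfin with v
  have k2' : s * (c0 ^ p * c0 * (log d0 - log c0)) + c * x ≤ 2 * π * (R ^ p * R) := by
    have : ENNReal.ofReal (s * (c0 ^ p * c0 * (log d0 - log c0)) + c * x) ≤ ENNReal.ofReal (2 * π * (R ^ p * R)) := by
      rw [ENNReal.ofReal_add (by positivity) (by positivity), ENNReal.ofReal_mul hc.le, ENNReal.ofReal_coe_nnreal]
      exact k2
    exact (ENNReal.ofReal_le_ofReal_iff (by positivity)).mp this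
  have k3' : κ * (2 * v) ≤ x + (-β) * (2 * π) := by
    have : ENNReal.ofReal (κ * (2 * v)) ≤ ENNReal.ofReal (x + (-β) * (2 * π)) := by
      have e1 : ENNReal.ofReal (κ * (2 * v)) = ENNReal.ofReal κ * (2 * v) := by
        rw [ENNReal.ofReal_mul hκ0.le, ENNReal.ofReal_mul zero_le_two, ENNReal.ofReal_coe_nnreal]
        simp
      have e2 : ENNReal.ofReal ((-β) * (2 * π)) = ENNReal.ofReal (-β) * ENNReal.ofReal (2 * π) :=
        ENNReal.ofReal_mul (by linarith)
      rw [ENNReal.ofReal_add (by positivity) (mul_nonneg (by linarith) (by positivity)), e1, e2,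
        ENNReal.ofReal_coe_nnreal]
      exact k3
    exact (ENNReal.ofReal_le_ofReal_iff (add_nonneg (by positivity) (mul_nonneg (by linarith) (by positivity)))).mp this
  have k4' : π * R ^ 2 ≤ v + π * r1 ^ 2 := by
    have : ENNReal.ofReal (π * R ^ 2) ≤ ENNReal.ofReal (v + π * r1 ^ 2) := by
      rw [ENNReal.ofReal_add (by positivity) (by positivity), ENNReal.ofReal_coe_nnreal]
      exact k4
    exact (ENNReal.ofReal_le_ofReal_iff (by positivity)).mp this
  refine le_trans ?_ k2'
  gcongr
  rw [hT]
  have := mul_le_mul_of_nonneg_left k4' hκ0.le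
  linarith

lemma no_interval {n : ℕ} {γ : Fin n → ℝ → ℂ} {Ω : Set ℂ} (h : RegCurves γ (frontier Ω)) (hopen : IsOpen Ω)
    {p R M : ℝ} (hp : 1 ≤ p) (hR : 0 < R) (hM : Ω ⊆ ball 0 M) (hvol : volume Ω = ENNReal.ofReal (π * R ^ 2))
    (hL : Lp' p (frontier Ω) ≤ ENNReal.ofReal (2 * π * (R ^ p * R)))
    {c0 d0 : ℝ} (hc0 : 0 < c0) (hcd : c0 < d0) (hintg : Icc c0 d0 ⊆ norm '' frontier Ω) : False := by
  set m := c0 ^ p * c0 * (log d0 - log c0) with hm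
  set T := 2 * π * (R ^ p * R) with hT
  have hT0 : 0 < T := by positivity
  have hm0 : 0 < m := by
    have := Real.log_lt_log hc0 hcd
    have : 0 < log d0 - log c0 := by linarith
    positivity
  have step : ∀ s c : ℝ, 0 ≤ s → 0 < c → s ^ 2 + c ^ 2 = 1 → s * m + c * T ≤ T := by
    intro s c hs hc hsc
    have hlim : Tendsto (fun r1 : ℝ => s * m + c * (T - 2 * ((p + 1) / 2 * (R ^ p / R)) * π * r1 ^ 2)) (𝓝[>] 0)
        (𝓝 (s * m + c * (T - 2 * ((p + 1) / 2 * (R ^ p / R)) * π * 0 ^ 2))) := by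
      apply Tendsto.mono_left _ nhdsWithin_le_nhds
      apply Continuous.tendsto; fun_prop
    have : s * m + c * (T - 2 * ((p + 1) / 2 * (R ^ p / R)) * π * 0 ^ 2) ≤ T := by
      apply le_of_tendsto hlim
      have hev : ∀ᶠ r1 : ℝ in 𝓝[>] 0, r1 < c0 := nhdsWithin_le_nhds (Iio_mem_nhds hc0)
      filter_upwards [hev, self_mem_nhdsWithin] with r1 h1 h2
      exact tilt_ineq h hopen hp hR hM hvol hL hc0 hcd hintg hs hc hsc h2 h1.le
    simpa using this
  obtain ⟨t, ht0, ht1, htm⟩ : ∃ t : ℝ, 0 < t ∧ t < 1 ∧ t * T < m := by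
    refine ⟨m / (m + T) * (1 / 2), by positivity, ?_, ?_⟩
    · have : m / (m + T) < 1 := by rw [div_lt_one (by positivity)]; linarith
      linarith
    · rw [div_mul_eq_mul_div, div_mul_eq_mul_div, div_lt_iff₀ (by positivity)]
      nlinarith
  have := step (2 * t / (1 + t ^ 2)) ((1 - t ^ 2) / (1 + t ^ 2)) (by positivity)
    (div_pos (by nlinarith) (by positivity)) (by field_simp; ring)
  rw [div_mul_eq_mul_div, div_mul_eq_mul_div, ← add_div, div_le_iff₀ (by positivity)] at this
  nlinarith

lemma annulus_conn (c y : ℝ) (hc : 0 ≤ c) : IsPreconnected {z : ℂ | c < ‖z‖ ∧ ‖z‖ < y} := by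
  have e : {z : ℂ | c < ‖z‖ ∧ ‖z‖ < y} = (fun x : ℝ × ℝ => pol x.1 x.2) '' (Ioo c y ×ˢ univ) := by
    ext z
    simp only [mem_ofPred_eq, mem_image, mem_prod, mem_Ioo, mem_univ, and_true, Prod.exists]
    constructor
    · intro hz
      exact ⟨‖z‖, Complex.arg z, hz, pol_norm_arg z⟩
    · rintro ⟨r, θ, hr, rfl⟩
      rw [norm_pol (by linarith)]; exact hr
  rw [e]
  exact (isPreconnected_Ioo.prod isPreconnected_univ).image _ pol_cont.continuousOn

lemma main_ge {n : ℕ} {γ : Fin n → ℝ → ℂ} {Ω : Set ℂ} (h : RegCurves γ (frontier Ω)) (hopen : IsOpen Ω)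
    {p R M : ℝ} (hp : 1 ≤ p) (hR : 0 < R) (hM : Ω ⊆ ball 0 M) (hvol : volume Ω = ENNReal.ofReal (π * R ^ 2))
    (hL : Lp' p (frontier Ω) ≤ ENNReal.ofReal (2 * π * (R ^ p * R))) :
    ∃ y, Ω = ball 0 y := by
  have hconst : ∀ i t, ‖γ i t‖ = ‖γ i 0‖ := by
    intro i t
    by_contra hne
    wlog hlt : ‖γ i 0‖ < ‖γ i t‖ generalizing with H
    · -- symmetric situation
      have hlt' : ‖γ i t‖ < ‖γ i 0‖ := lt_of_le_of_ne (not_lt.mp hlt) hne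
      have hpre : IsPreconnected (range fun t => ‖γ i t‖) :=
        isPreconnected_range (h.smooth i).continuous.norm
      have hsub : Icc ‖γ i t‖ ‖γ i 0‖ ⊆ range fun t => ‖γ i t‖ := hpre.Icc_subset ⟨t, rfl⟩ ⟨0, rfl⟩
      have h0 := norm_nonneg (γ i t)
      refine no_interval h hopen hp hR hM hvol hL (c0 := (‖γ i t‖ + ‖γ i 0‖) / 2) (d0 := ‖γ i 0‖)
        (by linarith) (by linarith) ?_
      intro r hr
      obtain ⟨t', ht'⟩ := hsub ⟨by linarith [hr.1], hr.2⟩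
      exact ⟨γ i t', by rw [h.eq, mem_iUnion]; exact ⟨i, t', rfl⟩, ht'⟩
    · have hpre : IsPreconnected (range fun t => ‖γ i t‖) :=
        isPreconnected_range (h.smooth i).continuous.norm
      have hsub : Icc ‖γ i 0‖ ‖γ i t‖ ⊆ range fun t => ‖γ i t‖ := hpre.Icc_subset ⟨0, rfl⟩ ⟨t, rfl⟩
      have h0 := norm_nonneg (γ i 0)
      refine no_interval h hopen hp hR hM hvol hL (c0 := (‖γ i 0‖ + ‖γ i t‖) / 2) (d0 := ‖γ i t‖)
        (by linarith) (by linarith) ?_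
      intro r hr
      obtain ⟨t', ht'⟩ := hsub ⟨by linarith [hr.1], hr.2⟩
      exact ⟨γ i t', by rw [h.eq, mem_iUnion]; exact ⟨i, t', rfl⟩, ht'⟩
  have hne : Ω.Nonempty := by
    rw [nonempty_iff_ne_empty]; intro he
    rw [he, measure_empty] at hvol
    have : 0 < π * R ^ 2 := by positivity
    have := ENNReal.ofReal_pos.mpr this
    rw [← hvol] at this
    exact lt_irrefl _ this
  have hbd : BddAbove (norm '' Ω) := by
    refine ⟨M, ?_⟩
    rintro _ ⟨z, hz, rfl⟩
    have := hM hz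
    rw [mem_ball_zero_iff] at this
    exact this.le
  set y := sSup (norm '' Ω) with hy
  have hle : ∀ z ∈ Ω, ‖z‖ ≤ y := fun z hz => le_csSup hbd ⟨z, hz, rfl⟩
  have hlt : ∀ z ∈ Ω, ‖z‖ < y := by
    intro z hz
    -- push z slightly outward
    refine lt_of_le_of_ne (hle z hz) ?_
    intro he
    obtain ⟨ε, hε, hb⟩ := Metric.isOpen_iff.mp hopen z hz
    set w := pol (‖z‖ + ε / 2) (Complex.arg z) with hw
    have hwz : w ∈ ball z ε := by
      have e1 : w - z = pol (ε / 2) (Complex.arg z) := by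
        have e0 : w - z = w - pol ‖z‖ (Complex.arg z) := by rw [pol_norm_arg]
        rw [e0]
        rw [hw]
        unfold pol; push_cast; ring
      rw [mem_ball, dist_eq_norm, e1, norm_pol (by positivity)]; linarith
    have := hle w (hb hwz)
    rw [hw, norm_pol (by positivity)] at this
    linarith
  have hsub : Ω ⊆ ball 0 y := fun z hz => by rw [mem_ball_zero_iff]; exact hlt z hz
  have hy0 : 0 < y := by
    obtain ⟨z, hz⟩ := hne
    exact lt_of_le_of_lt (norm_nonneg z) (hlt z hz)
  have hRy : R ≤ y := by
    have := measure_mono hsub (μ := volume)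
    rw [hvol, vol_ball_C hy0.le, ENNReal.ofReal_le_ofReal_iff (by positivity)] at this
    have h2 : R ^ 2 ≤ y ^ 2 := le_of_mul_le_mul_left this pi_pos
    exact le_of_sq_le_sq h2 hy0.le
  -- a free annulus
  obtain ⟨c, hc0, hcy, hfree⟩ : ∃ c, 0 ≤ c ∧ c < y ∧ ∀ z ∈ frontier Ω, ¬ (c < ‖z‖ ∧ ‖z‖ < y) := by
    have hfin : ((range fun i => ‖γ i 0‖) ∩ Iio y).Finite := (finite_range _).inter_of_left _
    have hcl : IsClosed ((range fun i => ‖γ i 0‖) ∩ Iio y) := hfin.isClosed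
    have hyn : y ∉ (range fun i => ‖γ i 0‖) ∩ Iio y := fun hc => lt_irrefl y hc.2
    have hev : ∀ᶠ c in 𝓝[<] y, Ioo c y ⊆ ((range fun i => ‖γ i 0‖) ∩ Iio y)ᶜ := by
      obtain ⟨ε, hε, hb⟩ := Metric.isOpen_iff.mp hcl.isOpen_compl y hyn
      have : ∀ᶠ c in 𝓝[<] y, y - ε < c := nhdsWithin_le_nhds (Ioi_mem_nhds (by linarith))
      filter_upwards [this] with c hc u hu
      apply hb
      rw [Real.ball_eq_Ioo]
      exact ⟨by linarith [hu.1], by linarith [hu.2]⟩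
    have hev2 : ∀ᶠ c in 𝓝[<] y, 0 < c := nhdsWithin_le_nhds (Ioi_mem_nhds hy0)
    obtain ⟨c, ⟨h1, h2⟩, h3⟩ := ((hev.and hev2).and self_mem_nhdsWithin).exists
    refine ⟨c, h2.le, h3, ?_⟩
    rintro z hz ⟨hz1, hz2⟩
    apply h1 ⟨hz1, hz2⟩
    refine ⟨?_, hz2⟩
    rw [h.eq, mem_iUnion] at hz
    obtain ⟨i, t, rfl⟩ := hz
    exact ⟨i, (hconst i t).symm⟩
  have hannΩ : ∀ z : ℂ, c < ‖z‖ ∧ ‖z‖ < y → z ∈ Ω := by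
    intro z hz
    by_contra hzΩ
    obtain ⟨_, ⟨w, hw, rfl⟩, hcw⟩ := exists_lt_of_lt_csSup (hne.image norm) hcy
    obtain ⟨f, hf1, hf2⟩ := conn_frontier (annulus_conn c y hc0) hopen ⟨w, ⟨hcw, hlt w hw⟩, hw⟩ ⟨z, hz, hzΩ⟩
    exact hfree f hf2 hf1
  have hsph : ∀ θ, pol y θ ∈ frontier Ω := by
    intro θ
    refine ⟨?_, ?_⟩
    · have h1 : y ∈ closure (Ioo c y) := by rw [closure_Ioo hcy.ne]; exact ⟨hcy.le, le_rfl⟩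
      have h2 := mem_closure_image (pol_cont_r θ).continuousAt h1
      refine closure_mono ?_ h2
      rintro _ ⟨r, hr, rfl⟩
      apply hannΩ
      rw [norm_pol (by linarith [hr.1])]; exact hr
    · rw [hopen.interior_eq]
      intro hm
      have := hlt _ hm
      rw [norm_pol hy0.le] at this
      exact lt_irrefl _ this
  have hcl := circle_L h (p := p) hy0 (by filter_upwards with θ _ using hsph θ)
  have hyR : y ≤ R := by
    have := (hcl.trans (Lp'_mono inter_subset_left)).trans hL
    rw [ENNReal.ofReal_le_ofReal_iff (by positivity)] at this
    by_contra hc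
    push Not at hc
    have : R ^ p * R < y ^ p * y := by
      have : R ^ p ≤ y ^ p := Real.rpow_le_rpow hR.le hc.le (by linarith)
      have : 0 < y ^ p := by positivity
      nlinarith
    nlinarith [pi_pos]
  have e : y = R := le_antisymm hyR hRy
  refine ⟨y, fin_lemma h hopen hy0 hsub ?_ ?_ hcl⟩
  · rw [hvol, e]
  · rw [e]; exact hL

lemma conc3 {p u v w : ℝ} (hp0 : 0 < p) (hp1 : p < 1) (hu : 0 ≤ u) (huv : u ≤ v) (hvw : v ≤ w) :
    (w ^ 2 - v ^ 2) * (u ^ p * u) + (v ^ 2 - u ^ 2) * (w ^ p * w) ≤ (w ^ 2 - u ^ 2) * (v ^ p * v) := by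
  rcases eq_or_lt_of_le (huv.trans hvw) with he | hlt
  · have : u = v := le_antisymm huv (by linarith)
    subst this; subst he; ring_nf; rfl
  have hc := (Real.concaveOn_rpow (p := (p + 1) / 2) (by linarith) (by linarith)).2
  have hD : 0 < w ^ 2 - u ^ 2 := by nlinarith
  have hv0 : 0 ≤ v := hu.trans huv
  have hw0 : 0 ≤ w := hv0.trans hvw
  have hpow : ∀ r : ℝ, 0 ≤ r → (r ^ 2) ^ ((p + 1) / 2) = r ^ p * r := by
    intro r hr
    rw [← Real.rpow_add_one' hr (by linarith), ← Real.rpow_natCast r 2, ← Real.rpow_mul hr]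
    congr 1; push_cast; ring
  have := hc (x := u ^ 2) (mem_Ici.mpr (sq_nonneg u)) (y := w ^ 2) (mem_Ici.mpr (sq_nonneg w))
    (a := (w ^ 2 - v ^ 2) / (w ^ 2 - u ^ 2)) (b := (v ^ 2 - u ^ 2) / (w ^ 2 - u ^ 2))
    (div_nonneg (by nlinarith) hD.le) (div_nonneg (by nlinarith) hD.le) (by field_simp; ring)
  simp only [smul_eq_mul] at this
  rw [show (w ^ 2 - v ^ 2) / (w ^ 2 - u ^ 2) * u ^ 2 + (v ^ 2 - u ^ 2) / (w ^ 2 - u ^ 2) * w ^ 2 = v ^ 2 by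
    field_simp; ring, hpow u hu, hpow v hv0, hpow w hw0, div_mul_eq_mul_div, div_mul_eq_mul_div, ← add_div,
    div_le_iff₀ hD] at this
  linarith

lemma conc_between {p κ β a y r : ℝ} (hp0 : 0 < p) (hp1 : p < 1) (ha : 0 ≤ a) (hay : a < y)
    (hga : κ * a ^ 2 + β ≤ a ^ p * a) (hgy : κ * y ^ 2 + β ≤ y ^ p * y) (har : a ≤ r) (hry : r ≤ y) :
    κ * r ^ 2 + β ≤ r ^ p * r := by
  have h := conc3 hp0 hp1 ha har hry
  have hD : 0 < y ^ 2 - a ^ 2 := by nlinarith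
  have h1 : 0 ≤ y ^ 2 - r ^ 2 := by nlinarith
  have h2 : 0 ≤ r ^ 2 - a ^ 2 := by nlinarith
  have h3 := mul_le_mul_of_nonneg_left hga h1
  have h4 := mul_le_mul_of_nonneg_left hgy h2
  refine le_of_mul_le_mul_left ?_ hD
  linarith

lemma conc_right {p κ β a y r : ℝ} (hp0 : 0 < p) (hp1 : p < 1) (ha : 0 ≤ a) (hay : a < y)
    (hga : κ * a ^ 2 + β ≤ a ^ p * a) (hgy : κ * y ^ 2 + β = y ^ p * y) (hry : y ≤ r) :
    r ^ p * r ≤ κ * r ^ 2 + β := by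
  have h := conc3 hp0 hp1 ha hay.le hry
  have hD : 0 < y ^ 2 - a ^ 2 := by nlinarith
  have h1 : 0 ≤ r ^ 2 - y ^ 2 := by nlinarith
  have h3 := mul_le_mul_of_nonneg_left hga h1
  rw [← hgy] at h
  refine le_of_mul_le_mul_left ?_ hD
  linarith

lemma conc_left {p κ β a y r : ℝ} (hp0 : 0 < p) (hp1 : p < 1) (hr : 0 ≤ r) (hra : r ≤ a) (hay : a < y)
    (hga : κ * a ^ 2 + β = a ^ p * a) (hgy : κ * y ^ 2 + β = y ^ p * y) :
    r ^ p * r ≤ κ * r ^ 2 + β := by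
  have h := conc3 hp0 hp1 hr hra hay.le
  have hD : 0 < y ^ 2 - a ^ 2 := by nlinarith
  rw [← hgy, ← hga] at h
  refine le_of_mul_le_mul_left ?_ hD
  linarith

lemma ae_exp {P : ℝ → Prop} (h : ∀ᵐ r, P r) : ∀ᵐ ξ : ℝ, P (exp ξ) := by
  have hN : volume ({r | ¬ P r} ∩ Ioi 0) = 0 := measure_mono_null inter_subset_left h
  have h2 : volume (Real.log '' ({r | ¬ P r} ∩ Ioi 0)) = 0 := by
    refine addHaar_image_eq_zero_of_differentiableOn_of_addHaar_eq_zero volume ?_ hN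
    intro r hr
    exact (Real.differentiableAt_log (ne_of_gt hr.2)).differentiableWithinAt
  refine measure_mono_null ?_ h2
  intro ξ hξ
  exact ⟨exp ξ, ⟨hξ, exp_pos ξ⟩, Real.log_exp ξ⟩

lemma Acal_cont {p κ β : ℝ} (hp : 0 < p) : Continuous (Acal p κ β) := by
  unfold Acal
  have : Continuous fun r : ℝ => r ^ p := Real.continuous_rpow_const hp.le
  fun_prop

lemma Acal_zero {p κ β r : ℝ} (hr : 0 ≤ r) (h : r ^ p * r ≤ |κ * r ^ 2 + β|) : Acal p κ β r = 0 := by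
  unfold Acal
  apply Real.sqrt_eq_zero_of_nonpos
  have h0 : 0 ≤ r ^ p * r := by positivity
  have := pow_le_pow_left₀ h0 h 2
  rw [sq_abs] at this
  linarith

lemma Acal_sq {p κ β r : ℝ} (h : |κ * r ^ 2 + β| ≤ r ^ p * r) :
    Acal p κ β r ^ 2 + |κ * r ^ 2 + β| ^ 2 ≤ (r ^ p * r) ^ 2 := by
  unfold Acal
  have := pow_le_pow_left₀ (abs_nonneg _) h 2
  rw [Real.sq_sqrt (by rw [sq_abs] at this; linarith), sq_abs]
  linarith

/-- radii of circles almost contained in Ω -/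
def fullR (Ω : Set ℂ) (x y : ℝ) : Set ℝ :=
  {r | x < r ∧ r < y ∧ ∀ z1 z2 : ℂ, ‖z1‖ = r → ‖z2‖ = r → z1 ∉ Ω → z2 ∉ Ω → z1 = z2}

lemma psi_points {Ω : Set ℂ} (hopen : IsOpen Ω) {x y a p κ β : ℝ} (hx : 0 ≤ x) (hxa : x ≤ a)
    (hV : ∀ᵐ r : ℝ, x < r → r < y → ∃ z ∈ Ω, ‖z‖ = r)
    (ha : ∀ r, a < r → r ∉ fullR Ω x y)
    (hA : ∀ r, 0 < r → ¬ (a < r ∧ r < y) → Acal p κ β r = 0) :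
    ∀ᵐ ξ, ∃ P : Finset ℂ, (↑P : Set ℂ) ⊆ frontier Ω ∩ {z | a ≤ ‖z‖ ∧ ‖z‖ ≤ y} ∧ (∀ x ∈ P, Real.log ‖x‖ = ξ) ∧
      ENNReal.ofReal (2 * Acal p κ β (exp ξ)) ≤ ∑ x ∈ P, ENNReal.ofReal (Acal p κ β ‖x‖) := by
  filter_upwards [ae_exp hV] with ξ hξ
  by_cases hr : a < exp ξ ∧ exp ξ < y
  · obtain ⟨w, hw, hwr⟩ := hξ (by linarith [hr.1]) hr.2
    have hnf := ha _ hr.1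
    have : ∃ z1 z2 : ℂ, ‖z1‖ = exp ξ ∧ ‖z2‖ = exp ξ ∧ z1 ∉ Ω ∧ z2 ∉ Ω ∧ z1 ≠ z2 := by
      by_contra hc
      push Not at hc
      exact hnf ⟨by linarith [hr.1], hr.2, hc⟩
    obtain ⟨z1, z2, h1r, h2r, h1, h2, h12⟩ := this
    obtain ⟨f1, hf1, f2, hf2, hne, hn1, hn2⟩ := two_points hopen (exp_pos ξ) hw hwr h1 h2 h1r h2r h12
    refine ⟨{f1, f2}, ?_, ?_, ?_⟩
    · intro z hz
      simp only [Finset.coe_insert, Finset.coe_singleton, mem_insert_iff, mem_singleton_iff] at hz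
      rcases hz with rfl | rfl
      · exact ⟨hf1, by simp only [mem_ofPred_eq]; rw [hn1]; exact ⟨hr.1.le, hr.2.le⟩⟩
      · exact ⟨hf2, by simp only [mem_ofPred_eq]; rw [hn2]; exact ⟨hr.1.le, hr.2.le⟩⟩
    · intro z hz
      simp only [Finset.mem_insert, Finset.mem_singleton] at hz
      rcases hz with rfl | rfl
      · rw [hn1, Real.log_exp]
      · rw [hn2, Real.log_exp]
    · have hA0 : 0 ≤ Acal p κ β (exp ξ) := Real.sqrt_nonneg _
      rw [Finset.sum_pair hne, hn1, hn2, ← ENNReal.ofReal_add hA0 hA0, two_mul]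
  · refine ⟨∅, by simp, by simp, ?_⟩
    rw [hA _ (exp_pos ξ) hr]; simp

lemma ae_full {Ω : Set ℂ} {x y r : ℝ} (hx : 0 ≤ x) (hr : r ∈ fullR Ω x y) :
    ∀ᵐ θ : ℝ, θ ∈ Ioo (-π) π → pol r θ ∈ Ω := by
  have hr0 : 0 < r := by linarith [hr.1]
  have hs : ({θ : ℝ | ¬ (θ ∈ Ioo (-π) π → pol r θ ∈ Ω)}).Subsingleton := by
    intro θ1 h1 θ2 h2
    simp only [mem_ofPred_eq, Classical.not_imp] at h1 h2
    have := hr.2.2 _ _ (norm_pol hr0.le θ1) (norm_pol hr0.le θ2) h1.2 h2.2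
    rw [← arg_pol hr0 h1.1, ← arg_pol hr0 h2.1, this]
  exact hs.measure_zero volume

lemma zone_I {n : ℕ} {γ : Fin n → ℝ → ℂ} {Ω : Set ℂ} (h : RegCurves γ (frontier Ω)) (hopen : IsOpen Ω)
    {p R x y : ℝ} (hp0 : 0 < p) (hp1 : p < 1) (hR : 0 ≤ R) (hx : 0 ≤ x) (hxy : x < y)
    (hyΩ : ∀ z ∈ Ω, ‖z‖ ≠ y) (hV : ∀ᵐ r : ℝ, x < r → r < y → ∃ z ∈ Ω, ‖z‖ = r)
    (hvol : volume (ann Ω x y) = ENNReal.ofReal (π * R ^ 2)) (hF : (fullR Ω x y).Nonempty) :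
    ENNReal.ofReal (2 * π * (R ^ p * R)) < Lp' p (frontier Ω ∩ {z | x ≤ ‖z‖ ∧ ‖z‖ ≤ y}) ∨
    ENNReal.ofReal (2 * π * (y ^ p * y)) ≤ Lp' p (frontier Ω ∩ sphere 0 y) := by
  have hy0 : 0 < y := by linarith
  have hbd : BddAbove (fullR Ω x y) := ⟨y, fun r hr => hr.2.1.le⟩
  set a := sSup (fullR Ω x y) with ha
  obtain ⟨u, -, hut, huF⟩ := exists_seq_tendsto_sSup hF hbd
  have hay : a ≤ y := csSup_le hF (fun r hr => hr.2.1.le)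
  have hxa : x < a := by
    obtain ⟨r, hr⟩ := hF
    exact lt_of_lt_of_le hr.1 (le_csSup hbd hr)
  have ha0 : 0 < a := by linarith
  have hae : ∀ᵐ θ : ℝ, θ ∈ Ioo (-π) π → ∃ ρ, pol ρ θ ∈ frontier Ω ∧ a ≤ ρ ∧ ρ ≤ y ∧
      ∀ r, 0 < r → pol r θ ∈ ann Ω x y → r ≤ ρ := by
    have := ae_all_iff.mpr (fun k => ae_full hx (huF k))
    filter_upwards [this] with θ h1 hθ
    obtain ⟨ρ, hρ1, hρ2, hρ3, hρ4⟩ := ray_outer hopen hx hyΩ ⟨(huF 0).1, (huF 0).2.1⟩ (h1 0 hθ)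
    refine ⟨ρ, hρ1, ?_, hρ3, hρ4⟩
    apply le_of_tendsto' hut
    intro k
    have hk0 : 0 < u k := by linarith [(huF k).1]
    apply hρ4 _ hk0
    rw [pol_mem_ann hk0.le]
    exact ⟨h1 k hθ, (huF k).1, (huF k).2.1⟩
  rcases hay.eq_or_lt with he | hlt
  · right
    apply circle_L h hy0
    filter_upwards [hae] with θ h1 hθ
    obtain ⟨ρ, hρ1, hρ2, hρ3, -⟩ := h1 hθ
    have : ρ = y := le_antisymm hρ3 (by linarith)
    rw [← this]; exact hρ1
  · left
    have hD : 0 < y ^ 2 - a ^ 2 := by nlinarith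
    have hmono : a ^ p * a < y ^ p * y := by
      have h1 : a ^ p ≤ y ^ p := Real.rpow_le_rpow ha0.le hlt.le hp0.le
      have h2 : 0 < a ^ p := by positivity
      have h3 : 0 < y ^ p := by positivity
      nlinarith
    have hdec : y ^ p * a < a ^ p * y := by
      have h1 : (y / a) ^ p < y / a := by
        have : 1 < y / a := by rw [one_lt_div ha0]; exact hlt
        calc (y / a) ^ p < (y / a) ^ (1:ℝ) := Real.rpow_lt_rpow_of_exponent_lt this hp1
          _ = y / a := Real.rpow_one _
      rw [Real.div_rpow hy0.le ha0.le, div_lt_div_iff₀ (by positivity) ha0] at h1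
      linarith
    obtain ⟨κ, β, hκ, hβ, hga, hgy⟩ : ∃ κ β : ℝ, 0 < κ ∧ 0 < β ∧ κ * a ^ 2 + β = a ^ p * a ∧
        κ * y ^ 2 + β = y ^ p * y := by
      refine ⟨(y ^ p * y - a ^ p * a) / (y ^ 2 - a ^ 2), (a ^ p * a * y ^ 2 - y ^ p * y * a ^ 2) / (y ^ 2 - a ^ 2),
        div_pos (by linarith) hD, div_pos ?_ hD, ?_, ?_⟩
      · have : 0 < a * y * (a ^ p * y - y ^ p * a) := mul_pos (by positivity) (by linarith)
        nlinarith
      · field_simp; ring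
      · field_simp; ring
    have hsl := slicing h (p := p) (S := frontier Ω ∩ {z | a ≤ ‖z‖ ∧ ‖z‖ ≤ y})
      (h.isCompact.isClosed.inter ((isClosed_le continuous_const continuous_norm).inter
        (isClosed_le continuous_norm continuous_const)))
      inter_subset_left (by rintro ⟨_, h0⟩; simp only [mem_ofPred_eq, norm_zero] at h0; linarith)
      (A := Acal p κ β) (G := fun r => |κ * r ^ 2 + β|) (Acal_cont hp0) (by fun_prop)
      (fun r => Real.sqrt_nonneg _) (fun r => abs_nonneg _)
      (by
        rintro z ⟨_, hz⟩
        simp only [mem_ofPred_eq] at hz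
        apply Acal_sq
        rw [abs_of_nonneg (by positivity)]
        exact conc_between hp0 hp1 ha0.le hlt hga.le hgy.le hz.1 hz.2)
      (fun ξ => ENNReal.ofReal (2 * Acal p κ β (exp ξ)))
      (fun θ => ENNReal.ofReal κ * hray (ann Ω x y) θ + ENNReal.ofReal β)
      (psi_points hopen hx hxa.le hV (fun r hr hm => absurd (le_csSup hbd hm) (not_le.mpr hr))
        (by
          intro r hr hn
          apply Acal_zero hr.le
          rw [abs_of_nonneg (by positivity)]
          by_cases h1 : a < r
          · exact conc_right hp0 hp1 ha0.le hlt hga.le hgy (not_lt.mp (fun h2 => hn ⟨h1, h2⟩))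
          · exact conc_left hp0 hp1 hr.le (not_lt.mp h1) hlt hga hgy))
      (by
        filter_upwards [hae] with θ h1 hθ
        obtain ⟨ρ, hρ1, hρ2, hρ3, hρ4⟩ := h1 hθ
        have hρ0 : 0 < ρ := by linarith
        refine ⟨{pol ρ θ}, ?_, ?_, ?_⟩
        · simp only [Finset.coe_singleton, singleton_subset_iff]
          exact ⟨hρ1, by simp only [mem_ofPred_eq]; rw [norm_pol hρ0.le]; exact ⟨hρ2, hρ3⟩⟩
        · simp [arg_pol hρ0 hθ]
        · rw [Finset.sum_singleton, norm_pol hρ0.le, abs_of_nonneg (by positivity),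
            ENNReal.ofReal_add (by positivity) hβ.le, ENNReal.ofReal_mul hκ.le]
          gcongr
          have hb := hray_le (U := ann Ω x y) (θ := θ) le_rfl hρ0.le (fun r hr hm => ⟨hr.le, hρ4 r hr hm⟩)
          simpa using hb)
    refine lt_of_lt_of_le (oneD_I hp0 hp1 hκ hβ ha0 hlt hga hgy hR) (le_trans ?_ (hsl.trans (Lp'_mono ?_)))
    · gcongr
      rw [lintegral_add_right _ measurable_const, setLIntegral_const, vol_pi,
        lintegral_const_mul' _ _ ENNReal.ofReal_ne_top, polar_hray (ann_open hopen x y).measurableSet, hvol,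
        ENNReal.ofReal_add (by positivity) (by positivity)]
      apply le_of_eq
      congr 1
      · rw [show 2 * κ * (π * R ^ 2) = κ * (2 * (π * R ^ 2)) by ring, ENNReal.ofReal_mul hκ.le,
          ENNReal.ofReal_mul zero_le_two]; simp
      · rw [← ENNReal.ofReal_mul hβ.le]; congr 1; ring
    · apply inter_subset_inter_right
      rintro z ⟨h1, h2⟩
      exact ⟨by linarith, h2⟩

lemma zone_II {n : ℕ} {γ : Fin n → ℝ → ℂ} {Ω : Set ℂ} (h : RegCurves γ (frontier Ω)) (hopen : IsOpen Ω)
    {p R x y : ℝ} (hp0 : 0 < p) (hp1 : p < 1) (hR : 0 ≤ R) (hx : 0 < x) (hxy : x < y)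
    (hxΩ : ∀ z ∈ Ω, ‖z‖ ≠ x)
    (hyΩ : ∀ z ∈ Ω, ‖z‖ ≠ y) (hV : ∀ᵐ r : ℝ, x < r → r < y → ∃ z ∈ Ω, ‖z‖ = r)
    (hvol : volume (ann Ω x y) = ENNReal.ofReal (π * R ^ 2)) (hF : fullR Ω x y = ∅) :
    ENNReal.ofReal (2 * π * (R ^ p * R)) < Lp' p (frontier Ω ∩ {z | x ≤ ‖z‖ ∧ ‖z‖ ≤ y}) := by
  have hy0 : 0 < y := by linarith
  have hD : 0 < y ^ 2 - x ^ 2 := by nlinarith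
  have hxp : 0 < x ^ p * x := by positivity
  have hyp : 0 < y ^ p * y := by positivity
  obtain ⟨κ, β, hκ, hβ, hgx, hgy⟩ : ∃ κ β : ℝ, 0 < κ ∧ β < 0 ∧ κ * x ^ 2 + β = -(x ^ p * x) ∧
      κ * y ^ 2 + β = y ^ p * y := by
    refine ⟨(y ^ p * y + x ^ p * x) / (y ^ 2 - x ^ 2),
      -(x ^ p * x) - (y ^ p * y + x ^ p * x) / (y ^ 2 - x ^ 2) * x ^ 2,
      by positivity, ?_, by ring, ?_⟩
    · have : 0 ≤ (y ^ p * y + x ^ p * x) / (y ^ 2 - x ^ 2) * x ^ 2 := by positivity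
      linarith
    · field_simp; ring
  have hlow : ∀ r, x ≤ r → -(r ^ p * r) ≤ κ * r ^ 2 + β := by
    intro r hr
    have h1 : x ^ p ≤ r ^ p := Real.rpow_le_rpow hx.le hr hp0.le
    have h2 : 0 < x ^ p := by positivity
    have h3 : x ^ p * x ≤ r ^ p * r := by nlinarith
    have h4 : κ * x ^ 2 ≤ κ * r ^ 2 := by gcongr
    linarith
  have hsl := slicing h (p := p) (S := frontier Ω ∩ {z | x ≤ ‖z‖ ∧ ‖z‖ ≤ y})
      (h.isCompact.isClosed.inter ((isClosed_le continuous_const continuous_norm).inter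
        (isClosed_le continuous_norm continuous_const)))
      inter_subset_left (by rintro ⟨_, h0⟩; simp only [mem_ofPred_eq, norm_zero] at h0; linarith)
      (A := Acal p κ β) (G := fun r => |κ * r ^ 2 + β|) (Acal_cont hp0) (by fun_prop)
      (fun r => Real.sqrt_nonneg _) (fun r => abs_nonneg _)
      (by
        rintro z ⟨_, hz⟩
        simp only [mem_ofPred_eq] at hz
        apply Acal_sq
        rw [abs_le]
        exact ⟨hlow _ hz.1, conc_between hp0 hp1 hx.le hxy (by linarith) hgy.le hz.1 hz.2⟩)
      (fun ξ => ENNReal.ofReal (2 * Acal p κ β (exp ξ)))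
      (fun θ => ENNReal.ofReal κ * hray (ann Ω x y) θ)
      (psi_points hopen hx.le le_rfl hV (fun r hr hm => by rw [hF] at hm; exact hm)
        (by
          intro r hr hn
          apply Acal_zero hr.le
          by_cases h1 : x < r
          · exact (conc_right hp0 hp1 hx.le hxy (by linarith) hgy (not_lt.mp (fun h2 => hn ⟨h1, h2⟩))).trans
              (le_abs_self _)
          · push Not at h1
            refine le_trans ?_ (neg_le_abs _)
            have h2 : r ^ p ≤ x ^ p := Real.rpow_le_rpow hr.le h1 hp0.le
            have h3 : r ^ p * r ≤ x ^ p * x := by gcongr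
            have h4 : κ * r ^ 2 ≤ κ * x ^ 2 := by gcongr
            linarith))
      (by
        filter_upwards with θ hθ
        by_cases hne : ∃ r0, 0 < r0 ∧ pol r0 θ ∈ ann Ω x y
        · obtain ⟨r0, hr0, hr0m⟩ := hne
          rw [pol_mem_ann hr0.le] at hr0m
          obtain ⟨ρ, hρ1, hρ2, hρ3, hρ4⟩ := ray_outer hopen hx.le hyΩ hr0m.2 hr0m.1
          obtain ⟨α, hα1, hα2, hα3, hα4⟩ := ray_inner hopen hx.le hxΩ hr0m.2 hr0m.1
          have hρ0 : 0 < ρ := by linarith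
          have hα0 : 0 < α := by linarith
          have hne : pol ρ θ ≠ pol α θ := by
            intro he
            have := congrArg norm he
            rw [norm_pol hρ0.le, norm_pol hα0.le] at this
            linarith
          refine ⟨{pol ρ θ, pol α θ}, ?_, ?_, ?_⟩
          · intro z hz
            simp only [Finset.coe_insert, Finset.coe_singleton, mem_insert_iff, mem_singleton_iff] at hz
            rcases hz with rfl | rfl
            · exact ⟨hρ1, by simp only [mem_ofPred_eq]; rw [norm_pol hρ0.le]; exact ⟨by linarith, hρ3⟩⟩
            · exact ⟨hα1, by simp only [mem_ofPred_eq]; rw [norm_pol hα0.le]; exact ⟨hα3, by linarith⟩⟩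
          · intro z hz
            simp only [Finset.mem_insert, Finset.mem_singleton] at hz
            rcases hz with rfl | rfl
            · exact arg_pol hρ0 hθ
            · exact arg_pol hα0 hθ
          · rw [Finset.sum_pair hne, norm_pol hρ0.le, norm_pol hα0.le,
              ← ENNReal.ofReal_add (abs_nonneg _) (abs_nonneg _)]
            have hb := hray_le (U := ann Ω x y) (θ := θ) hα0.le (by linarith : α ≤ ρ)
              (fun r hr hm => ⟨hα4 r hr hm, hρ4 r hr hm⟩)
            calc _ ≤ ENNReal.ofReal κ * ENNReal.ofReal (ρ ^ 2 - α ^ 2) := by gcongr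
              _ = ENNReal.ofReal (κ * (ρ ^ 2 - α ^ 2)) := (ENNReal.ofReal_mul hκ.le).symm
              _ ≤ _ := by
                apply ENNReal.ofReal_le_ofReal
                have h1 := le_abs_self (κ * ρ ^ 2 + β)
                have h2 := neg_le_abs (κ * α ^ 2 + β)
                linarith
        · push Not at hne
          refine ⟨∅, by simp, by simp, ?_⟩
          simp [hray_zero hne])
  refine lt_of_lt_of_le (oneD_II hp0 hp1 hκ hβ hR) (le_trans ?_ hsl)
  gcongr
  rw [lintegral_const_mul' _ _ ENNReal.ofReal_ne_top, polar_hray (ann_open hopen x y).measurableSet, hvol]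
  apply le_of_eq
  rw [show 2 * κ * (π * R ^ 2) = κ * (2 * (π * R ^ 2)) by ring, ENNReal.ofReal_mul hκ.le,
          ENNReal.ofReal_mul zero_le_two]; simp

lemma zone {n : ℕ} {γ : Fin n → ℝ → ℂ} {Ω : Set ℂ} (h : RegCurves γ (frontier Ω)) (hopen : IsOpen Ω)
    (h0 : (0:ℂ) ∉ frontier Ω)
    {p R x y : ℝ} (hp0 : 0 < p) (hp1 : p < 1) (hR : 0 ≤ R) (hx : 0 ≤ x) (hxy : x < y)
    (hxΩ : 0 < x → ∀ z ∈ Ω, ‖z‖ ≠ x)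
    (hyΩ : ∀ z ∈ Ω, ‖z‖ ≠ y) (hV : ∀ᵐ r : ℝ, x < r → r < y → ∃ z ∈ Ω, ‖z‖ = r)
    (hvol : volume (ann Ω x y) = ENNReal.ofReal (π * R ^ 2)) :
    ENNReal.ofReal (2 * π * (R ^ p * R)) < Lp' p (frontier Ω ∩ {z | x ≤ ‖z‖ ∧ ‖z‖ ≤ y}) ∨
    ENNReal.ofReal (2 * π * (y ^ p * y)) ≤ Lp' p (frontier Ω ∩ sphere 0 y) := by
  by_cases hF : (fullR Ω x y).Nonempty
  · exact zone_I h hopen hp0 hp1 hR hx hxy hyΩ hV hvol hF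
  · left
    have hF' : fullR Ω x y = ∅ := not_nonempty_iff_eq_empty.mp hF
    rcases hx.eq_or_lt with hx0 | hx0
    · exfalso
      subst hx0
      -- points of Ω close to the origin
      have hcl : (0:ℂ) ∈ closure Ω := by
        rw [Metric.mem_closure_iff]
        intro ε hε
        have hpos : 0 < volume (Ioo 0 (min ε y)) := by
          rw [Real.volume_Ioo]; simp [hε, hxy]
        have : ∃ r ∈ Ioo 0 (min ε y), (0 < r → r < y → ∃ z ∈ Ω, ‖z‖ = r) := by
          by_contra hc
          push Not at hc
          refine absurd (measure_mono_null ?_ hV) hpos.ne'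
          intro r hr hm
          obtain ⟨h1, h2, h3⟩ := hc r hr
          obtain ⟨z, hz, hzr⟩ := hm h1 h2
          exact h3 z hz hzr
        obtain ⟨r, hr, hrz⟩ := this
        obtain ⟨z, hz, hzr⟩ := hrz hr.1 (lt_of_lt_of_le hr.2 (min_le_right _ _))
        refine ⟨z, hz, ?_⟩
        rw [dist_zero_left, hzr]
        exact lt_of_lt_of_le hr.2 (min_le_left _ _)
      have h0Ω : (0:ℂ) ∈ Ω := by
        by_contra hc
        exact h0 ⟨hcl, by rwa [hopen.interior_eq]⟩
      obtain ⟨ε, hε, hb⟩ := Metric.isOpen_iff.mp hopen 0 h0Ω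
      apply hF
      refine ⟨min ε y / 2, by positivity, ?_, ?_⟩
      · have := min_le_right ε y; linarith
      · intro z1 z2 hz1 _ hn _
        exfalso
        apply hn
        apply hb
        rw [mem_ball_zero_iff, hz1]
        have := min_le_left ε y; linarith
    · exact zone_II h hopen hp0 hp1 hR hx0 hxy (hxΩ hx0) hyΩ hV hvol hF'

/-- decomposition of an open subset of the line, up to null sets, in well separated intervals -/
lemma components {V : Set ℝ} (hV : IsOpen V) {M : ℝ} (hVM : V ⊆ Ioo 0 M) :
    ∃ S : Set (ℝ × ℝ), S.Countable ∧ (∀ k ∈ S, 0 ≤ k.1 ∧ k.1 < k.2 ∧ k.1 ∉ V ∧ k.2 ∉ V ∧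
      (∀ᵐ r : ℝ, k.1 < r → r < k.2 → r ∈ V)) ∧
      (∀ k ∈ S, ∀ l ∈ S, k ≠ l → Disjoint (Icc k.1 k.2) (Icc l.1 l.2)) ∧
      (∀ r ∈ V, ∃ k ∈ S, r ∈ Ioo k.1 k.2) := by
  set W : Set ℝ := {t | ∃ ε > 0, volume (Ioo (t - ε) (t + ε) \ V) = 0} with hW
  have hWo : IsOpen W := by
    rw [Metric.isOpen_iff]
    rintro t ⟨ε, hε, h0⟩
    refine ⟨ε / 2, by positivity, ?_⟩
    intro s hs
    rw [Real.ball_eq_Ioo] at hs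
    refine ⟨ε / 2, by positivity, measure_mono_null (sdiff_subset_sdiff_left (Ioo_subset_Ioo ?_ ?_)) h0⟩
    · linarith [hs.1]
    · linarith [hs.2]
  have hVW : V ⊆ W := by
    intro t ht
    obtain ⟨ε, hε, hb⟩ := Metric.isOpen_iff.mp hV t ht
    rw [Real.ball_eq_Ioo] at hb
    refine ⟨ε, hε, ?_⟩
    rw [sdiff_eq_bot_iff.mpr hb]
    exact measure_empty
  have hnull : volume (W \ V) = 0 := by
    refine measure_null_of_locally_null _ ?_
    rintro t ⟨⟨ε, hε, h0⟩, -⟩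
    refine ⟨Ioo (t - ε) (t + ε) ∩ (W \ V), inter_mem (mem_nhdsWithin_of_mem_nhds
      (Ioo_mem_nhds (by linarith) (by linarith))) self_mem_nhdsWithin, ?_⟩
    refine measure_mono_null ?_ h0
    rintro s ⟨h1, -, h2⟩
    exact ⟨h1, h2⟩
  have hWM : W ⊆ Ioo 0 M := by
    rintro t ⟨ε, hε, h0⟩
    constructor
    · by_contra hc
      push Not at hc
      have : volume (Ioo (t - ε) t) = 0 := by
        refine measure_mono_null ?_ h0
        rintro s ⟨h1, h2⟩
        refine ⟨⟨h1, by linarith⟩, fun h => ?_⟩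
        linarith [(hVM h).1]
      rw [Real.volume_Ioo, ENNReal.ofReal_eq_zero] at this
      linarith
    · by_contra hc
      push Not at hc
      have : volume (Ioo t (t + ε)) = 0 := by
        refine measure_mono_null ?_ h0
        rintro s ⟨h1, h2⟩
        refine ⟨⟨by linarith, by linarith⟩, fun h => ?_⟩
        linarith [(hVM h).2]
      rw [Real.volume_Ioo, ENNReal.ofReal_eq_zero] at this
      linarith
  set S : Set (ℝ × ℝ) := {k | k.1 < k.2 ∧ Ioo k.1 k.2 ⊆ W ∧ k.1 ∉ W ∧ k.2 ∉ W} with hS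
  have hdis : ∀ k ∈ S, ∀ l ∈ S, k ≠ l → Disjoint (Ioo k.1 k.2) (Ioo l.1 l.2) := by
    rintro ⟨a, b⟩ ⟨hab, h1, h2, h3⟩ ⟨c, d⟩ ⟨hcd, h4, h5, h6⟩ hne
    rw [Set.disjoint_left]
    rintro r ⟨r1, r2⟩ ⟨r3, r4⟩
    simp only at *
    apply hne
    have e1 : a = c := by
      rcases lt_trichotomy a c with h | h | h
      · exact absurd (h1 ⟨h, by linarith⟩) h5
      · exact h
      · exact absurd (h4 ⟨h, by linarith⟩) h2
    have e2 : b = d := by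
      rcases lt_trichotomy b d with h | h | h
      · exact absurd (h4 ⟨by linarith, h⟩) h3
      · exact h
      · exact absurd (h1 ⟨by linarith, h⟩) h6
    rw [e1, e2]
  -- no shared end points
  have hshare : ∀ a b c, a < b → b < c → Ioo a b ⊆ W → Ioo b c ⊆ W → b ∈ W := by
    intro a b c hab hbc h1 h2
    refine ⟨min (b - a) (c - b), lt_min (by linarith) (by linarith), ?_⟩
    refine measure_mono_null (t := (W \ V) ∪ {b}) ?_ (measure_union_null hnull (by simp))
    rintro s ⟨⟨s1, s2⟩, hs⟩
    have := min_le_left (b - a) (c - b)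
    have := min_le_right (b - a) (c - b)
    rcases lt_trichotomy s b with h | h | h
    · exact Or.inl ⟨h1 ⟨by linarith, h⟩, hs⟩
    · exact Or.inr h
    · exact Or.inl ⟨h2 ⟨h, by linarith⟩, hs⟩
  refine ⟨S, ?_, ?_, ?_, ?_⟩
  · refine Set.PairwiseDisjoint.countable_of_isOpen (s := fun k : ℝ × ℝ => Ioo k.1 k.2) ?_ ?_ ?_
    · intro k hk l hl hne
      exact hdis k hk l hl hne
    · intro k _; exact isOpen_Ioo
    · intro k hk; exact nonempty_Ioo.mpr hk.1
  · rintro ⟨a, b⟩ ⟨hab, h1, h2, h3⟩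
    refine ⟨?_, hab, fun h => h2 (hVW h), fun h => h3 (hVW h), ?_⟩
    · by_contra hc
      push Not at hc
      simp only at *
      obtain ⟨r, hr1, hr2⟩ := exists_between (lt_min hab hc)
      have := (hWM (h1 ⟨hr1, hr2.trans_le (min_le_left _ _)⟩)).1
      linarith [min_le_right b 0]
    · have : ∀ᵐ r : ℝ, r ∉ W \ V := measure_eq_zero_iff_ae_notMem.mp hnull
      filter_upwards [this] with r hr r1 r2
      by_contra hc
      exact hr ⟨h1 ⟨r1, r2⟩, hc⟩
  · rintro ⟨a, b⟩ hk ⟨c, d⟩ hl hne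
    have hd := hdis _ hk _ hl hne
    obtain ⟨hab, h1, h2, h3⟩ := hk
    obtain ⟨hcd, h4, h5, h6⟩ := hl
    rw [Set.disjoint_left]
    rintro r ⟨r1, r2⟩ ⟨r3, r4⟩
    simp only at *
    rw [Ioo_disjoint_Ioo] at hd
    rcases min_le_iff.mp hd with h | h <;> rcases le_max_iff.mp h with h' | h'
    · linarith
    · have e : b = c := by linarith
      subst e
      exact h3 (hshare a b d hab hcd h1 h4)
    · have e : a = d := by linarith
      subst e
      exact h2 (hshare c a b hcd hab h4 h1)
    · linarith
  · intro r hr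
    have hrW := hVW hr
    have hr2 := hWM hrW
    have hA : IsClosed (Iic r ∩ Wᶜ) := isClosed_Iic.inter hWo.isClosed_compl
    have hB : IsClosed (Ici r ∩ Wᶜ) := isClosed_Ici.inter hWo.isClosed_compl
    have hAb : BddAbove (Iic r ∩ Wᶜ) := bddAbove_Iic.mono inter_subset_left
    have hBb : BddBelow (Ici r ∩ Wᶜ) := bddBelow_Ici.mono inter_subset_left
    have ha := hA.csSup_mem ⟨0, hr2.1.le, fun h => lt_irrefl _ (hWM h).1⟩ hAb
    have hb := hB.csInf_mem ⟨M, hr2.2.le, fun h => lt_irrefl _ (hWM h).2⟩ hBb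
    set a := sSup (Iic r ∩ Wᶜ) with hadef
    set b := sInf (Ici r ∩ Wᶜ) with hbdef
    have har : a < r := lt_of_le_of_ne ha.1 (fun e => ha.2 (e ▸ hrW))
    have hbr : r < b := lt_of_le_of_ne hb.1 (fun e => hb.2 (e ▸ hrW))
    refine ⟨(a, b), ⟨har.trans hbr, ?_, ha.2, hb.2⟩, har, hbr⟩
    rintro s ⟨s1, s2⟩
    by_contra hc
    simp only at *
    rcases le_total s r with h | h
    · exact absurd (le_csSup hAb ⟨h, hc⟩) (not_le.mpr s1)
    · exact absurd (csInf_le hBb ⟨h, hc⟩) (not_le.mpr s2)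

lemma vol_to_R {v : ℝ≥0∞} (hv : v ≠ ⊤) : v = ENNReal.ofReal (π * (√(v.toReal / π)) ^ 2) := by
  rw [Real.sq_sqrt (by positivity), mul_div_cancel₀ _ pi_pos.ne', ENNReal.ofReal_toReal hv]

lemma main_lt {n : ℕ} {γ : Fin n → ℝ → ℂ} {Ω : Set ℂ} (h : RegCurves γ (frontier Ω)) (hopen : IsOpen Ω)
    (h0 : (0:ℂ) ∉ frontier Ω) {p R M : ℝ} (hp0 : 0 < p) (hp1 : p < 1) (hR : 0 < R) (hM : Ω ⊆ ball 0 M)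
    (hvol : volume Ω = ENNReal.ofReal (π * R ^ 2))
    (hL : Lp' p (frontier Ω) ≤ ENNReal.ofReal (2 * π * (R ^ p * R))) : ∃ y, Ω = ball 0 y := by
  set V : Set ℝ := norm '' (Ω \ {0}) with hVdef
  have hVo : IsOpen V := by
    rw [Metric.isOpen_iff]
    rintro _ ⟨z, ⟨hz, hz0⟩, rfl⟩
    have hz0 : 0 < ‖z‖ := norm_pos_iff.mpr hz0
    have hc : Continuous fun r : ℝ => (r : ℂ) * (z / ‖z‖) := by fun_prop
    have hm : (‖z‖ : ℝ) ∈ (fun r : ℝ => (r : ℂ) * (z / ‖z‖)) ⁻¹' Ω ∩ Ioi 0 := by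
      refine ⟨?_, hz0⟩
      show (‖z‖ : ℂ) * (z / ‖z‖) ∈ Ω
      rw [mul_div_cancel₀ _ (by exact_mod_cast hz0.ne')]
      exact hz
    obtain ⟨ε, hε, hb⟩ := Metric.isOpen_iff.mp ((hopen.preimage hc).inter isOpen_Ioi) _ hm
    refine ⟨ε, hε, fun r hr => ?_⟩
    obtain ⟨h1, h2⟩ := hb hr
    have h2 : 0 < r := h2
    have hn : ‖(r : ℂ) * (z / ‖z‖)‖ = r := by
      rw [norm_mul, norm_div, Complex.norm_real, Complex.norm_real, norm_norm, div_self hz0.ne', mul_one,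
        Real.norm_of_nonneg h2.le]
    refine ⟨_, ⟨h1, ?_⟩, hn⟩
    intro e
    have e : (r : ℂ) * (z / ‖z‖) = 0 := e
    rw [e, norm_zero] at hn
    linarith
  have hVM : V ⊆ Ioo 0 M := by
    rintro _ ⟨z, ⟨hz, hz0⟩, rfl⟩
    exact ⟨norm_pos_iff.mpr hz0, by simpa using hM hz⟩
  obtain ⟨S, hSc, hS, hSd, hcov⟩ := components hVo hVM
  have hnV : ∀ {x : ℝ}, 0 < x → x ∉ V → ∀ z ∈ Ω, ‖z‖ ≠ x := by
    intro x hx hxV z hz e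
    refine hxV ⟨z, ⟨hz, fun hz0 => ?_⟩, e⟩
    rw [mem_singleton_iff] at hz0
    rw [hz0, norm_zero] at e
    linarith
  have : Countable S := hSc.to_subtype
  set v : S → ℝ≥0∞ := fun k => volume (ann Ω k.1.1 k.1.2) with hv
  set L : S → ℝ≥0∞ := fun k => Lp' p (frontier Ω ∩ {z | k.1.1 ≤ ‖z‖ ∧ ‖z‖ ≤ k.1.2}) with hLdef
  have hvle : ∀ k, v k ≤ volume Ω := fun k => measure_mono inter_subset_left
  have hvt : ∀ k, v k ≠ ⊤ := fun k => ne_top_of_le_ne_top (hvol ▸ ENNReal.ofReal_ne_top) (hvle k)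
  have hsumv : volume Ω ≤ ∑' k, v k := by
    have hs : Ω ⊆ {0} ∪ ⋃ k : S, ann Ω k.1.1 k.1.2 := by
      intro z hz
      by_cases hz0 : z = 0
      · exact Or.inl hz0
      · obtain ⟨k, hk, hk2⟩ := hcov ‖z‖ ⟨z, ⟨hz, hz0⟩, rfl⟩
        exact Or.inr (mem_iUnion.mpr ⟨⟨k, hk⟩, hz, hk2⟩)
    refine (measure_mono hs).trans ((measure_union_le _ _).trans ?_)
    rw [measure_singleton, zero_add]
    exact measure_iUnion_le _
  have hclosed : ∀ k : S, MeasurableSet (frontier Ω ∩ {z | k.1.1 ≤ ‖z‖ ∧ ‖z‖ ≤ k.1.2}) := by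
    intro k
    refine (isClosed_frontier.inter ?_).measurableSet
    exact (isClosed_le continuous_const continuous_norm).inter (isClosed_le continuous_norm continuous_const)
  have hsumL : ∑' k, L k ≤ Lp' p (frontier Ω) := by
    have := lintegral_iUnion (μ := μH[1]) hclosed (by
      intro k l hkl
      refine Set.disjoint_left.mpr ?_
      rintro z ⟨-, h1⟩ ⟨-, h2⟩
      exact Set.disjoint_left.mp (hSd k.1 k.2 l.1 l.2 (fun e => hkl (Subtype.ext e))) h1 h2)
      (fun z : ℂ => ENNReal.ofReal (‖z‖ ^ p))
    refine this.symm.le.trans (Lp'_mono (iUnion_subset fun k => inter_subset_left))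
  set c : ℝ≥0∞ := ENNReal.ofReal (2 * R ^ (p - 1)) with hc
  have hRp : R ^ (p - 1) * R ^ 2 = R ^ p * R := by
    rw [Real.rpow_sub_one hR.ne']; field_simp
  have hcR : c * volume Ω = ENNReal.ofReal (2 * π * (R ^ p * R)) := by
    rw [hc, hvol, ← ENNReal.ofReal_mul (by positivity), ← hRp]
    congr 1; ring
  obtain ⟨k, hk⟩ : ∃ k, L k ≤ c * v k := by
    by_contra hno
    push Not at hno
    have hne : Nonempty S := by
      by_contra hemp
      rw [not_nonempty_iff] at hemp
      rw [tsum_empty, hvol, nonpos_iff_eq_zero, ENNReal.ofReal_eq_zero] at hsumv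
      have : 0 < π * R ^ 2 := by positivity
      linarith
    obtain ⟨k0⟩ := hne
    have hsv : c * volume Ω ≤ ∑' k, c * v k := by
      rw [ENNReal.tsum_mul_left]; gcongr
    have hsl : ∑' k, L k ≤ ENNReal.ofReal (2 * π * (R ^ p * R)) := hsumL.trans hL
    have hcl : ∑' k, c * v k ≤ ∑' k, L k := ENNReal.tsum_le_tsum fun k => (hno k).le
    have hlt : ∑' k, c * v k < ∑' k, L k :=
      ENNReal.tsum_lt_tsum (i := k0) (ne_top_of_le_ne_top ENNReal.ofReal_ne_top (hcl.trans hsl))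
        (fun k => (hno k).le) (hno k0)
    rw [hcR] at hsv
    exact absurd (hsv.trans_lt (hlt.trans_le hsl)) (lt_irrefl _)
  obtain ⟨hx0, hxy, hxV, hyV, hae⟩ := hS k.1 k.2
  set x := k.1.1 with hxdef
  set y := k.1.2 with hydef
  have hy0 : 0 < y := hx0.trans_lt hxy
  set ρ := √((v k).toReal / π) with hρ
  have hvk : v k = ENNReal.ofReal (π * ρ ^ 2) := vol_to_R (hvt k)
  have hρ0 : 0 < ρ := by
    -- the zone is not empty
    have hpos : 0 < v k := by
      refine (ann_open hopen x y).measure_pos _ ?_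
      by_contra hemp
      have : ∀ᵐ r : ℝ, r ∉ Ioo x y := by
        filter_upwards [hae] with r hr hr2
        obtain ⟨z, hz, e⟩ := hr hr2.1 hr2.2
        exact hemp ⟨z, hz.1, by rw [mem_ofPred_eq, e]; exact hr2⟩
      have := measure_eq_zero_iff_ae_notMem.mpr this
      rw [Real.volume_Ioo, ENNReal.ofReal_eq_zero] at this
      linarith
    rw [hρ]
    have := ENNReal.toReal_pos hpos.ne' (hvt k)
    positivity
  have hρR : ρ ≤ R := by
    have := hvle k
    rw [hvk, hvol, ENNReal.ofReal_le_ofReal_iff (by positivity)] at this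
    exact le_of_sq_le_sq (le_of_mul_le_mul_left this pi_pos) hR.le
  have hρy : ρ ≤ y := by
    have : v k ≤ volume (ball (0:ℂ) y) := measure_mono fun z hz => by simpa using hz.2.2
    rw [hvk, vol_ball_C hy0.le, ENNReal.ofReal_le_ofReal_iff (by positivity)] at this
    exact le_of_sq_le_sq (le_of_mul_le_mul_left this pi_pos) hy0.le
  have hcv : c * v k = ENNReal.ofReal (2 * π * (R ^ (p - 1) * ρ ^ 2)) := by
    rw [hc, hvk, ← ENNReal.ofReal_mul (by positivity)]
    congr 1; ring
  have hρp : ρ ^ (p - 1) * ρ ^ 2 = ρ ^ p * ρ := by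
    rw [Real.rpow_sub_one hρ0.ne']; field_simp
  have hmono : R ^ (p - 1) ≤ ρ ^ (p - 1) := Real.rpow_le_rpow_of_nonpos hρ0 hρR (by linarith)
  have hle2 : R ^ (p - 1) * ρ ^ 2 ≤ ρ ^ p * ρ := by rw [← hρp]; gcongr
  rw [hcv] at hk
  have hz := zone h hopen h0 hp0 hp1 hρ0.le hx0 hxy (fun hx => hnV hx hxV) (hnV hy0 hyV)
    (by filter_upwards [hae] with r hr r1 r2
        obtain ⟨z, hz, e⟩ := hr r1 r2
        exact ⟨z, hz.1, e⟩) hvk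
  rcases hz with hz | hz
  · exfalso
    have := hz.trans_le hk
    rw [ENNReal.ofReal_lt_ofReal_iff_of_nonneg (by positivity)] at this
    nlinarith [pi_pos]
  have hsL : Lp' p (frontier Ω ∩ sphere 0 y) ≤ L k := by
    refine Lp'_mono ?_
    rintro z ⟨h1, h2⟩
    rw [mem_sphere_zero_iff_norm] at h2
    exact ⟨h1, by rw [mem_ofPred_eq, h2]; exact ⟨hxy.le, le_rfl⟩⟩
  have hyle := hz.trans (hsL.trans hk)
  rw [ENNReal.ofReal_le_ofReal_iff (by positivity)] at hyle
  have hyle : y ^ p * y ≤ R ^ (p - 1) * ρ ^ 2 := le_of_mul_le_mul_left hyle (by positivity)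
  have hyρ : y = ρ := by
    refine le_antisymm ?_ hρy
    by_contra hcon
    push Not at hcon
    have h1 : ρ ^ p ≤ y ^ p := Real.rpow_le_rpow hρ0.le hcon.le hp0.le
    have h2 : 0 < y ^ p := by positivity
    nlinarith
  have hRρ : R = ρ := by
    refine le_antisymm ?_ hρR
    by_contra hcon
    push Not at hcon
    have h1 : R ^ (p - 1) < ρ ^ (p - 1) := Real.rpow_lt_rpow_of_neg hρ0 hcon (by linarith)
    have h2 : R ^ (p - 1) * ρ ^ 2 < ρ ^ (p - 1) * ρ ^ 2 := by gcongr
    rw [hρp, ← hyρ] at h2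
    rw [← hyρ] at hyle
    linarith
  have hyR : y = R := hyρ.trans hRρ.symm
  have hsub : Ω ⊆ ball 0 y := by
    intro z hz
    rw [mem_ball_zero_iff]
    by_contra hcon
    push Not at hcon
    have hgt : y < ‖z‖ := lt_of_le_of_ne hcon (hnV hy0 hyV z hz).symm
    have hO : IsOpen (Ω ∩ {z | y < ‖z‖}) := hopen.inter (isOpen_lt continuous_const continuous_norm)
    have hpos := hO.measure_pos volume ⟨z, hz, hgt⟩
    have hd : Disjoint (ann Ω x y) (Ω ∩ {z | y < ‖z‖}) := by
      refine Set.disjoint_left.mpr ?_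
      rintro w ⟨-, -, h1⟩ ⟨-, h2⟩
      exact lt_asymm h1 h2
    have hun := measure_union (μ := volume) hd hO.measurableSet
    have hle : volume (ann Ω x y ∪ Ω ∩ {z | y < ‖z‖}) ≤ volume Ω :=
      measure_mono (union_subset inter_subset_left inter_subset_left)
    have hvk' : volume (ann Ω x y) = volume Ω := by
      rw [hvol, hRρ]; exact hvk
    rw [hun, hvk'] at hle
    have hfin : volume Ω ≠ ⊤ := hvol ▸ ENNReal.ofReal_ne_top
    exact absurd hle (not_le.mpr (ENNReal.lt_add_right hfin hpos.ne'))
  refine ⟨y, fin_lemma h hopen hy0 hsub ?_ ?_ hz⟩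
  · rw [hvol, hyR]
  · rw [hyR]; exact hL

lemma RegCurves.finite {n : ℕ} {γ : Fin n → ℝ → ℂ} {Γ : Set ℂ} (h : RegCurves γ Γ) :
    μH[1] Γ < ⊤ := by
  have hi : ∀ i, μH[1] (range (γ i)) < ⊤ := by
    intro i
    obtain ⟨K, hK⟩ := ((h.smooth i).locallyLipschitz.locallyLipschitzOn (s := Icc (0:ℝ) 1)).exists_lipschitzOnWith_of_compact isCompact_Icc
    rw [h.range_eq]
    refine (hK.hausdorffMeasure_image_le zero_le_one).trans_lt ?_
    rw [hausdorffMeasure_real, Real.volume_Icc]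
    exact ENNReal.mul_lt_top (by simp) ENNReal.ofReal_lt_top
  rw [h.eq]
  exact (measure_iUnion_le _).trans_lt (by rw [tsum_fintype]; exact ENNReal.sum_lt_top.mpr fun i _ => hi i)

lemma RegCurves.Lp_eq {n : ℕ} {γ : Fin n → ℝ → ℂ} {Γ : Set ℂ} (h : RegCurves γ Γ) {p : ℝ} (hp : 0 < p) :
    Lp' p Γ = ENNReal.ofReal (∫ z in Γ, ‖z‖ ^ p ∂μH[1]) := by
  have hcont : Continuous fun z : ℂ => ‖z‖ ^ p := continuous_norm.rpow_const fun _ => Or.inr hp.le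
  rw [ofReal_integral_eq_lintegral_ofReal]
  · rfl
  · exact hcont.continuousOn.integrableOn_of_subset_isCompact h.isCompact h.isCompact.measurableSet subset_rfl h.finite.ne
  · filter_upwards with z
    positivity

lemma main_C {n : ℕ} {γ : Fin n → ℝ → ℂ} {Ω : Set ℂ} (h : RegCurves γ (frontier Ω)) (hopen : IsOpen Ω)
    (hb : Bornology.IsBounded Ω) {p : ℝ} (hp : 0 < p) (h0 : (0:ℂ) ∉ frontier Ω ∨ 1 ≤ p)
    (heq : ((volume Ω).toReal / π) ^ ((p + 1) / 2) =
      (1 / (2 * π)) * ∫ x in frontier Ω, ‖x‖ ^ p ∂μH[1]) : ∃ y, Ω = ball 0 y := by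
  rcases Ω.eq_empty_or_nonempty with he | hne
  · exact ⟨0, by rw [he, ball_zero]⟩
  have hfin : volume Ω ≠ ⊤ := hb.measure_lt_top.ne
  have hpos := hopen.measure_pos volume hne
  set R := √((volume Ω).toReal / π) with hR
  have hR0 : 0 < R := by
    have := ENNReal.toReal_pos hpos.ne' hfin
    rw [hR]; positivity
  have hvol : volume Ω = ENNReal.ofReal (π * R ^ 2) := vol_to_R hfin
  have hRR : ((volume Ω).toReal / π) ^ ((p + 1) / 2) = R ^ p * R := by
    have e : (volume Ω).toReal / π = R ^ (2:ℝ) := by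
      rw [Real.rpow_two, hR, Real.sq_sqrt (by positivity)]
    rw [e, ← Real.rpow_mul hR0.le, ← Real.rpow_add_one hR0.ne']
    congr 1; ring
  have hL : Lp' p (frontier Ω) ≤ ENNReal.ofReal (2 * π * (R ^ p * R)) := by
    rw [h.Lp_eq hp, ← hRR, heq]
    apply le_of_eq
    congr 1
    field_simp
  obtain ⟨M, hM⟩ := hb.subset_ball 0
  rcases le_or_gt 1 p with h1 | h1
  · exact main_ge h hopen h1 hR0 hM hvol hL
  · exact main_lt h hopen (h0.resolve_right (not_le.mpr h1)) hp h1 hR0 hM hvol hL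

lemma main_E (p : ℝ) (hp : 0 < p)
    (Ω : Set (EuclideanSpace ℝ (Fin 2)))
    (hopen : IsOpen Ω) (hbdd : Bornology.IsBounded Ω)
    (hbry : ∃ (n : ℕ) (γ : Fin n → ℝ → EuclideanSpace ℝ (Fin 2)),
    (∀ i, ContDiff ℝ 2 (γ i)) ∧ (∀ i, Function.Periodic (γ i) 1) ∧
    (∀ i t, deriv (γ i) t ≠ 0) ∧ frontier Ω = ⋃ i, Set.range (γ i))
    (h : (0 : EuclideanSpace ℝ (Fin 2)) ∉ frontier Ω ∨ 1 ≤ p)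
    (heq : ((volume Ω).toReal / π) ^ ((p + 1) / 2) =
      (1 / (2 * π)) * ∫ x in frontier Ω, ‖x‖ ^ p ∂μH[1]) :
    ∃ rad : ℝ, Ω = ball (0 : EuclideanSpace ℝ (Fin 2)) rad := by
  obtain ⟨n, γ, hs, hper, hreg, hfr⟩ := hbry
  let e : ℂ ≃ₗᵢ[ℝ] EuclideanSpace ℝ (Fin 2) := Complex.orthonormalBasisOneI.repr
  have hfr' : frontier (e ⁻¹' Ω) = e ⁻¹' (frontier Ω) := (e.toHomeomorph.preimage_frontier Ω).symm
  have hreg' : RegCurves (fun i t => e.symm (γ i t)) (frontier (e ⁻¹' Ω)) := by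
    refine ⟨fun i => ?_, fun i t => ?_, fun i t => ?_, ?_⟩
    · exact e.symm.contDiff.comp ((hs i).of_le (by norm_num))
    · simp only [hper i t]
    · have hd : HasDerivAt (γ i) (deriv (γ i) t) t :=
        (((hs i).differentiable (by norm_num)) t).hasDerivAt
      have := (e.symm.toContinuousLinearEquiv.toContinuousLinearMap.hasFDerivAt (x := γ i t)).comp_hasDerivAt t hd
      have h2 : deriv (fun t => e.symm (γ i t)) t = e.symm (deriv (γ i) t) := this.deriv
      rw [h2]
      simpa using hreg i t
    · rw [hfr', hfr, preimage_iUnion]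
      refine iUnion_congr fun i => ?_
      ext z
      constructor
      · rintro ⟨t, ht⟩
        exact ⟨t, by simp [ht]⟩
      · rintro ⟨t, ht⟩
        exact ⟨t, by simp [← ht]⟩
  have hv : volume (e ⁻¹' Ω) = volume Ω :=
    e.measurePreserving.measure_preimage hopen.measurableSet.nullMeasurableSet
  have hintg : ∫ x in frontier (e ⁻¹' Ω), ‖x‖ ^ p ∂μH[1] = ∫ x in frontier Ω, ‖x‖ ^ p ∂μH[1] := by
    have hmp := e.toIsometryEquiv.measurePreserving_hausdorffMeasure 1
    have := hmp.setIntegral_preimage_emb e.toHomeomorph.measurableEmbedding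
      (fun x => ‖x‖ ^ p) (frontier Ω)
    rw [hfr', ← this]
    refine integral_congr_ae ?_
    filter_upwards with z
    have : ‖e z‖ = ‖z‖ := e.norm_map z
    show ‖z‖ ^ p = ‖e z‖ ^ p
    rw [this]
  have hbd : Bornology.IsBounded (e ⁻¹' Ω) := e.antilipschitz.isBounded_preimage hbdd
  obtain ⟨y, hy⟩ := main_C hreg' (hopen.preimage e.continuous) hbd hp (by
    refine h.imp_left fun h0 => ?_
    rw [hfr', mem_preimage, map_zero]
    exact h0) (by rw [hv, hintg]; exact heq)
  refine ⟨y, ?_⟩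
  ext z
  have : e.symm z ∈ e ⁻¹' Ω ↔ e.symm z ∈ ball (0:ℂ) y := by rw [hy]
  simpa using this

end Helpers

/-- Theorem 2.1 (iv): for `p > 0`, a bounded open set `Ω` with `C²` boundary
achieving equality in the weighted isoperimetric inequality is a disc centered
at the origin, provided `0 ∉ ∂Ω`; for `p ≥ 1` the hypothesis `0 ∉ ∂Ω` can be
dropped. -/
theorem weighted_isoperimetric_equality
    (p : ℝ) (hp : 0 < p)
    (Ω : Set (EuclideanSpace ℝ (Fin 2)))
    (hopen : IsOpen Ω) (hbdd : Bornology.IsBounded Ω)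
    (hbry : HasC2Boundary Ω)
    (h : (0 : EuclideanSpace ℝ (Fin 2)) ∉ frontier Ω ∨ 1 ≤ p)
    (heq : ((volume Ω).toReal / π) ^ ((p + 1) / 2) =
      (1 / (2 * π)) * ∫ x in frontier Ω, ‖x‖ ^ p ∂μH[1]) :
    ∃ rad : ℝ, Ω = ball (0 : EuclideanSpace ℝ (Fin 2)) rad := by
  exact main_E p hp Ω hopen hbdd hbry h heq
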